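/- arXiv:2403.03343 — 4 statements merged into one kernel-verified Lean document; each statement's English description precedes it below -/
import Mathlib

section
/- Let φ : ℝ → ℂ be a C^∞ function with compact support and define I(s) = ∫₀^∞ x^s φ(x) dx, where x^s := exp(s·log x) for x > 0. Then: (a) for every s ∈ ℂ with Re(s) > -1 the function x ↦ x^s φ(x) is Lebesgue integrable on (0,∞) and I is holomorphic on the half-plane {s ∈ ℂ : Re(s) > -1}; (b) there exists a meromorphic function G on ℂ such that G(s) = I(s) whenever Re(s) > -1, and every pole of G is a simple pole lying in the set of negative integers. -/
open MeasureTheory Filter Set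

/-- The integral `I(s) = ∫₀^∞ x^s φ(x) dx`, with `x^s := exp(s · log x)` for `x > 0`. -/
noncomputable def zetaI (φ : ℝ → ℂ) (s : ℂ) : ℂ :=
  ∫ x in Set.Ioi (0 : ℝ), Complex.exp (s * (Real.log x : ℂ)) * φ x

/-- `s₀` is a pole of `G`: `‖G‖` tends to infinity along the punctured neighbourhood filter. -/
def IsPole (G : ℂ → ℂ) (s₀ : ℂ) : Prop :=
  Filter.Tendsto (fun s => ‖G s‖) (nhdsWithin s₀ {s₀}ᶜ) Filter.atTop

/-- `s₀` is a simple pole of `G`: `(s - s₀) · G(s)` has a finite nonzero limit at `s₀`. -/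
def IsSimplePole (G : ℂ → ℂ) (s₀ : ℂ) : Prop :=
  ∃ c : ℂ, c ≠ 0 ∧
    Filter.Tendsto (fun s => (s - s₀) * G s) (nhdsWithin s₀ {s₀}ᶜ) (nhds c)

open Topology

lemma top_bigO (f : ℝ → ℂ) (hfc : HasCompactSupport f) (a : ℝ) :
    f =O[atTop] (fun x : ℝ => x ^ (-a)) := by
  have h : f =ᶠ[atTop] 0 :=
    (hasCompactSupport_iff_eventuallyEq.mp hfc).filter_mono
      (by rw [Filter.coclosedCompact_eq_cocompact]; exact atTop_le_cocompact)
  exact h.trans_isBigO (Asymptotics.isBigO_zero _ _)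

lemma bot_bigO (f : ℝ → ℂ) (hf : Continuous f) :
    f =O[𝓝[>] 0] (fun x : ℝ => x ^ (-(0:ℝ))) := by
  simp only [neg_zero, Real.rpow_zero]
  exact (hf.tendsto 0 |>.mono_left nhdsWithin_le_nhds).isBigO_one ℝ

lemma mconv (f : ℝ → ℂ) (hf : Continuous f) (hfc : HasCompactSupport f) (s : ℂ)
    (hs : 0 < s.re) : MellinConvergent f s :=
  mellinConvergent_of_isBigO_rpow (a := s.re + 1) (b := 0)
    (hf.locallyIntegrable.locallyIntegrableOn _) (top_bigO f hfc _) (by linarith)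
    (bot_bigO f hf) hs

lemma mdiff (f : ℝ → ℂ) (hf : Continuous f) (hfc : HasCompactSupport f) (s : ℂ)
    (hs : 0 < s.re) : DifferentiableAt ℂ (mellin f) s :=
  mellin_differentiableAt_of_isBigO_rpow (a := s.re + 1) (b := 0)
    (hf.locallyIntegrable.locallyIntegrableOn _) (top_bigO f hfc _) (by linarith)
    (bot_bigO f hf) hs

lemma mellin_parts (f : ℝ → ℂ) (hf : ContDiff ℝ (⊤ : ℕ∞) f) (hfc : HasCompactSupport f) (s : ℂ)
    (hs : 0 < s.re) : mellin f s = -s⁻¹ * mellin (deriv f) (s + 1) := by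
  have hs0 : s ≠ 0 := by rintro rfl; simp at hs
  have hdc : Continuous (deriv f) := hf.continuous_deriv (by simp)
  have h1 := mconv f hf.continuous hfc s hs
  have h2 := mconv (deriv f) hdc hfc.deriv (s + 1) (by simp; linarith)
  unfold MellinConvergent at h1 h2
  have key := integral_Ioi_mul_deriv_eq_deriv_mul (a := (0:ℝ)) (u := f) (u' := deriv f)
    (v := fun x : ℝ => (x : ℂ) ^ s / s) (v' := fun x : ℝ => (x : ℂ) ^ (s - 1))
    (a' := 0) (b' := 0)
    (fun x _ => (hf.differentiable (by simp) x).hasDerivAt)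
    (fun x hx => by
      have := (hasDerivAt_ofReal_cpow_const (x := x) (ne_of_gt hx) hs0).div_const s
      rwa [mul_div_cancel_left₀ _ hs0] at this)
    (h1.congr_fun (fun x _ => by simp [mul_comm]) measurableSet_Ioi)
    (IntegrableOn.congr_fun (Integrable.const_mul h2 s⁻¹) (fun x _ => by
      simp [div_eq_mul_inv]; ring) measurableSet_Ioi)
    (by
      have hc : Continuous (f * fun x : ℝ => (x : ℂ) ^ s / s) := by
        refine hf.continuous.mul (Continuous.div_const ?_ s)
        exact Complex.continuous_ofReal_cpow_const hs
      have := (hc.tendsto 0).mono_left (nhdsWithin_le_nhds (s := Ioi 0))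
      simpa [hs0] using this)
    (by
      have h : f =ᶠ[atTop] 0 :=
        (hasCompactSupport_iff_eventuallyEq.mp hfc).filter_mono
          (by rw [Filter.coclosedCompact_eq_cocompact]; exact atTop_le_cocompact)
      refine tendsto_const_nhds.congr' ?_
      filter_upwards [h] with x hx
      simp [hx])
  have e1 : mellin f s = ∫ x in Ioi (0:ℝ), f x * (x : ℂ) ^ (s - 1) := by
    unfold mellin; congr 1; ext x; simp [mul_comm]
  have e2 : s⁻¹ * mellin (deriv f) (s + 1) = ∫ x in Ioi (0:ℝ), deriv f x * ((x : ℂ) ^ s / s) := by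
    unfold mellin
    rw [← integral_const_mul]
    congr 1; ext x; simp [div_eq_mul_inv]; ring
  rw [e1, key, ← e2]; ring

lemma zeta_integrand (f : ℝ → ℂ) (s : ℂ) : ∀ x ∈ Ioi (0:ℝ),
    (x : ℂ) ^ (s + 1 - 1) • f x = Complex.exp (s * (Real.log x : ℂ)) * f x := by
  intro x hx
  have hx' : (x : ℂ) ≠ 0 := by exact_mod_cast (ne_of_gt hx)
  rw [add_sub_cancel_right, Complex.cpow_def_of_ne_zero hx', Complex.ofReal_log (le_of_lt hx),
    mul_comm s, smul_eq_mul]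

lemma zetaI_eq (f : ℝ → ℂ) (s : ℂ) : zetaI f s = mellin f (s + 1) :=
  (setIntegral_congr_fun measurableSet_Ioi (zeta_integrand f s)).symm

noncomputable def cN (n : ℕ) (s : ℂ) : ℂ := ∏ j ∈ Finset.range n, (-(s + j + 1)⁻¹)

noncomputable def gN (f : ℝ → ℂ) (n : ℕ) (s : ℂ) : ℂ :=
  cN n s * mellin (deriv^[n] f) (s + n + 1)

section
variable (f : ℝ → ℂ) (hf : ContDiff ℝ (⊤ : ℕ∞) f) (hfc : HasCompactSupport f)

lemma iter_cs {f : ℝ → ℂ} (hfc : HasCompactSupport f) (n : ℕ) :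
    HasCompactSupport (deriv^[n] f) := by
  induction n with
  | zero => simpa
  | succ n ih => rw [Function.iterate_succ_apply']; exact ih.deriv

lemma iter_cd {f : ℝ → ℂ} (hf : ContDiff ℝ (⊤ : ℕ∞) f) (n : ℕ) :
    ContDiff ℝ (⊤ : ℕ∞) (deriv^[n] f) := ContDiff.iterate_deriv n hf

lemma gN_succ {f : ℝ → ℂ} (hf : ContDiff ℝ (⊤ : ℕ∞) f) (hfc : HasCompactSupport f)
    (n : ℕ) (s : ℂ) (hs : -1 < s.re + n) : gN f n s = gN f (n + 1) s := by
  unfold gN cN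
  rw [mellin_parts _ (iter_cd hf n) (iter_cs hfc n) _ (by simp; linarith),
    Finset.prod_range_succ, Function.iterate_succ_apply']
  push_cast
  rw [← add_assoc s]
  ring

lemma gN_le {f : ℝ → ℂ} (hf : ContDiff ℝ (⊤ : ℕ∞) f) (hfc : HasCompactSupport f)
    (m n : ℕ) (hmn : m ≤ n) (s : ℂ) (hs : -1 < s.re + m) : gN f m s = gN f n s := by
  induction n, hmn using Nat.le_induction with
  | base => rfl
  | succ n hn ih =>
    rw [ih, gN_succ hf hfc]
    have : (m : ℝ) ≤ n := by exact_mod_cast hn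
    linarith

end

noncomputable def gG (f : ℝ → ℂ) (s : ℂ) : ℂ := gN f ⌈-s.re⌉₊ s

lemma gG_eq {f : ℝ → ℂ} (hf : ContDiff ℝ (⊤ : ℕ∞) f) (hfc : HasCompactSupport f)
    (n : ℕ) (s : ℂ) (hs : -1 < s.re + n) : gG f s = gN f n s := by
  unfold gG
  rcases le_total ⌈-s.re⌉₊ n with h | h
  · refine gN_le hf hfc _ _ h s ?_
    have := Nat.le_ceil (-s.re)
    linarith
  · exact (gN_le hf hfc _ _ h s hs).symm

lemma gG_ev {f : ℝ → ℂ} (hf : ContDiff ℝ (⊤ : ℕ∞) f) (hfc : HasCompactSupport f)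
    (n : ℕ) (s : ℂ) (hs : -1 < s.re + n) : gG f =ᶠ[𝓝 s] gN f n := by
  have ho : IsOpen {z : ℂ | -1 < z.re + n} :=
    isOpen_lt continuous_const (Complex.continuous_re.add continuous_const)
  filter_upwards [ho.mem_nhds hs] with z hz using gG_eq hf hfc n z hz

lemma mell_an {f : ℝ → ℂ} (hf : ContDiff ℝ (⊤ : ℕ∞) f) (hfc : HasCompactSupport f)
    (n : ℕ) (s : ℂ) (hs : -1 < s.re + n) :
    AnalyticAt ℂ (fun z => mellin (deriv^[n] f) (z + n + 1)) s := by
  have ho : IsOpen {z : ℂ | -1 < z.re + n} :=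
    isOpen_lt continuous_const (Complex.continuous_re.add continuous_const)
  refine DifferentiableOn.analyticAt (s := {z : ℂ | -1 < z.re + n}) ?_ (ho.mem_nhds hs)
  intro z hz
  have hz' : -1 < z.re + n := hz
  refine DifferentiableAt.differentiableWithinAt ?_
  have h := mdiff _ (iter_cd hf n).continuous (iter_cs hfc n) (z + n + 1) (by simp; linarith)
  exact DifferentiableAt.comp (g := mellin (deriv^[n] f)) (f := fun z : ℂ => z + n + 1) z h (by fun_prop)

lemma pole_aux (G g : ℂ → ℂ) (s₀ : ℂ) (hg : DifferentiableAt ℂ g s₀)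
    (h : ∀ᶠ s in 𝓝[≠] s₀, (s - s₀) * G s = g s) (hp : IsPole G s₀) : IsSimplePole G s₀ := by
  refine ⟨g s₀, ?_, ?_⟩
  · intro h0
    have hd := hasDerivAt_iff_tendsto_slope.mp hg.hasDerivAt
    have : Tendsto G (𝓝[≠] s₀) (𝓝 (deriv g s₀)) := by
      refine hd.congr' ?_
      filter_upwards [h, self_mem_nhdsWithin] with s hs hne
      have : s - s₀ ≠ 0 := sub_ne_zero.mpr hne
      rw [slope_def_field, h0, ← hs]
      field_simp
      simp
    exact not_tendsto_nhds_of_tendsto_atTop hp _ this.norm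
  · exact (hg.continuousAt.tendsto.mono_left nhdsWithin_le_nhds).congr'
      (h.mono fun s hs => hs.symm)

theorem stmt0 (φ : ℝ → ℂ) (hφ : ContDiff ℝ (⊤ : ℕ∞) φ) (hφc : HasCompactSupport φ) :
    (∀ s : ℂ, -1 < s.re →
      MeasureTheory.IntegrableOn
        (fun x : ℝ => Complex.exp (s * (Real.log x : ℂ)) * φ x) (Set.Ioi 0)) ∧
    DifferentiableOn ℂ (zetaI φ) {s : ℂ | -1 < s.re} ∧
    ∃ G : ℂ → ℂ, MeromorphicOn G Set.univ ∧
      (∀ s : ℂ, -1 < s.re → G s = zetaI φ s) ∧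
      (∀ s₀ : ℂ, IsPole G s₀ →
        IsSimplePole G s₀ ∧ ∃ k : ℤ, k < 0 ∧ s₀ = (k : ℂ)) := by
  have hn : ∀ s : ℂ, ∃ n : ℕ, -1 < s.re + n := fun s => ⟨⌈-s.re⌉₊, by
    have := Nat.le_ceil (-s.re)
    linarith⟩
  refine ⟨?_, ?_, gG φ, ?_, ?_, ?_⟩
  · intro s hs
    have h := mconv φ hφ.continuous hφc (s + 1) (by simp; linarith)
    exact IntegrableOn.congr_fun h (zeta_integrand φ s) measurableSet_Ioi
  · intro s hs
    have hs' : -1 < s.re := hs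
    have h := mell_an hφ hφc 0 s (by simpa using hs')
    have e : zetaI φ = fun z => mellin (deriv^[0] φ) (z + (0 : ℕ) + 1) := by
      ext z; simp [zetaI_eq]
    rw [e]
    exact h.differentiableAt.differentiableWithinAt
  · intro s _
    obtain ⟨n, hs⟩ := hn s
    refine MeromorphicAt.congr ?_ ((gG_ev hφ hφc n s hs).symm.filter_mono nhdsWithin_le_nhds)
    refine MeromorphicAt.mul (f := cN n) ?_ (mell_an hφ hφc n s hs).meromorphicAt
    unfold cN
    fun_prop
  · intro s hs
    rw [gG_eq hφ hφc 0 s (by simpa using hs), zetaI_eq]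
    simp [gN, cN]
  · intro s₀ hp
    obtain ⟨n, hs⟩ := hn s₀
    have hH := (mell_an hφ hφc n s₀ hs).differentiableAt
    have hev := gG_ev hφ hφc n s₀ hs
    by_cases hk : ∃ k ∈ Finset.range n, s₀ + k + 1 = 0
    · obtain ⟨k, hkn, hk⟩ := hk
      have hs0 : s₀ = -(k + 1) := by linear_combination hk
      refine ⟨?_, -(k + 1), by linarith [Int.natCast_nonneg k], by rw [hs0]; push_cast; ring⟩
      refine pole_aux _ (fun s => (-∏ j ∈ (Finset.range n).erase k, (-(s + j + 1)⁻¹)) *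
        mellin (deriv^[n] φ) (s + n + 1)) s₀ ?_ ?_ hp
      · refine DifferentiableAt.mul (DifferentiableAt.neg ?_) hH
        refine DifferentiableAt.fun_finsetProd fun j hj => ?_
        refine (DifferentiableAt.inv (by fun_prop) ?_).neg
        intro h
        apply Finset.ne_of_mem_erase hj
        have : (j : ℂ) = k := by linear_combination h - hk
        exact_mod_cast this
      · filter_upwards [hev.filter_mono nhdsWithin_le_nhds, self_mem_nhdsWithin] with s h1 h2
        have h3 : s - s₀ ≠ 0 := sub_ne_zero.mpr h2
        have h4 : s + k + 1 = s - s₀ := by rw [hs0]; ring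
        rw [h1, gN, cN, ← Finset.mul_prod_erase _ _ hkn, h4]
        field_simp
    · exfalso
      push Not at hk
      have hd : DifferentiableAt ℂ (gN φ n) s₀ := by
        refine DifferentiableAt.mul (a := cN n) ?_ hH
        refine DifferentiableAt.fun_finsetProd fun j hj => ?_
        refine (DifferentiableAt.inv (by fun_prop) ?_).neg
        exact hk j hj
      have := (hd.continuousAt.congr hev.symm).tendsto.mono_left
        (nhdsWithin_le_nhds (s := {s₀}ᶜ))
      exact not_tendsto_nhds_of_tendsto_atTop hp _ this.norm
end

section
/- Let K be a field of characteristic zero, n a positive integer, and f ∈ K[x₁,…,xₙ] a nonconstant polynomial. Then there exists a nonzero polynomial b ∈ K[s] satisfying a Bernstein identity for f. -/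
/-- Iterated partial derivative `∂^β = ∂^{β₁}/∂x₁^{β₁} ⋯ ∂^{βₙ}/∂xₙ^{βₙ}`. -/
noncomputable def iterPDeriv {K : Type*} [CommRing K] {n : ℕ} (β : Fin n → ℕ)
    (q : MvPolynomial (Fin n) K) : MvPolynomial (Fin n) K :=
  (List.finRange n).foldr (fun i r => (fun g => MvPolynomial.pderiv i g)^[β i] r) q

/-- `b ∈ K[s]` satisfies a Bernstein identity for `f`: there are finitely many pairs
`(α, β)` of multi-indices and polynomials `c_{αβ} ∈ K[s]` with
`∑ c_{αβ}(m) · x^α · ∂^β (f^{m+1}) = b(m) · f^m` for every natural number `m`. -/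
def SatisfiesBernstein {K : Type*} [CommRing K] {n : ℕ} (f : MvPolynomial (Fin n) K)
    (b : Polynomial K) : Prop :=
  ∃ (A : Finset ((Fin n → ℕ) × (Fin n → ℕ)))
    (c : ((Fin n → ℕ) × (Fin n → ℕ)) → Polynomial K),
    ∀ m : ℕ,
      ∑ ab ∈ A,
        MvPolynomial.C (Polynomial.eval (m : K) (c ab)) *
          MvPolynomial.monomial (Finsupp.equivFunOnFinite.symm ab.1) (1 : K) * iterPDeriv ab.2 (f ^ (m + 1)) =
      MvPolynomial.C (Polynomial.eval (m : K) b) * f ^ m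


set_option linter.unusedSimpArgs false
namespace BS
open MvPolynomial

section ring
variable {A : Type*} [Ring A] {n : ℕ}

noncomputable def lp (Y : Fin n → A) (β : Fin n → ℕ) : A :=
  ((List.finRange n).map fun i => Y i ^ β i).prod

theorem lp_zero (Y : Fin n → A) : lp Y 0 = 1 := by
  simp [lp]

theorem lp_succ_aux (Y : Fin n → A) (hY : ∀ i j, Commute (Y i) (Y j)) (β : Fin n → ℕ) (j : Fin n)
    (l : List (Fin n)) (hl : l.Nodup) :
    (l.map fun i => Y i ^ (β + Pi.single j 1 : Fin n → ℕ) i).prod =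
      (if j ∈ l then Y j else 1) * (l.map fun i => Y i ^ β i).prod := by
  induction l with
  | nil => simp
  | cons a l ih =>
    have hl' := List.nodup_cons.1 hl
    simp only [List.map_cons, List.prod_cons, ih hl'.2]
    by_cases h : j = a
    · subst h
      simp [hl'.1, pow_succ', mul_assoc]
    · have : (β + Pi.single j 1 : Fin n → ℕ) a = β a := by
        simp [Pi.single_apply, Ne.symm h]
      rw [this]
      by_cases h2 : j ∈ l
      · simp only [h2, if_true, List.mem_cons, or_true]
        rw [← mul_assoc, ← mul_assoc, ((hY a j).pow_left (β a)).eq]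
      · simp [h2, h]

theorem lp_succ (Y : Fin n → A) (hY : ∀ i j, Commute (Y i) (Y j)) (β : Fin n → ℕ) (j : Fin n) :
    lp Y (β + Pi.single j 1) = Y j * lp Y β := by
  have := lp_succ_aux Y hY β j _ (List.nodup_finRange n)
  simpa [lp] using this

theorem lp_comm (Y : Fin n → A) (hY : ∀ i j, Commute (Y i) (Y j)) (β : Fin n → ℕ) (j : Fin n) :
    Y j * lp Y β = lp Y β * Y j := by
  refine Commute.list_prod_right _ _ ?_
  intro x hx
  obtain ⟨i, -, rfl⟩ := List.mem_map.1 hx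
  exact (hY j i).pow_right _

theorem idx_induction {motive : (Fin n → ℕ) → Prop} (h0 : motive 0)
    (hs : ∀ β j, motive β → motive (β + Pi.single j 1)) (β : Fin n → ℕ) : motive β := by
  induction h : ∑ i, β i generalizing β with
  | zero =>
    have : β = 0 := by
      funext i
      simpa using (Finset.sum_eq_zero_iff.1 h i (Finset.mem_univ i))
    exact this ▸ h0
  | succ k ih =>
    obtain ⟨j, -, hj⟩ := Finset.exists_ne_zero_of_sum_ne_zero (by omega : ∑ i, β i ≠ 0)
    have e : β = (β - Pi.single j 1) + Pi.single j 1 := by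
      funext i
      by_cases hi : i = j
      · subst hi; simp; omega
      · simp [Pi.single_apply, hi]
    rw [e]
    apply hs
    apply ih
    have := congrArg (fun g => ∑ i, g i) e
    simp [Finset.sum_add_distrib] at this
    simp only [Pi.sub_apply]
    omega

theorem lp_bracket (Y : Fin n → A) (hY : ∀ i j, Commute (Y i) (Y j)) (z c : A) (j : Fin n)
    (hc : ∀ a, Commute c a)
    (hz : ∀ i, z * Y i = Y i * z + if i = j then c else 0) (β : Fin n → ℕ) :
    z * lp Y β = lp Y β * z + (β j : A) * c * lp Y (β - Pi.single j 1) := by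
  induction β using idx_induction with
  | h0 => simp [lp_zero]
  | hs β i ih =>
    rw [lp_succ Y hY, ← mul_assoc, hz, add_mul, mul_assoc, ih]
    by_cases h : i = j
    · subst h
      have e1 : β + Pi.single i 1 - Pi.single i 1 = β := by
        funext a; simp
      rw [e1]
      have e2 : (β i : A) * (Y i * lp Y (β - Pi.single i 1)) = (β i : A) * lp Y β := by
        by_cases h0 : β i = 0
        · simp [h0]
        · rw [← lp_succ Y hY]
          congr 2
          funext a
          by_cases ha : a = i
          · subst ha; simp; omega
          · simp [Pi.single_apply, ha]
      have e3 : Y i * ((β i : A) * c * lp Y (β - Pi.single i 1)) = (β i : A) * c * lp Y β := by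
        have hb : Commute (Y i) ((β i : A) * c) :=
          (Nat.cast_commute _ _).symm.mul_right (hc _).symm
        rw [← mul_assoc, hb.eq]
        rw [(Nat.cast_commute (β i) c).eq, mul_assoc, mul_assoc, e2, mul_assoc]
      rw [mul_add, e3]
      simp only [if_true, Pi.add_apply, Pi.single_eq_same, Nat.cast_add, Nat.cast_one]
      noncomm_ring
    · have e1 : lp Y (β + Pi.single i 1 - Pi.single j 1) * (β j : A) = Y i * lp Y (β - Pi.single j 1) * (β j : A) := by
        by_cases h0 : β j = 0
        · simp [h0]
        · rw [← lp_succ Y hY]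
          congr 2
          funext a
          by_cases ha : a = j
          · subst ha; simp [Pi.single_apply, Ne.symm h]
          · simp [Pi.single_apply, ha]
      have e2 : (β + Pi.single i 1 : Fin n → ℕ) j = β j := by simp [Pi.single_apply, Ne.symm h]
      rw [e2]
      simp only [h, if_false, zero_mul, add_zero, mul_add]
      rw [(Nat.cast_commute (β j) c).eq, mul_assoc c, (Nat.cast_commute (β j) _).eq, mul_assoc c,
        (Nat.cast_commute (β j) (lp Y (β + _ - _))).eq, e1, ← mul_assoc, ← mul_assoc,
        ← mul_assoc, ← mul_assoc, ← mul_assoc, (hc (Y i)).eq]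
end ring
end BS

set_option linter.unusedSimpArgs false
namespace BS
open MvPolynomial

section op
variable {F : Type*} [Field F] {M : Type*} [AddCommGroup M] [Module F M] {n : ℕ}

/-- normally ordered operator attached to a symbol -/
noncomputable def op (X D : Fin n → Module.End F M) :
    MvPolynomial (Fin n ⊕ Fin n) F →ₗ[F] Module.End F M :=
  (MvPolynomial.basisMonomials (Fin n ⊕ Fin n) F).constr F
    (fun m => lp X (fun i => m (Sum.inl i)) * lp D (fun i => m (Sum.inr i)))

theorem op_monomial (X D : Fin n → Module.End F M) (m : Fin n ⊕ Fin n →₀ ℕ) (c : F) :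
    op X D (monomial m c) =
      c • (lp X (fun i => m (Sum.inl i)) * lp D (fun i => m (Sum.inr i))) := by
  have : monomial m c = c • (MvPolynomial.basisMonomials (Fin n ⊕ Fin n) F) m := by
    simp [MvPolynomial.smul_monomial]
  rw [this, map_smul, op, Module.Basis.constr_basis]

/-- Weyl relations -/
structure Weyl (X D : Fin n → Module.End F M) : Prop where
  xx : ∀ i j, Commute (X i) (X j)
  dd : ∀ i j, Commute (D i) (D j)
  dx : ∀ i j, D i * X j = X j * D i + if j = i then 1 else 0

variable {X D : Fin n → Module.End F M}

theorem op_one : op X D 1 = 1 := by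
  have := op_monomial X D 0 1
  rw [MvPolynomial.monomial_zero', C_1] at this
  rw [this]
  have h (Y : Fin n → Module.End F M) : lp Y (fun _ => 0) = 1 := lp_zero Y
  simp [h]

theorem x_op (h : Weyl X D) (j : Fin n) (p) :
    X j * op X D p = op X D (MvPolynomial.X (Sum.inl j) * p) := by
  induction p using MvPolynomial.induction_on' with
  | add p q hp hq => simp only [map_add, mul_add, hp, hq]
  | monomial m c =>
    rw [MvPolynomial.X, monomial_mul, one_mul, op_monomial, op_monomial, mul_smul_comm, ← mul_assoc,
      ← lp_succ X h.xx]
    congr 3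
    · funext i
      simp [Finsupp.single_apply, Pi.single_apply, add_comm, eq_comm]
    · funext i
      simp [Finsupp.single_apply]

theorem op_d (h : Weyl X D) (j : Fin n) (p) :
    op X D p * D j = op X D (MvPolynomial.X (Sum.inr j) * p) := by
  induction p using MvPolynomial.induction_on' with
  | add p q hp hq => simp only [map_add, mul_add, add_mul, hp, hq]
  | monomial m c =>
    rw [MvPolynomial.X, monomial_mul, one_mul, op_monomial, op_monomial, smul_mul_assoc, mul_assoc,
      ← lp_comm D h.dd, ← lp_succ D h.dd]
    congr 3
    · funext i
      simp [Finsupp.single_apply]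
    · funext i
      simp [Finsupp.single_apply, Pi.single_apply, add_comm, eq_comm]

theorem d_op (h : Weyl X D) (j : Fin n) (p) :
    D j * op X D p = op X D p * D j + op X D (pderiv (Sum.inl j) p) := by
  induction p using MvPolynomial.induction_on' with
  | add p q hp hq => simp only [map_add, mul_add, add_mul, hp, hq]; abel
  | monomial m c =>
    rw [pderiv_monomial, op_monomial, op_monomial, mul_smul_comm, ← mul_assoc,
      lp_bracket X h.xx (D j) 1 j (Commute.one_left) (h.dx j), smul_mul_assoc, add_mul, smul_add]
    congr 1
    · rw [mul_assoc, mul_assoc, lp_comm D h.dd]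
    · rw [mul_smul]
      congr 1
      rw [mul_one, mul_assoc, ← nsmul_eq_mul, Nat.cast_smul_eq_nsmul]
      congr 3
      · funext i
        simp [Finsupp.single_apply, Pi.single_apply, eq_comm]
      · funext i
        simp [Finsupp.single_apply]

theorem op_x (h : Weyl X D) (j : Fin n) (p) :
    op X D p * X j = X j * op X D p + op X D (pderiv (Sum.inr j) p) := by
  induction p using MvPolynomial.induction_on' with
  | add p q hp hq => simp only [map_add, mul_add, add_mul, hp, hq]; abel
  | monomial m c =>
    have key := lp_bracket D h.dd (X j) (-1) j (fun a => (Commute.one_left a).neg_left)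
      (by intro i; rw [h.dx i j]; by_cases hij : i = j
          · simp [hij]
          · simp [hij, Ne.symm hij]) (fun i => m (Sum.inr i))
    have key2 : lp D (fun i => m (Sum.inr i)) * X j = X j * lp D (fun i => m (Sum.inr i)) +
      (m (Sum.inr j) : Module.End F M) * lp D ((fun i => m (Sum.inr i)) - Pi.single j 1) := by
      rw [key]; noncomm_ring
    rw [pderiv_monomial, op_monomial, op_monomial, smul_mul_assoc, mul_assoc, key2, mul_add,
      smul_add]
    congr 1
    · rw [← mul_assoc, ← lp_comm X h.xx, mul_smul_comm, mul_assoc]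
    · rw [mul_smul]
      congr 1
      rw [← mul_assoc, ← (Nat.cast_commute _ _).eq, mul_assoc, ← nsmul_eq_mul, Nat.cast_smul_eq_nsmul]
      congr 3
      · funext i
        simp [Finsupp.single_apply]
      · funext i
        simp [Finsupp.single_apply, Pi.single_apply, eq_comm]

theorem d_op' (h : Weyl X D) (j : Fin n) (p) :
    D j * op X D p = op X D (MvPolynomial.X (Sum.inr j) * p + pderiv (Sum.inl j) p) := by
  rw [d_op h, op_d h, map_add]

theorem op_filt (h : Weyl X D) (Γ : ℕ → Submodule F M) (mono : Monotone Γ)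
    (hx : ∀ i j v, v ∈ Γ j → X i v ∈ Γ (j+1)) (hd : ∀ i j v, v ∈ Γ j → D i v ∈ Γ (j+1))
    (p : MvPolynomial (Fin n ⊕ Fin n) F) (e j : ℕ) (hp : p.totalDegree ≤ e) (v : M) (hv : v ∈ Γ j) :
    op X D p v ∈ Γ (j + e) := by
  have key : ∀ (k : ℕ) (m : Fin n ⊕ Fin n →₀ ℕ), m.degree = k → ∀ j v, v ∈ Γ j →
      op X D (monomial m 1) v ∈ Γ (j + k) := by
    intro k
    induction k with
    | zero =>
      intro m hm j v hv
      have : m = 0 := (Finsupp.degree_eq_zero_iff m).1 hm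
      subst this
      rw [MvPolynomial.monomial_zero', C_1, op_one]
      exact hv
    | succ k ih =>
      intro m hm j v hv
      have : m ≠ 0 := by rintro rfl; simp at hm
      obtain ⟨a, ha⟩ := Finsupp.ne_iff.1 this
      obtain ⟨m', rfl⟩ : ∃ m', m = Finsupp.single a 1 + m' := by
        refine ⟨m - Finsupp.single a 1, ?_⟩
        rw [add_tsub_cancel_of_le]
        simpa [Nat.one_le_iff_ne_zero] using ha
      have hm' : m'.degree = k := by
        simp at hm; omega
      have e1 : monomial (Finsupp.single a 1 + m') (1 : F) = MvPolynomial.X a * monomial m' 1 := by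
        rw [MvPolynomial.X, monomial_mul, one_mul]
      rw [e1]
      cases a with
      | inl a =>
        rw [← x_op h]
        exact hx _ _ _ (ih m' hm' j v hv)
      | inr a =>
        rw [← op_d h]
        have := ih m' hm' (j+1) _ (hd a _ _ hv)
        rwa [show j + 1 + k = j + (k + 1) by ring] at this
  rw [p.as_sum, map_sum, LinearMap.sum_apply]
  refine Submodule.sum_mem _ fun m hm => ?_
  rw [show monomial m (coeff m p) = coeff m p • monomial m (1 : F) by
    simp [MvPolynomial.smul_monomial], map_smul]
  refine Submodule.smul_mem _ _ (mono ?_ (key _ m rfl j v hv))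
  have := le_totalDegree hm
  have e2 : m.degree = m.sum fun _ e => e := rfl
  omega

theorem eq_C_of_pderiv [CharZero F] {σ : Type*} (p : MvPolynomial σ F)
    (hp : ∀ i, pderiv i p = 0) : p = C (coeff 0 p) := by
  classical
  ext m
  rw [coeff_C]
  split_ifs with hm
  · rw [hm]
  · obtain ⟨a, ha⟩ := Finsupp.ne_iff.1 (Ne.symm hm)
    have := congrArg (coeff (m - Finsupp.single a 1)) (hp a)
    rw [coeff_pderiv, tsub_add_cancel_of_le (by simpa [Nat.one_le_iff_ne_zero] using ha)] at this
    rw [coeff_zero] at this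
    refine (mul_eq_zero.1 this).resolve_right ?_
    exact Nat.cast_add_one_ne_zero _

theorem totalDegree_pderiv_le {σ : Type*} (p : MvPolynomial σ F) (i : σ) :
    (pderiv i p).totalDegree ≤ p.totalDegree - 1 := by
  refine Finset.sup_le fun m hm => ?_
  have h1 : m + Finsupp.single i 1 ∈ p.support := by
    rw [mem_support_iff, coeff_pderiv] at hm
    exact mem_support_iff.2 (left_ne_zero_of_mul hm)
  have h2 := le_totalDegree h1
  have e2 : ∀ m : σ →₀ ℕ, (m.sum fun _ e => e) = m.degree := fun _ => rfl
  rw [e2] at h2 ⊢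
  simp at h2
  omega

theorem op_inj [CharZero F] (h : Weyl X D) (N : Submodule F M) (hx : ∀ i v, v ∈ N → X i v ∈ N)
    (hd : ∀ i v, v ∈ N → D i v ∈ N) (u : M) (hu : u ∉ N) (i : ℕ) :
    ∀ p : MvPolynomial (Fin n ⊕ Fin n) F, p.totalDegree ≤ i →
    (∀ q : MvPolynomial (Fin n ⊕ Fin n) F, q.totalDegree ≤ i → op X D p (op X D q u) ∈ N) →
    p = 0 := by
  have hC : ∀ c : F, op X D (C c) (op X D 1 u) ∈ N → C c = (0 : MvPolynomial (Fin n ⊕ Fin n) F) := by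
    intro c hc
    rw [show (C c : MvPolynomial (Fin n ⊕ Fin n) F) = c • 1 by
      rw [MvPolynomial.smul_eq_C_mul, mul_one], map_smul, op_one] at hc
    by_cases h0 : c = 0
    · simp [h0]
    · exact absurd ((Submodule.smul_mem_iff N h0).1 hc) hu
  induction i with
  | zero =>
    intro p hp hq
    have e := totalDegree_eq_zero_iff_eq_C.1 (Nat.le_zero.1 hp)
    rw [e] at hq ⊢
    exact hC _ (hq 1 (by simp))
  | succ i ih =>
    intro p hp hq
    have e : p = C (coeff 0 p) := by
      apply eq_C_of_pderiv
      intro a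
      apply ih
      · have := totalDegree_pderiv_le p a
        omega
      · intro q hqi
        cases a with
        | inl j =>
          have e1 : op X D (pderiv (Sum.inl j) p) = D j * op X D p - op X D p * D j := by
            rw [d_op h]; abel
          rw [e1]
          refine Submodule.sub_mem _ (hd _ _ (hq q (by omega))) ?_
          change op X D p ((D j * op X D q) u) ∈ N
          rw [d_op' h]
          apply hq
          refine (totalDegree_add _ _).trans (max_le ?_ ?_)
          · refine (totalDegree_mul _ _).trans ?_
            rw [totalDegree_X]; omega
          · have := totalDegree_pderiv_le q (Sum.inl j)
            omega
        | inr j =>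
          have e1 : op X D (pderiv (Sum.inr j) p) = op X D p * X j - X j * op X D p := by
            rw [op_x h]; abel
          rw [e1]
          refine Submodule.sub_mem _ ?_ (hx _ _ (hq q (by omega)))
          change op X D p ((X j * op X D q) u) ∈ N
          rw [x_op h]
          apply hq
          refine (totalDegree_mul _ _).trans ?_
          rw [totalDegree_X]; omega
    rw [e] at hq ⊢
    exact hC _ (hq 1 (by simp))
end op
end BS

set_option linter.unusedSimpArgs false
namespace BS
open MvPolynomial

section dim
variable {F : Type*} [Field F] {M : Type*} [AddCommGroup M] [Module F M] {n : ℕ}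

noncomputable def evu (X D : Fin n → Module.End F M) (v : M) :
    MvPolynomial (Fin n ⊕ Fin n) F →ₗ[F] M :=
  (LinearMap.applyₗ v) ∘ₗ op X D

theorem evu_apply (X D : Fin n → Module.End F M) (v : M) (p) : evu X D v p = op X D p v := rfl

theorem card_le_finrank (n t : ℕ) :
    (t + 1) ^ (2 * n) ≤ Module.finrank F (restrictTotalDegree (Fin n ⊕ Fin n) F (2 * n * t)) := by
  let em : ((Fin n ⊕ Fin n) → Fin (t+1)) → (Fin n ⊕ Fin n →₀ ℕ) := fun e =>
    Finsupp.equivFunOnFinite.symm (fun i => (e i : ℕ))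
  have hem : Function.Injective em := by
    intro e e' h
    have h2 := Finsupp.equivFunOnFinite.symm.injective h
    funext i
    exact Fin.ext (congrFun h2 i)
  have hdeg : ∀ e, (em e).degree ≤ 2 * n * t := by
    intro e
    rw [Finsupp.degree_eq_sum]
    calc ∑ i, (em e) i ≤ ∑ i : Fin n ⊕ Fin n, t := by
          apply Finset.sum_le_sum
          intro i _
          exact Nat.lt_succ_iff.1 (e i).2
      _ = 2 * n * t := by
          rw [Finset.sum_const, Finset.card_univ, Fintype.card_sum, Fintype.card_fin, smul_eq_mul]; ring
  let w : ((Fin n ⊕ Fin n) → Fin (t+1)) → restrictTotalDegree (Fin n ⊕ Fin n) F (2 * n * t) :=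
    fun e => ⟨monomial (em e) 1, by
      rw [mem_restrictTotalDegree]
      refine (totalDegree_monomial_le _ _).trans ?_
      exact hdeg e⟩
  have hw : LinearIndependent F w := by
    apply LinearIndependent.of_comp (Submodule.subtype _)
    have := (MvPolynomial.basisMonomials (Fin n ⊕ Fin n) F).linearIndependent.comp em hem
    convert this using 1
    funext e
    simp [w]
  have := hw.fintype_card_le_finrank
  refine le_trans (le_of_eq ?_) this
  simp; ring

theorem dim_hom [CharZero F] {X D : Fin n → Module.End F M} (h : Weyl X D) (N : Submodule F M)
    (hx : ∀ i v, v ∈ N → X i v ∈ N)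
    (hd : ∀ i v, v ∈ N → D i v ∈ N) (u : M) (hu : u ∉ N) (i : ℕ) :
    Module.finrank F (restrictTotalDegree (Fin n ⊕ Fin n) F i) ≤
     Module.finrank F ((restrictTotalDegree (Fin n ⊕ Fin n) F i).map (evu X D u)) *
     Module.finrank F (((restrictTotalDegree (Fin n ⊕ Fin n) F (i+i)).map (evu X D u)).map N.mkQ) := by
  set E := fun i => restrictTotalDegree (Fin n ⊕ Fin n) F i with hE
  set V := fun i => (E i).map (evu X D u) with hV
  have hVmono : Monotone V := by
    intro a b hab
    apply Submodule.map_mono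
    intro p hp
    rw [mem_restrictTotalDegree] at hp ⊢
    omega
  have hVx : ∀ a j v, v ∈ V j → X a v ∈ V (j+1) := by
    rintro a j _ ⟨q, hq, rfl⟩
    refine ⟨MvPolynomial.X (Sum.inl a) * q, ?_, ?_⟩
    · have hq' := (mem_restrictTotalDegree _ _ _).1 hq
      refine (mem_restrictTotalDegree _ _ _).2 ((totalDegree_mul _ _).trans ?_)
      rw [totalDegree_X]; omega
    · rw [evu_apply, ← x_op h]; rfl
  have hVd : ∀ a j v, v ∈ V j → D a v ∈ V (j+1) := by
    rintro a j _ ⟨q, hq, rfl⟩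
    refine ⟨MvPolynomial.X (Sum.inr a) * q + pderiv (Sum.inl a) q, ?_, ?_⟩
    · have hq' := (mem_restrictTotalDegree _ _ _).1 hq
      refine (mem_restrictTotalDegree _ _ _).2 ((totalDegree_add _ _).trans (max_le ?_ ?_))
      · refine (totalDegree_mul _ _).trans ?_
        rw [totalDegree_X]; omega
      · have := totalDegree_pderiv_le q (Sum.inl a)
        omega
    · rw [evu_apply, ← d_op' h]; rfl
  have hop : ∀ p ∈ E i, ∀ v : V i, N.mkQ (op X D p v) ∈ (V (i+i)).map N.mkQ := by
    intro p hp v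
    exact Submodule.mem_map_of_mem
      (op_filt h V hVmono hVx hVd p i i ((mem_restrictTotalDegree _ _ _).1 hp) v v.2)
  let Φ : E i →ₗ[F] (V i →ₗ[F] (V (i+i)).map N.mkQ) :=
    { toFun := fun p => ((N.mkQ ∘ₗ op X D p.1) ∘ₗ (V i).subtype).codRestrict _ (hop p.1 p.2)
      map_add' := by
        intro p q
        refine LinearMap.ext fun v => Subtype.ext ?_
        change N.mkQ (op X D (p.1 + q.1) v) = N.mkQ (op X D p.1 v) + N.mkQ (op X D q.1 v)
        rw [map_add, LinearMap.add_apply, map_add]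
      map_smul' := by
        intro c p
        refine LinearMap.ext fun v => Subtype.ext ?_
        change N.mkQ (op X D (c • p.1) v) = c • N.mkQ (op X D p.1 v)
        rw [map_smul, LinearMap.smul_apply, map_smul] }
  have hΦ : Function.Injective Φ := by
    rw [injective_iff_map_eq_zero]
    intro p hp
    apply Subtype.ext
    refine op_inj h N hx hd u hu i p.1 ((mem_restrictTotalDegree _ _ _).1 p.2) ?_
    intro q hq
    have := congrArg Subtype.val
      (LinearMap.congr_fun hp ⟨op X D q u, ⟨q, (mem_restrictTotalDegree _ _ _).2 hq, rfl⟩⟩)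
    change N.mkQ (op X D p.1 (op X D q u)) = 0 at this
    simpa using this
  have := LinearMap.finrank_le_finrank_of_injective hΦ
  rwa [Module.finrank_linearMap] at this

theorem range_stable_x {X D : Fin n → Module.End F M} (h : Weyl X D) (u : M) (i v)
    (hv : v ∈ LinearMap.range (evu X D u)) : X i v ∈ LinearMap.range (evu X D u) := by
  obtain ⟨q, rfl⟩ := hv
  exact ⟨MvPolynomial.X (Sum.inl i) * q, by rw [evu_apply, ← x_op h]; rfl⟩

theorem range_stable_d {X D : Fin n → Module.End F M} (h : Weyl X D) (u : M) (i v)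
    (hv : v ∈ LinearMap.range (evu X D u)) : D i v ∈ LinearMap.range (evu X D u) := by
  obtain ⟨q, rfl⟩ := hv
  exact ⟨MvPolynomial.X (Sum.inr i) * q + pderiv (Sum.inl i) q, by
    rw [evu_apply, ← d_op' h]; rfl⟩

/-- rank-nullity step -/
theorem step (G N N' W : Submodule F M) [FiniteDimensional F G] (hN : N' ≤ N) (hW : W ≤ G ⊓ N) :
    Module.finrank F (W.map N'.mkQ) + Module.finrank F (G ⊓ N' : Submodule F M) ≤
      Module.finrank F (G ⊓ N : Submodule F M) := by
  let g := N'.mkQ ∘ₗ (G ⊓ N).subtype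
  have : FiniteDimensional F (G ⊓ N : Submodule F M) :=
    Submodule.finiteDimensional_of_le inf_le_left
  have h1 := LinearMap.finrank_range_add_finrank_ker g
  have h2 : Module.finrank F (W.map N'.mkQ) ≤ Module.finrank F (LinearMap.range g) := by
    apply Submodule.finrank_mono
    rintro _ ⟨w, hw, rfl⟩
    exact ⟨⟨w, hW hw⟩, rfl⟩
  have h3 : Module.finrank F (G ⊓ N' : Submodule F M) ≤ Module.finrank F (LinearMap.ker g) := by
    let φ : (G ⊓ N' : Submodule F M) →ₗ[F] LinearMap.ker g :=
      { toFun := fun x => ⟨⟨x.1, x.2.1, hN x.2.2⟩, by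
          have := x.2.2
          simpa [g] using this⟩
        map_add' := fun _ _ => rfl
        map_smul' := fun _ _ => rfl }
    apply LinearMap.finrank_le_finrank_of_injective (f := φ)
    intro x y hxy
    apply Subtype.ext
    exact congrArg (fun z => z.1.1) hxy
  omega

theorem abstract_bernstein [CharZero F] {X D : Fin n → Module.End F M} (h : Weyl X D)
    (u : ℕ → M) (huu : ∀ k, ∃ p, op X D p (u k) = u (k+1))
    (Γ : ℕ → Submodule F M) (mono : Monotone Γ)
    (hx : ∀ i j v, v ∈ Γ j → X i v ∈ Γ (j+1)) (hd : ∀ i j v, v ∈ Γ j → D i v ∈ Γ (j+1))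
    (d : ℕ) [hfin : ∀ j, FiniteDimensional F (Γ j)]
    (hrank : ∀ j, Module.finrank F (Γ j) ≤ (j * (d+1) + 1)^n)
    (hu : ∀ l, ∃ a, ∀ k < l, u k ∈ Γ a) :
    ∃ k p, op X D p (u (k+1)) = u k := by
  by_contra hcon
  push Not at hcon
  set N : ℕ → Submodule F M := fun k => LinearMap.range (evu X D (u k)) with hNdef
  have hNmem : ∀ k, u k ∉ N (k+1) := by
    rintro k ⟨p, hp⟩
    exact hcon k p hp
  have hNle : ∀ k, N (k+1) ≤ N k := by
    rintro k _ ⟨q, rfl⟩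
    obtain ⟨p, hp⟩ := huu k
    exact op_filt h (fun _ => N k) (fun _ _ _ => le_rfl) (fun i _ v hv => range_stable_x h _ i v hv)
      (fun i _ v hv => range_stable_d h _ i v hv) q _ 0 le_rfl _ ⟨p, hp⟩
  set C1 := (2 * n + 1) * (d + 1) + 1 with hC1
  set C2 := (4 * n + 1) * (d + 1) + 1 with hC2
  set l := (C1 * C2) ^ n + 1 with hl
  obtain ⟨a, ha⟩ := hu l
  set t := a + 1 with ht
  set i := 2 * n * t with hi
  have hV : ∀ k < l, ∀ j, (restrictTotalDegree (Fin n ⊕ Fin n) F j).map (evu X D (u k)) ≤ Γ (a + j) := by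
    rintro k hk j _ ⟨q, hq, rfl⟩
    exact op_filt h Γ mono hx hd q j a ((mem_restrictTotalDegree _ _ _).1 hq) _ (ha k hk)
  have main : ∀ k < l, (t+1)^(2*n) ≤ (C1 * t)^n *
      Module.finrank F (((restrictTotalDegree (Fin n ⊕ Fin n) F (i+i)).map (evu X D (u k))).map (N (k+1)).mkQ) := by
    intro k hk
    refine (card_le_finrank (F := F) n t).trans ((dim_hom h (N (k+1))
      (fun i v hv => range_stable_x h _ i v hv)
      (fun i v hv => range_stable_d h _ i v hv) (u k) (hNmem k) i).trans ?_)
    refine Nat.mul_le_mul_right _ ?_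
    refine (Submodule.finrank_mono (hV k hk i)).trans ((hrank _).trans ?_)
    refine Nat.pow_le_pow_left ?_ n
    have h1 : a + i ≤ (2 * n + 1) * t := by rw [hi, ht]; ring_nf; omega
    calc (a + i) * (d + 1) + 1 ≤ ((2 * n + 1) * t) * (d+1) + t := by gcongr; omega
      _ = C1 * t := by rw [hC1]; ring
  have tele : ∀ r ≤ l, (∑ k ∈ Finset.range r, Module.finrank F
      (((restrictTotalDegree (Fin n ⊕ Fin n) F (i+i)).map (evu X D (u k))).map (N (k+1)).mkQ))
      + Module.finrank F (Γ (a + (i+i)) ⊓ N r : Submodule F M) ≤ Module.finrank F (Γ (a + (i + i))) := by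
    intro r
    induction r with
    | zero =>
      intro _
      simp only [Finset.range_zero, Finset.sum_empty, zero_add]
      exact Submodule.finrank_mono inf_le_left
    | succ r ih =>
      intro hr
      rw [Finset.sum_range_succ]
      have h1 := ih (by omega)
      have h2 := step (Γ (a + (i+i))) (N r) (N (r+1)) _ (hNle r)
        (le_inf (hV r (by omega) (i+i)) (LinearMap.map_le_range))
      omega
  have h1 : l * (t+1)^(2*n) ≤ (C1 * t)^n * (C2 * t)^n := by
    calc l * (t+1)^(2*n) = ∑ k ∈ Finset.range l, (t+1)^(2*n) := by simp
      _ ≤ ∑ k ∈ Finset.range l, (C1 * t)^n * Module.finrank F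
          (((restrictTotalDegree (Fin n ⊕ Fin n) F (i+i)).map (evu X D (u k))).map (N (k+1)).mkQ) :=
        Finset.sum_le_sum fun k hk => main k (Finset.mem_range.1 hk)
      _ ≤ (C1 * t)^n * (C2 * t)^n := by
        rw [← Finset.mul_sum]
        refine Nat.mul_le_mul_left _ ?_
        refine (Nat.le_add_right _ _).trans ((tele l le_rfl).trans ((hrank _).trans ?_))
        refine Nat.pow_le_pow_left ?_ n
        have h1 : a + (i + i) ≤ (4 * n + 1) * t := by rw [hi, ht]; ring_nf; omega
        calc (a + (i + i)) * (d + 1) + 1 ≤ ((4 * n + 1) * t) * (d+1) + t := by gcongr; omega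
          _ = C2 * t := by rw [hC2]; ring
  have h2 : l * t^(2*n) ≤ (C1 * C2)^n * t^(2*n) := by
    calc l * t^(2*n) ≤ l * (t+1)^(2*n) := by gcongr; omega
      _ ≤ _ := h1
      _ = _ := by rw [← mul_pow, pow_mul, ← mul_pow]; ring
  have h3 := Nat.le_of_mul_le_mul_right h2 (by positivity)
  omega
end dim
end BS

set_option linter.unusedSimpArgs false
namespace BS
open MvPolynomial
open scoped nonZeroDivisors

section seq
variable (K : Type*) [Field K] (n : ℕ)

/-- sequences of polynomials -/
def Sq : Type _ := ℕ → MvPolynomial (Fin n) K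

noncomputable instance : AddCommGroup (Sq K n) :=
  inferInstanceAs (AddCommGroup (ℕ → MvPolynomial (Fin n) K))

noncomputable instance : Module (Polynomial K) (Sq K n) where
  smul p g := fun m => p.eval (m : K) • g m
  one_smul g := by funext m; change Polynomial.eval (m : K) 1 • g m = g m; simp
  mul_smul p q g := by
    funext m
    change Polynomial.eval (m : K) (p * q) • g m = p.eval (m : K) • q.eval (m : K) • g m
    rw [Polynomial.eval_mul, mul_smul]
  smul_zero p := by
    funext m
    exact smul_zero (A := MvPolynomial (Fin n) K) (p.eval (m : K))
  smul_add p g h := by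
    funext m
    exact smul_add (A := MvPolynomial (Fin n) K) (p.eval (m : K)) (g m) (h m)
  add_smul p q g := by
    funext m
    change Polynomial.eval (m : K) (p + q) • g m = p.eval (m : K) • g m + q.eval (m : K) • g m
    rw [Polynomial.eval_add, add_smul]
  zero_smul g := by funext m; change Polynomial.eval (m : K) 0 • g m = 0; simp

variable {K n}

def sq (h : ℕ → MvPolynomial (Fin n) K) : Sq K n := h
def ev (g : Sq K n) (m : ℕ) : MvPolynomial (Fin n) K := g m

theorem ev_sq (h : ℕ → MvPolynomial (Fin n) K) (m : ℕ) : ev (sq h) m = h m := rfl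
theorem ev_smul (p : Polynomial K) (g : Sq K n) (m : ℕ) :
    ev (p • g) m = p.eval (m : K) • ev g m := rfl
theorem ev_add (g h : Sq K n) (m : ℕ) : ev (g + h) m = ev g m + ev h m := rfl
theorem ev_sum {ι : Type*} (s : Finset ι) (g : ι → Sq K n) (m : ℕ) :
    ev (∑ i ∈ s, g i) m = ∑ i ∈ s, ev (g i) m :=
  Finset.sum_apply (M := fun _ => MvPolynomial (Fin n) K) m s g
theorem sq_ext {g h : Sq K n} (H : ∀ m, ev g m = ev h m) : g = h := funext H

/-- apply a linear map termwise -/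
noncomputable def tw (φ : MvPolynomial (Fin n) K →ₗ[K] MvPolynomial (Fin n) K) :
    Sq K n →ₗ[Polynomial K] Sq K n where
  toFun g := sq fun m => φ (ev g m)
  map_add' g h := sq_ext fun m => by simp only [ev_sq, ev_add, map_add]
  map_smul' p g := sq_ext fun m => by simp only [ev_sq, ev_smul, map_smul, RingHom.id_apply]

theorem ev_tw (φ : MvPolynomial (Fin n) K →ₗ[K] MvPolynomial (Fin n) K) (g m) :
    ev (tw φ g) m = φ (ev g m) := rfl

variable (K n) in
abbrev Mo := LocalizedModule (Polynomial K)⁰ (Sq K n)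

noncomputable def io : Sq K n →ₗ[Polynomial K] Mo K n :=
  LocalizedModule.mkLinearMap (Polynomial K)⁰ (Sq K n)

noncomputable def lt (φ : MvPolynomial (Fin n) K →ₗ[K] MvPolynomial (Fin n) K) :
    Module.End (FractionRing (Polynomial K)) (Mo K n) :=
  LocalizedModule.map (Polynomial K)⁰ (tw φ)

theorem lt_mk (φ : MvPolynomial (Fin n) K →ₗ[K] MvPolynomial (Fin n) K) (g s) :
    lt φ (LocalizedModule.mk g s : Mo K n) = LocalizedModule.mk (tw φ g) s :=
  LocalizedModule.map_mk _ _ _ _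

theorem lt_io (φ : MvPolynomial (Fin n) K →ₗ[K] MvPolynomial (Fin n) K) (g) :
    lt φ (io g : Mo K n) = io (tw φ g) := lt_mk _ _ _

theorem lt_mul (φ ψ : MvPolynomial (Fin n) K →ₗ[K] MvPolynomial (Fin n) K) :
    (lt φ : Module.End _ (Mo K n)) * lt ψ = lt (φ ∘ₗ ψ) := by
  refine LinearMap.ext fun v => ?_
  induction v using LocalizedModule.induction_on with
  | h g s => rw [Module.End.mul_apply, lt_mk, lt_mk, lt_mk]; rfl

theorem lt_add (φ ψ : MvPolynomial (Fin n) K →ₗ[K] MvPolynomial (Fin n) K) :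
    (lt (φ + ψ) : Module.End _ (Mo K n)) = lt φ + lt ψ := by
  have : tw (φ + ψ) = tw φ + tw ψ := rfl
  rw [lt, this, map_add]; rfl

theorem lt_one : (lt (LinearMap.id : MvPolynomial (Fin n) K →ₗ[K] _) : Module.End _ (Mo K n)) = 1 := by
  refine LinearMap.ext fun v => ?_
  induction v using LocalizedModule.induction_on with
  | h g s => rw [lt_mk]; rfl

noncomputable def mX (i : Fin n) : MvPolynomial (Fin n) K →ₗ[K] MvPolynomial (Fin n) K :=
  LinearMap.mulLeft K (MvPolynomial.X i)
noncomputable def mD (i : Fin n) : MvPolynomial (Fin n) K →ₗ[K] MvPolynomial (Fin n) K :=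
  (pderiv i).toLinearMap

noncomputable def oX (i : Fin n) : Module.End (FractionRing (Polynomial K)) (Mo K n) := lt (mX i)
noncomputable def oD (i : Fin n) : Module.End (FractionRing (Polynomial K)) (Mo K n) := lt (mD i)

theorem pderiv_comm' (i j : Fin n) (p : MvPolynomial (Fin n) K) :
    pderiv i (pderiv j p) = pderiv j (pderiv i p) := by
  ext m
  simp only [coeff_pderiv]
  rw [add_right_comm]
  by_cases h : i = j
  · subst h; rfl
  · simp [Finsupp.single_apply, h, Ne.symm h]; ring

theorem weyl : Weyl (oX : Fin n → Module.End (FractionRing (Polynomial K)) (Mo K n)) oD where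
  xx i j := by
    rw [commute_iff_eq, oX, oX, lt_mul, lt_mul]
    congr 1
    refine LinearMap.ext fun p => ?_
    simp [mX]; ring
  dd i j := by
    rw [commute_iff_eq, oD, oD, lt_mul, lt_mul]
    congr 1
    exact LinearMap.ext fun p => pderiv_comm' i j p
  dx i j := by
    by_cases h : j = i
    · subst h
      rw [oD, oX, lt_mul, lt_mul, if_pos rfl, ← lt_one, ← lt_add]
      congr 1
      refine LinearMap.ext fun p => ?_
      simp [mX, mD]
    · rw [oD, oX, lt_mul, lt_mul, if_neg h, add_zero]
      congr 1
      refine LinearMap.ext fun p => ?_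
      simp [mX, mD, pderiv_X_of_ne h]

theorem lp_oX (α : Fin n → ℕ) : lp (oX : Fin n → Module.End _ (Mo K n)) α =
    lt (LinearMap.mulLeft K (monomial (Finsupp.equivFunOnFinite.symm α) 1)) := by
  induction α using idx_induction with
  | h0 =>
    rw [lp_zero, ← lt_one]
    congr 1
    refine LinearMap.ext fun p => ?_
    have : Finsupp.equivFunOnFinite.symm (0 : Fin n → ℕ) = 0 := by ext; simp
    rw [this]
    simp
  | hs α j ih =>
    rw [lp_succ _ weyl.xx, ih, oX, lt_mul]
    congr 1
    refine LinearMap.ext fun p => ?_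
    have : Finsupp.equivFunOnFinite.symm (α + Pi.single j 1) =
      Finsupp.single j 1 + Finsupp.equivFunOnFinite.symm α := by
      classical
      ext i; simp [Finsupp.single_apply, Pi.single_apply, add_comm, eq_comm]
    rw [this]
    simp only [mX, LinearMap.comp_apply, LinearMap.mulLeft_apply, MvPolynomial.X]
    rw [← mul_assoc, monomial_mul, one_mul]

theorem oD_pow (i : Fin n) (k : ℕ) (g : Sq K n) :
    (oD i ^ k) (io g) = io (sq fun m => (fun q => pderiv i q)^[k] (ev g m)) := by
  induction k with
  | zero => rfl
  | succ k ih =>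
    rw [pow_succ', Module.End.mul_apply, ih, oD, lt_io]
    congr 1
    refine sq_ext fun m => ?_
    rw [ev_tw, ev_sq, ev_sq, Function.iterate_succ_apply']
    rfl

theorem lp_oD (β : Fin n → ℕ) (g : Sq K n) : lp oD β (io g) = io (sq fun m => iterPDeriv β (ev g m)) := by
  unfold lp iterPDeriv
  induction (List.finRange n) with
  | nil => rfl
  | cons a l ih =>
    rw [List.map_cons, List.prod_cons, Module.End.mul_apply, ih, oD_pow]
    rfl

theorem op_mon (μ : Fin n ⊕ Fin n →₀ ℕ) (c : Polynomial K) (g : Sq K n) :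
    op oX oD (monomial μ (algebraMap _ (FractionRing (Polynomial K)) c)) (io g) =
    io (c • (sq fun m => monomial (Finsupp.equivFunOnFinite.symm fun i => μ (Sum.inl i)) 1 *
      iterPDeriv (fun i => μ (Sum.inr i)) (ev g m))) := by
  rw [op_monomial, LinearMap.smul_apply, Module.End.mul_apply, lp_oD, lp_oX, lt_io, algebraMap_smul,
    ← map_smul]
  rfl

theorem mul_op (q : MvPolynomial (Fin n) K) : ∃ p, ∀ g : Sq K n,
    op oX oD p (io g) = io (sq fun m => q * ev g m) := by
  induction q using MvPolynomial.induction_on with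
  | C a =>
    refine ⟨C (algebraMap _ _ (Polynomial.C a)), fun g => ?_⟩
    rw [← mul_one (C _), ← MvPolynomial.smul_eq_C_mul, map_smul, op_one, LinearMap.smul_apply,
      algebraMap_smul, Module.End.one_apply, ← map_smul]
    congr 1
    refine sq_ext fun m => ?_
    rw [ev_smul, ev_sq, Polynomial.eval_C, MvPolynomial.smul_eq_C_mul]
  | add q r hq hr =>
    obtain ⟨p, hp⟩ := hq
    obtain ⟨p', hp'⟩ := hr
    refine ⟨p + p', fun g => ?_⟩
    rw [map_add, LinearMap.add_apply, hp, hp', ← map_add]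
    congr 1
    refine sq_ext fun m => ?_
    rw [ev_add, ev_sq, ev_sq, ev_sq, add_mul]
  | mul_X q i hq =>
    obtain ⟨p, hp⟩ := hq
    refine ⟨MvPolynomial.X (Sum.inl i) * p, fun g => ?_⟩
    rw [← x_op weyl, Module.End.mul_apply, hp, oX, lt_io]
    congr 1
    refine sq_ext fun m => ?_
    simp only [ev_tw, ev_sq, mX, LinearMap.mulLeft_apply]
    ring

noncomputable def pr (K : Type*) [Field K] (a : ℕ) : Polynomial K :=
  ∏ j ∈ Finset.range a, (Polynomial.X - Polynomial.C (j : K))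

theorem pr_ne (a : ℕ) : pr K a ≠ 0 :=
  Finset.prod_ne_zero_iff.2 fun _ _ => Polynomial.X_sub_C_ne_zero _

theorem pr_eval (a m : ℕ) (h : m < a) : (pr K a).eval (m : K) = 0 := by
  rw [pr, Polynomial.eval_prod]
  exact Finset.prod_eq_zero (Finset.mem_range.2 h) (by simp)

theorem io_eq (a : ℕ) (g h : Sq K n) (hgh : ∀ m, a ≤ m → ev g m = ev h m) : io g = io h := by
  refine (IsLocalizedModule.eq_iff_exists (Polynomial K)⁰
    (LocalizedModule.mkLinearMap (Polynomial K)⁰ (Sq K n))).2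
    ⟨⟨pr K a, mem_nonZeroDivisors_of_ne_zero (pr_ne a)⟩, ?_⟩
  refine sq_ext fun m => ?_
  change ev (pr K a • g) m = ev (pr K a • h) m
  rw [ev_smul, ev_smul]
  by_cases hm : a ≤ m
  · rw [hgh m hm]
  · rw [pr_eval a m (by omega), zero_smul, zero_smul]
end seq
end BS

set_option linter.unusedSimpArgs false
namespace BS
open MvPolynomial
open scoped nonZeroDivisors

section fin
variable {K : Type*} [Field K] {n : ℕ}

/-- the filtration by poles and degrees -/
noncomputable def Ga (f : MvPolynomial (Fin n) K) (j : ℕ) :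
    Submodule (FractionRing (Polynomial K)) (Mo K n) :=
  Submodule.span _ {v | ∃ g : MvPolynomial (Fin n) K,
    (∀ i, degreeOf i g ≤ j * (f.totalDegree + 1)) ∧ v = io (sq fun m => g * f ^ (m - j))}

theorem mem_Ga (f : MvPolynomial (Fin n) K) (j : ℕ) (g : MvPolynomial (Fin n) K)
    (hg : ∀ i, degreeOf i g ≤ j * (f.totalDegree + 1)) :
    io (sq fun m => g * f ^ (m - j)) ∈ Ga f j := Submodule.subset_span ⟨g, hg, rfl⟩

theorem deg_pderiv (i k : Fin n) (g : MvPolynomial (Fin n) K) :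
    degreeOf k (pderiv i g) ≤ degreeOf k g := by
  classical
  rw [degreeOf_le_iff]
  intro m hm
  rw [mem_support_iff, coeff_pderiv] at hm
  have : m + Finsupp.single i 1 ∈ g.support := mem_support_iff.2 (left_ne_zero_of_mul hm)
  have h2 := (degreeOf_le_iff (d := degreeOf k g)).1 le_rfl _ this
  exact le_trans (by simp) h2

theorem Ga_mono (f : MvPolynomial (Fin n) K) : Monotone (Ga f) := by
  refine monotone_nat_of_le_succ fun j => Submodule.span_le.2 ?_
  rintro v ⟨g, hg, rfl⟩
  have : (io (sq fun m => g * f ^ (m - j)) : Mo K n) =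
      io (sq fun m => (g * f) * f ^ (m - (j + 1))) := by
    refine io_eq (j + 1) _ _ fun m hm => ?_
    rw [ev_sq, ev_sq, mul_assoc, ← pow_succ']
    congr 2; omega
  rw [this]
  refine mem_Ga f (j + 1) _ fun i => ?_
  have h1 := degreeOf_mul_le i g f
  have h2 := degreeOf_le_totalDegree f i
  have h3 := hg i
  linarith

theorem Ga_X (f : MvPolynomial (Fin n) K) (i : Fin n) (j : ℕ) (v : Mo K n) (hv : v ∈ Ga f j) :
    oX i v ∈ Ga f (j + 1) := by
  classical
  have : Ga f j ≤ (Ga f (j + 1)).comap (oX i) := by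
    refine Submodule.span_le.2 ?_
    rintro v ⟨g, hg, rfl⟩
    change oX i (io (sq fun m => g * f ^ (m - j)) : Mo K n) ∈ Ga f (j + 1)
    rw [oX, lt_io]
    have : (io (tw (mX i) (sq fun m => g * f ^ (m - j))) : Mo K n) =
        io (sq fun m => (MvPolynomial.X i * (g * f)) * f ^ (m - (j + 1))) := by
      refine io_eq (j + 1) _ _ fun m hm => ?_
      rw [ev_sq, ev_tw, ev_sq, mul_assoc, mul_assoc, ← pow_succ', mX, LinearMap.mulLeft_apply]
      congr 3; omega
    rw [this]
    refine mem_Ga f (j + 1) _ fun k => ?_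
    have h0 := degreeOf_mul_le k (MvPolynomial.X i) (g * f)
    have h1 := degreeOf_mul_le k g f
    have h2 := degreeOf_le_totalDegree f k
    have h3 := hg k
    have h4 : degreeOf k (MvPolynomial.X i : MvPolynomial (Fin n) K) ≤ 1 := by
      rw [degreeOf_X]; split_ifs <;> omega
    linarith
  exact this hv

theorem Ga_D (f : MvPolynomial (Fin n) K) (i : Fin n) (j : ℕ) (v : Mo K n) (hv : v ∈ Ga f j) :
    oD i v ∈ Ga f (j + 1) := by
  classical
  have : Ga f j ≤ (Ga f (j + 1)).comap (oD i) := by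
    refine Submodule.span_le.2 ?_
    rintro v ⟨g, hg, rfl⟩
    change oD i (io (sq fun m => g * f ^ (m - j)) : Mo K n) ∈ Ga f (j + 1)
    rw [oD, lt_io]
    have : (io (tw (mD i) (sq fun m => g * f ^ (m - j))) : Mo K n) =
        io ((sq fun m => (pderiv i g * f) * f ^ (m - (j + 1))) +
          (Polynomial.X - Polynomial.C (j : K)) • 
            (sq fun m => (g * pderiv i f) * f ^ (m - (j + 1)))) := by
      refine io_eq (j + 1) _ _ fun m hm => ?_
      obtain ⟨r, rfl⟩ := Nat.exists_eq_add_of_le hm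
      rw [ev_add, ev_smul, ev_sq, ev_tw, ev_sq, ev_sq]
      have e1 : j + 1 + r - j = r + 1 := by omega
      have e2 : j + 1 + r - (j + 1) = r := by omega
      rw [e1, e2, mD]
      simp only [Derivation.coeFn_coe, Derivation.leibniz, Derivation.leibniz_pow, smul_eq_mul,
        Polynomial.eval_sub, Polynomial.eval_X, Polynomial.eval_C]
      have e3 : (((j + 1 + r : ℕ) : K) - j) = ((r + 1 : ℕ) : K) := by push_cast; ring
      rw [e3, MvPolynomial.smul_eq_C_mul, map_natCast, nsmul_eq_mul, Nat.add_sub_cancel]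
      ring
    rw [this, map_add, map_smul]
    refine add_mem (mem_Ga f (j + 1) _ fun k => ?_) ?_
    · have h1 := degreeOf_mul_le k (pderiv i g) f
      have h2 := degreeOf_le_totalDegree f k
      have h3 := hg k
      have h4 := deg_pderiv i k g
      linarith
    · rw [← algebraMap_smul (FractionRing (Polynomial K))]
      refine Submodule.smul_mem _ _ (mem_Ga f (j + 1) _ fun k => ?_)
      have h1 := degreeOf_mul_le k g (pderiv i f)
      have h2 := degreeOf_le_totalDegree f k
      have h3 := hg k
      have h4 := deg_pderiv i k f
      linarith
  exact this hv

/-- a spanning family -/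
noncomputable def gen (f : MvPolynomial (Fin n) K) (j : ℕ)
    (e : Fin n → Fin (j * (f.totalDegree + 1) + 1)) : Mo K n :=
  io (sq fun m => monomial (Finsupp.equivFunOnFinite.symm fun i => (e i : ℕ)) 1 * f ^ (m - j))

theorem Ga_le (f : MvPolynomial (Fin n) K) (j : ℕ) :
    Ga f j ≤ Submodule.span _ (Set.range (gen f j)) := by
  refine Submodule.span_le.2 ?_
  rintro v ⟨g, hg, rfl⟩
  have : (sq fun m => g * f ^ (m - j)) = ∑ μ ∈ g.support,
      Polynomial.C (coeff μ g) • (sq fun m => monomial μ 1 * f ^ (m - j)) := by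
    refine sq_ext fun m => ?_
    rw [ev_sum]
    simp only [ev_smul, ev_sq, Polynomial.eval_C]
    conv_lhs => rw [g.as_sum, Finset.sum_mul]
    refine Finset.sum_congr rfl fun μ _ => ?_
    rw [← smul_mul_assoc, smul_monomial, smul_eq_mul, mul_one]
  rw [this, map_sum]
  refine sum_mem fun μ hμ => ?_
  rw [map_smul, ← algebraMap_smul (FractionRing (Polynomial K))]
  refine Submodule.smul_mem _ _ (Submodule.subset_span ⟨fun i => ⟨μ i, ?_⟩, ?_⟩)
  · have := (degreeOf_le_iff).1 (hg i) μ hμ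
    omega
  · rw [gen]
    congr 3
    funext m
    congr 2
    ext i
    simp

theorem Ga_fin (f : MvPolynomial (Fin n) K) (j : ℕ) :
    FiniteDimensional (FractionRing (Polynomial K)) (Ga f j) :=
  haveI := FiniteDimensional.span_of_finite (FractionRing (Polynomial K))
    (Set.finite_range (gen f j))
  Submodule.finiteDimensional_of_le (Ga_le f j)

theorem Ga_rank (f : MvPolynomial (Fin n) K) (j : ℕ) :
    Module.finrank (FractionRing (Polynomial K)) (Ga f j) ≤ (j * (f.totalDegree + 1) + 1) ^ n := by
  haveI := FiniteDimensional.span_of_finite (FractionRing (Polynomial K))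
    (Set.finite_range (gen f j))
  refine (Submodule.finrank_mono (Ga_le f j)).trans ?_
  refine (finrank_range_le_card (R := FractionRing (Polynomial K)) (gen f j)).trans ?_
  simp

/-- the sequence of shifted powers -/
noncomputable def us (f : MvPolynomial (Fin n) K) (k : ℕ) : Mo K n := io (sq fun m => f ^ (m + k))

theorem us_mem (f : MvPolynomial (Fin n) K) (l : ℕ) : ∃ a, ∀ k < l, us f k ∈ Ga f a := by
  refine ⟨l * f.totalDegree, fun k hk => ?_⟩
  have : us f k = io (sq fun m => f ^ (k + l * f.totalDegree) * f ^ (m - l * f.totalDegree)) := by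
    refine io_eq (l * f.totalDegree) _ _ fun m hm => ?_
    rw [ev_sq, ev_sq, ← pow_add]
    congr 1; omega
  rw [this]
  refine mem_Ga f _ _ fun i => (degreeOf_pow_le i f _).trans ?_
  have h2 := degreeOf_le_totalDegree f i
  calc (k + l * f.totalDegree) * degreeOf i f ≤ (k + l * f.totalDegree) * f.totalDegree :=
        Nat.mul_le_mul_left _ h2
    _ ≤ _ := by nlinarith

theorem step_exists [CharZero K] (f : MvPolynomial (Fin n) K) :
    ∃ k p, op oX oD p (us f (k + 1)) = us f k := by
  haveI : CharZero (FractionRing (Polynomial K)) :=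
    charZero_of_injective_algebraMap (IsFractionRing.injective (Polynomial K) _)
  haveI := Ga_fin f
  refine abstract_bernstein weyl (us f) (fun k => ?_) (Ga f) (Ga_mono f) (Ga_X f) (Ga_D f)
    f.totalDegree (Ga_rank f) (us_mem f)
  obtain ⟨p, hp⟩ := mul_op f
  refine ⟨p, ?_⟩
  rw [us, hp, us]
  congr 1
  refine sq_ext fun m => ?_
  simp only [ev_sq]
  ring

theorem shifted [CharZero K] (f : MvPolynomial (Fin n) K) :
    ∃ (k : ℕ) (S : Finset (Fin n ⊕ Fin n →₀ ℕ)) (c : (Fin n ⊕ Fin n →₀ ℕ) → Polynomial K)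
      (b : Polynomial K), b ≠ 0 ∧ ∀ m : ℕ, ∑ μ ∈ S, (c μ).eval (m : K) •
        (monomial (Finsupp.equivFunOnFinite.symm fun i => μ (Sum.inl i)) (1 : K) *
          iterPDeriv (fun i => μ (Sum.inr i)) (f ^ (m + (k + 1)))) =
        b.eval (m : K) • f ^ (m + k) := by
  obtain ⟨k, p, hp⟩ := step_exists f
  obtain ⟨b, hb⟩ := IsLocalization.exist_integer_multiples (Polynomial K)⁰ p.support
    (fun μ => coeff μ p)
  choose! c hc using hb
  have key : (io (∑ μ ∈ p.support, c μ • (sq fun m =>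
      monomial (Finsupp.equivFunOnFinite.symm fun i => μ (Sum.inl i)) 1 *
      iterPDeriv (fun i => μ (Sum.inr i)) (ev (sq fun m => f ^ (m + (k + 1))) m))) : Mo K n) =
      io ((b : Polynomial K) • sq fun m => f ^ (m + k)) := by
    rw [map_sum, map_smul]
    change _ = (b : Polynomial K) • us f k
    rw [← hp, ← algebraMap_smul (FractionRing (Polynomial K)), ← LinearMap.smul_apply, ← map_smul]
    conv_rhs => rw [p.as_sum, Finset.smul_sum, map_sum, LinearMap.sum_apply]
    refine Finset.sum_congr rfl fun μ hμ => ?_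
    rw [← op_mon, smul_monomial, hc μ hμ, algebraMap_smul]
    rfl
  obtain ⟨s, hs⟩ := (IsLocalizedModule.eq_iff_exists (Polynomial K)⁰
    (LocalizedModule.mkLinearMap (Polynomial K)⁰ (Sq K n))).1 key
  refine ⟨k, p.support, fun μ => s * c μ, s * b, mul_ne_zero (nonZeroDivisors.coe_ne_zero s)
    (nonZeroDivisors.coe_ne_zero b), fun m => ?_⟩
  have h := congrArg (fun g => ev g m) hs
  change ev ((s : Polynomial K) • _) m = ev ((s : Polynomial K) • _) m at h
  simp only [ev_smul, ev_sum, ev_sq, Finset.smul_sum, smul_smul] at h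
  simpa only [Polynomial.eval_mul] using h

theorem final [CharZero K] (f : MvPolynomial (Fin n) K) :
    ∃ b : Polynomial K, b ≠ 0 ∧ SatisfiesBernstein f b := by
  classical
  obtain ⟨k, S, c, b, hb, H⟩ := shifted f
  refine ⟨b.comp (Polynomial.X - Polynomial.C (k : K)) * pr K k, mul_ne_zero ?_ (pr_ne k), ?_⟩
  · intro h
    rcases Polynomial.comp_eq_zero_iff.1 h with h | ⟨-, h⟩
    · exact hb h
    · have := congrArg Polynomial.natDegree h
      rw [Polynomial.natDegree_X_sub_C, Polynomial.natDegree_C] at this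
      omega
  refine ⟨S.image fun μ => (fun i => μ (Sum.inl i), fun i => μ (Sum.inr i)),
    fun ab => (c (Finsupp.equivFunOnFinite.symm (Sum.elim ab.1 ab.2))).comp
      (Polynomial.X - Polynomial.C (k : K)) * pr K k, fun m => ?_⟩
  rw [Finset.sum_image]
  swap
  · intro μ _ ν _ h
    rw [Prod.mk.injEq] at h
    ext (i | i)
    · exact congrFun h.1 i
    · exact congrFun h.2 i
  by_cases hm : m < k
  · simp [pr_eval k m hm]
  obtain ⟨r, rfl⟩ := Nat.exists_eq_add_of_le (not_lt.1 hm)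
  have e0 : ∀ q : Polynomial K, (q.comp (Polynomial.X - Polynomial.C (k : K)) * pr K k).eval
      ((k + r : ℕ) : K) = (pr K k).eval ((k + r : ℕ) : K) * q.eval (r : K) := by
    intro q
    rw [Polynomial.eval_mul, Polynomial.eval_comp, mul_comm]
    congr 2
    simp
  simp only [e0]
  have h := H r
  simp only [MvPolynomial.smul_eq_C_mul] at h
  rw [map_mul, mul_assoc, show k + r = r + k by omega, ← h, Finset.mul_sum]
  refine Finset.sum_congr rfl fun μ _ => ?_
  have e1 : (Finsupp.equivFunOnFinite.symm (Sum.elim (fun i => μ (Sum.inl i))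
      fun i => μ (Sum.inr i))) = μ := by
    ext (i | i) <;> simp
  rw [e1, map_mul, add_assoc]
  ring
end fin
end BS

theorem stmt3 {K : Type*} [Field K] [CharZero K] {n : ℕ} (hn : 0 < n)
    (f : MvPolynomial (Fin n) K) (hf : 0 < f.totalDegree) :
    ∃ b : Polynomial K, b ≠ 0 ∧ SatisfiesBernstein f b := by
  exact BS.final f
end

section
/- Let f ∈ ℝ[x₁,…,xₙ] be a nonconstant polynomial and φ : ℝⁿ → ℂ a C^∞ function with compact support. Then there exists a meromorphic function G on ℂ such that G(s) = Z(f,φ;s) for every s with Re(s) > 0, and such that for every pole s₀ of G there exists k ∈ ℤ_{≥0} with the property that b(s₀ + k) = 0 for every b ∈ ℝ[s] satisfying a Bernstein identity for f (here b is evaluated at the complex number s₀ + k via the inclusion ℝ[s] ⊆ ℂ[s]). -/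
open MeasureTheory Filter

/-- The integrand `|f(x)|^s · φ(x)` of the real zeta function, where
`|f(x)|^s := exp(s · log |f(x)|)` if `f(x) ≠ 0` and `0` if `f(x) = 0`. -/
noncomputable def realZetaIntegrand {n : ℕ} (f : MvPolynomial (Fin n) ℝ)
    (φ : (Fin n → ℝ) → ℂ) (s : ℂ) (x : Fin n → ℝ) : ℂ :=
  (if MvPolynomial.eval x f = 0 then 0
    else Complex.exp (s * (Real.log |MvPolynomial.eval x f| : ℂ))) * φ x

/-- The real zeta function `Z(f,φ;s) = ∫_{ℝⁿ} |f(x)|^s φ(x) dx`. -/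
noncomputable def realZeta {n : ℕ} (f : MvPolynomial (Fin n) ℝ)
    (φ : (Fin n → ℝ) → ℂ) (s : ℂ) : ℂ :=
  ∫ x : Fin n → ℝ, realZetaIntegrand f φ s x

section WeylAbstract

/-- Ordered product of powers. -/
def ypow {R : Type*} [Monoid R] {n : ℕ} (Y : Fin n → R) (L : List (Fin n)) (β : Fin n → ℕ) : R :=
  (L.map (fun i => Y i ^ β i)).prod

theorem ypow_cons {R : Type*} [Monoid R] {n : ℕ} (Y : Fin n → R) (i : Fin n) (L : List (Fin n))
    (β : Fin n → ℕ) : ypow Y (i :: L) β = Y i ^ β i * ypow Y L β := by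
  simp [ypow]

theorem ypow_congr {R : Type*} [Monoid R] {n : ℕ} (Y : Fin n → R) (L : List (Fin n))
    (β γ : Fin n → ℕ) (h : ∀ i ∈ L, β i = γ i) : ypow Y L β = ypow Y L γ := by
  unfold ypow
  congr 1
  apply List.map_congr_left
  intro i hi
  rw [h i hi]

theorem pow_comm_aux {R : Type*} [Ring R] (y z : R) (ε : ℤ)
    (h : y * z = z * y + (ε : R)) (k : ℕ) :
    y ^ k * z = z * y ^ k + ((ε * k : ℤ) : R) * y ^ (k - 1) := by
  induction k with
  | zero => simp
  | succ k ih =>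
    have hc : ∀ (a : ℤ) (w : R), w * (a : R) = (a : R) * w := fun a w => (Int.cast_commute a w).symm.eq
    rw [pow_succ', mul_assoc, ih, mul_add, ← mul_assoc, h, ← mul_assoc, hc]
    have : ((ε * k : ℤ) : R) * y * y ^ (k - 1) = ((ε * k : ℤ) : R) * y ^ k := by
      rcases k with _ | k
      · simp
      · rw [mul_assoc, Nat.add_sub_cancel, pow_succ']
    rw [this]
    push_cast
    noncomm_ring

theorem ypow_comm {R : Type*} [Ring R] {n : ℕ} (Y : Fin n → R) (z : R) (ε : ℤ) (l : Fin n)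
    (hl : Y l * z = z * Y l + (ε : R)) (hne : ∀ i, i ≠ l → Y i * z = z * Y i)
    (L : List (Fin n)) (hL : L.Nodup) (β : Fin n → ℕ) :
    ypow Y L β * z = z * ypow Y L β +
      if l ∈ L then ((ε * β l : ℤ) : R) * ypow Y L (β - Pi.single l 1) else 0 := by
  induction L with
  | nil => simp [ypow]
  | cons i L ih =>
    have hc : ∀ (a : ℤ) (w : R), w * (a : R) = (a : R) * w := fun a w => (Int.cast_commute a w).symm.eq
    rw [List.nodup_cons] at hL
    rw [ypow_cons, ypow_cons, mul_assoc, ih hL.2]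
    by_cases hil : i = l
    · subst hil
      rw [if_neg hL.1, if_pos (by simp), add_zero, ← mul_assoc, pow_comm_aux _ _ ε hl, add_mul,
        mul_assoc, mul_assoc]
      congr 2
      rw [ypow_congr Y L (β - Pi.single i 1) β]
      · simp
      · intro j hj
        have : j ≠ i := fun h => hL.1 (h ▸ hj)
        simp [this]
    · have h1 : Y i ^ β i * z = z * Y i ^ β i :=
        (Commute.pow_left (show Commute (Y i) z from hne i hil) _).eq
      have hli : ¬ l = i := fun h => hil h.symm
      rw [mul_add, ← mul_assoc, h1, mul_assoc]
      congr 1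
      by_cases hlL : l ∈ L
      · rw [if_pos hlL, if_pos (by simp [hlL]), ← mul_assoc, hc, mul_assoc]
        simp [hil]
      · rw [if_neg hlL, if_neg (by simp [hlL, hli]), mul_zero]

theorem ypow_mul_left {R : Type*} [Ring R] {n : ℕ} (Y : Fin n → R) (l : Fin n)
    (hY : ∀ i j, Y i * Y j = Y j * Y i)
    (L : List (Fin n)) (hL : L.Nodup) (hlL : l ∈ L) (β : Fin n → ℕ) :
    Y l * ypow Y L β = ypow Y L (β + Pi.single l 1) := by
  induction L with
  | nil => simp at hlL
  | cons i L ih =>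
    rw [List.nodup_cons] at hL
    rw [ypow_cons, ypow_cons]
    by_cases hil : i = l
    · subst hil
      rw [← mul_assoc, ← pow_succ', ypow_congr Y L (β + Pi.single i 1) β]
      · simp
      · intro j hj
        have : j ≠ i := fun h => hL.1 (h ▸ hj)
        simp [this]
    · have hli : ¬ l = i := fun h => hil h.symm
      have hl' : l ∈ L := by simpa [hli] using hlL
      rw [← mul_assoc, (Commute.pow_right (show Commute (Y l) (Y i) from hY l i) _).eq, mul_assoc,
        ih hL.2 hl']
      simp [hil]

variable {K W : Type*} [Field K] [AddCommGroup W] [Module K W] {n : ℕ}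

/-- Weyl relations. -/
structure IsWeyl (X D : Fin n → Module.End K W) : Prop where
  xx : ∀ i j, X i * X j = X j * X i
  dd : ∀ i j, D i * D j = D j * D i
  dx : ∀ i, D i * X i = X i * D i + 1
  dxne : ∀ i j, i ≠ j → D i * X j = X j * D i

/-- Normally ordered monomial operator. -/
def weylMon (X D : Fin n → Module.End K W) (α β : Fin n → ℕ) : Module.End K W :=
  ypow X (List.finRange n) α * ypow D (List.finRange n) β

theorem weylMon_comm_X {X D : Fin n → Module.End K W} (h : IsWeyl X D) (α β : Fin n → ℕ)
    (l : Fin n) : weylMon X D α β * X l - X l * weylMon X D α β =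
      (β l : K) • weylMon X D α (β - Pi.single l 1) := by
  unfold weylMon
  have hX : X l * ypow X (List.finRange n) α = ypow X (List.finRange n) α * X l := by
    have := ypow_comm X (X l) 0 l (by simp) (fun i _ => h.xx i l) (List.finRange n)
      (List.nodup_finRange n) α
    simpa using this.symm
  have hD := ypow_comm D (X l) 1 l (by simpa using h.dx l) (fun i hi => h.dxne i l hi)
    (List.finRange n) (List.nodup_finRange n) β
  rw [mul_assoc, hD, if_pos (by simp), mul_add, ← mul_assoc, ← mul_assoc, ← mul_assoc, hX]
  simp only [one_mul, Int.cast_natCast]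
  rw [add_sub_cancel_left, (Nat.cast_commute (β l) _).symm.eq, mul_assoc,
    ← nsmul_eq_mul, Nat.cast_smul_eq_nsmul]

theorem weylMon_comm_D {X D : Fin n → Module.End K W} (h : IsWeyl X D) (α β : Fin n → ℕ)
    (l : Fin n) : D l * weylMon X D α β - weylMon X D α β * D l =
      (α l : K) • weylMon X D (α - Pi.single l 1) β := by
  unfold weylMon
  have hD : D l * ypow D (List.finRange n) β = ypow D (List.finRange n) β * D l := by
    have := ypow_comm D (D l) 0 l (by simp) (fun i _ => h.dd i l) (List.finRange n)
      (List.nodup_finRange n) β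
    simpa using this.symm
  have hX := ypow_comm X (D l) (-1) l (by rw [h.dx l]; simp)
    (fun i hi => (h.dxne l i (Ne.symm hi)).symm)
    (List.finRange n) (List.nodup_finRange n) α
  rw [if_pos (by simp)] at hX
  rw [mul_assoc, ← hD, ← mul_assoc, ← mul_assoc, hX]
  push_cast
  rw [add_mul, sub_add_eq_sub_sub, sub_self, zero_sub]
  simp only [neg_mul, one_mul, neg_neg]
  rw [mul_assoc, ← nsmul_eq_mul, Nat.cast_smul_eq_nsmul]

theorem X_mul_weylMon {X D : Fin n → Module.End K W} (h : IsWeyl X D) (α β : Fin n → ℕ)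
    (l : Fin n) : X l * weylMon X D α β = weylMon X D (α + Pi.single l 1) β := by
  unfold weylMon
  rw [← mul_assoc, ypow_mul_left X l h.xx _ (List.nodup_finRange n) (by simp)]

theorem weylMon_mul_D {X D : Fin n → Module.End K W} (h : IsWeyl X D) (α β : Fin n → ℕ)
    (l : Fin n) : weylMon X D α β * D l = weylMon X D α (β + Pi.single l 1) := by
  have hD : D l * ypow D (List.finRange n) β = ypow D (List.finRange n) β * D l := by
    have := ypow_comm D (D l) 0 l (by simp) (fun i _ => h.dd i l) (List.finRange n)
      (List.nodup_finRange n) β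
    simpa using this.symm
  unfold weylMon
  rw [mul_assoc, ← hD, ypow_mul_left D l h.dd _ (List.nodup_finRange n) (by simp)]

/-- Quantization of a symbol. -/
noncomputable def weylOp (X D : Fin n → Module.End K W) :
    MvPolynomial (Fin n ⊕ Fin n) K →ₗ[K] Module.End K W :=
  (MvPolynomial.basisMonomials (Fin n ⊕ Fin n) K).constr K
    (fun e => weylMon X D (fun i => e (Sum.inl i)) (fun i => e (Sum.inr i)))

theorem weylOp_monomial (X D : Fin n → Module.End K W) (e : (Fin n ⊕ Fin n) →₀ ℕ) (c : K) :
    weylOp X D (MvPolynomial.monomial e c) =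
      c • weylMon X D (fun i => e (Sum.inl i)) (fun i => e (Sum.inr i)) := by
  have h1 : MvPolynomial.monomial e c = c • MvPolynomial.basisMonomials (Fin n ⊕ Fin n) K e := by
    rw [MvPolynomial.coe_basisMonomials, MvPolynomial.smul_monomial, smul_eq_mul, mul_one]
  rw [h1, map_smul, weylOp, Module.Basis.constr_basis]

theorem weylOp_pderiv_inr {X D : Fin n → Module.End K W} (h : IsWeyl X D)
    (P : MvPolynomial (Fin n ⊕ Fin n) K) (l : Fin n) :
    weylOp X D (MvPolynomial.pderiv (Sum.inr l) P) = weylOp X D P * X l - X l * weylOp X D P := by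
  induction P using MvPolynomial.induction_on' with
  | monomial e c =>
    rw [MvPolynomial.pderiv_monomial, weylOp_monomial, weylOp_monomial, smul_mul_assoc,
      mul_smul_comm, ← smul_sub, weylMon_comm_X h, smul_smul]
    congr 2 <;> funext i <;> by_cases hi : l = i <;>
      simp [hi, Finsupp.single_apply, Pi.single_apply, eq_comm]
  | add p q hp hq =>
    rw [map_add, map_add, hp, hq, map_add, add_mul, mul_add]; abel

theorem weylOp_pderiv_inl {X D : Fin n → Module.End K W} (h : IsWeyl X D)
    (P : MvPolynomial (Fin n ⊕ Fin n) K) (l : Fin n) :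
    weylOp X D (MvPolynomial.pderiv (Sum.inl l) P) = D l * weylOp X D P - weylOp X D P * D l := by
  induction P using MvPolynomial.induction_on' with
  | monomial e c =>
    rw [MvPolynomial.pderiv_monomial, weylOp_monomial, weylOp_monomial, smul_mul_assoc,
      mul_smul_comm, ← smul_sub, weylMon_comm_D h, smul_smul]
    congr 2 <;> funext i <;> by_cases hi : l = i <;>
      simp [hi, Finsupp.single_apply, Pi.single_apply, eq_comm]
  | add p q hp hq =>
    rw [map_add, map_add, hp, hq, map_add, add_mul, mul_add]; abel

end WeylAbstract

section WeylAbstract2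
variable {K W : Type*} [Field K] [AddCommGroup W] [Module K W] {n : ℕ}

theorem ypow_mem (Y : Fin n → Module.End K W) (G : ℕ → Submodule K W)
    (hY : ∀ k l w, w ∈ G k → Y l w ∈ G (k + 1)) (L : List (Fin n)) (β : Fin n → ℕ) :
    ∀ k w, w ∈ G k → ypow Y L β w ∈ G (k + (L.map β).sum) := by
  have hp : ∀ (l : Fin n) (j k : ℕ) w, w ∈ G k → (Y l ^ j) w ∈ G (k + j) := by
    intro l j
    induction j with
    | zero => intro k w hw; simpa using hw
    | succ j ih =>
      intro k w hw
      rw [pow_succ', Module.End.mul_apply, ← add_assoc]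
      exact hY _ _ _ (ih k w hw)
  induction L with
  | nil => intro k w hw; simpa [ypow] using hw
  | cons i L ih =>
    intro k w hw
    rw [ypow_cons, Module.End.mul_apply, List.map_cons, List.sum_cons, add_comm (β i), ← add_assoc]
    exact hp _ _ _ _ (ih k w hw)

theorem weylMon_mem (X D : Fin n → Module.End K W) (G : ℕ → Submodule K W)
    (hX : ∀ k l w, w ∈ G k → X l w ∈ G (k + 1)) (hD : ∀ k l w, w ∈ G k → D l w ∈ G (k + 1))
    (α β : Fin n → ℕ) (k : ℕ) (w : W) (hw : w ∈ G k) :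
    weylMon X D α β w ∈ G (k + (∑ i, α i + ∑ i, β i)) := by
  have h1 := ypow_mem X G hX (List.finRange n) α _ _ (ypow_mem D G hD (List.finRange n) β k w hw)
  rw [← Fin.sum_univ_def, ← Fin.sum_univ_def] at h1
  rw [weylMon, Module.End.mul_apply, add_comm (∑ i, α i), ← add_assoc]
  exact h1

theorem weylOp_mem (X D : Fin n → Module.End K W) (G : ℕ → Submodule K W) (hG : Monotone G)
    (hX : ∀ k l w, w ∈ G k → X l w ∈ G (k + 1)) (hD : ∀ k l w, w ∈ G k → D l w ∈ G (k + 1))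
    (P : MvPolynomial (Fin n ⊕ Fin n) K) (i : ℕ) (hP : P.totalDegree ≤ i) (k : ℕ) (w : W)
    (hw : w ∈ G k) : weylOp X D P w ∈ G (k + i) := by
  rw [P.as_sum, map_sum, LinearMap.sum_apply]
  refine Submodule.sum_mem _ fun e he => ?_
  rw [weylOp_monomial, LinearMap.smul_apply]
  refine Submodule.smul_mem _ _ ?_
  refine hG ?_ (weylMon_mem X D G hX hD _ _ k w hw)
  have h1 := MvPolynomial.le_totalDegree he
  rw [Finsupp.sum_fintype _ _ (by simp), Fintype.sum_sum_type] at h1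
  omega

theorem eq_C_of_pderiv_eq_zero {σ : Type*} [CharZero K] (P : MvPolynomial σ K)
    (h : ∀ i, MvPolynomial.pderiv i P = 0) : P = MvPolynomial.C (MvPolynomial.coeff 0 P) := by
  classical
  ext e
  rw [MvPolynomial.coeff_C]
  split_ifs with he
  · rw [he]
  · obtain ⟨i, hi⟩ : ∃ i, e i ≠ 0 := by
      by_contra! hc
      exact he (by ext i; simp [hc i])
    have h1 := MvPolynomial.coeff_pderiv (i := i) P (e - Finsupp.single i 1)
    have h2 : e - Finsupp.single i 1 + Finsupp.single i 1 = e := by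
      apply tsub_add_cancel_of_le
      rw [Finsupp.single_le_iff]; omega
    rw [h i, h2, MvPolynomial.coeff_zero] at h1
    exact (mul_eq_zero.mp h1.symm).resolve_right (Nat.cast_add_one_ne_zero _)

theorem totalDegree_pderiv_le' {σ : Type*} (P : MvPolynomial σ K) (i : σ) (d : ℕ)
    (h : P.totalDegree ≤ d + 1) : (MvPolynomial.pderiv i P).totalDegree ≤ d := by
  classical
  refine Finset.sup_le fun e he => ?_
  rw [MvPolynomial.mem_support_iff, MvPolynomial.coeff_pderiv] at he
  have h1 : e + Finsupp.single i 1 ∈ P.support := by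
    rw [MvPolynomial.mem_support_iff]; exact left_ne_zero_of_mul he
  have h2 := (MvPolynomial.le_totalDegree h1).trans h
  rw [Finsupp.sum_add_index' (by simp) (by simp), Finsupp.sum_single_index rfl] at h2
  omega

theorem weyl_faithful [CharZero K] {X D : Fin n → Module.End K W} (h : IsWeyl X D)
    (G : ℕ → Submodule K W) (hG : Monotone G)
    (hX : ∀ k l w, w ∈ G k → X l w ∈ G (k + 1)) (hD : ∀ k l w, w ∈ G k → D l w ∈ G (k + 1))
    (u : W) (hu0 : u ≠ 0) (hu : u ∈ G 0) (i : ℕ) :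
    ∀ P : MvPolynomial (Fin n ⊕ Fin n) K, P.totalDegree ≤ i →
      (∀ w ∈ G i, weylOp X D P w = 0) → P = 0 := by
  have hconst : ∀ (i : ℕ) (c : K), (∀ w ∈ G i, weylOp X D (MvPolynomial.C c) w = 0) → c = 0 := by
    intro i c hc
    have h1 := hc u (hG (Nat.zero_le i) hu)
    rw [MvPolynomial.C_apply, weylOp_monomial] at h1
    have h2 : weylMon X D (fun _ => 0) (fun _ => 0) = 1 := by simp [weylMon, ypow]
    simp only [Finsupp.coe_zero, Pi.zero_apply, h2, LinearMap.smul_apply, Module.End.one_apply] at h1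
    exact (smul_eq_zero.mp h1).resolve_right hu0
  induction i with
  | zero =>
    intro P hP hk
    rw [MvPolynomial.totalDegree_eq_zero_iff_eq_C.mp (Nat.le_zero.mp hP)] at hk ⊢
    rw [hconst 0 _ hk, map_zero]
  | succ i ih =>
    intro P hP hk
    have hz : ∀ j, MvPolynomial.pderiv j P = 0 := by
      intro j
      refine ih _ (totalDegree_pderiv_le' P j i hP) ?_
      intro w hw
      have hw' : w ∈ G (i + 1) := hG (Nat.le_succ i) hw
      rcases j with l | l
      · rw [weylOp_pderiv_inl h, LinearMap.sub_apply, Module.End.mul_apply, Module.End.mul_apply,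
          hk _ hw', hk _ (hD _ _ _ hw), map_zero, sub_zero]
      · rw [weylOp_pderiv_inr h, LinearMap.sub_apply, Module.End.mul_apply, Module.End.mul_apply,
          hk _ hw', hk _ (hX _ _ _ hw), map_zero, sub_zero]
    have hC := eq_C_of_pderiv_eq_zero P hz
    rw [hC] at hk ⊢
    rw [hconst _ _ hk, map_zero]

theorem bernstein_ineq [CharZero K] {X D : Fin n → Module.End K W} (h : IsWeyl X D)
    (G : ℕ → Submodule K W) (hG : Monotone G) [∀ i, FiniteDimensional K (G i)]
    (hX : ∀ k l w, w ∈ G k → X l w ∈ G (k + 1)) (hD : ∀ k l w, w ∈ G k → D l w ∈ G (k + 1))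
    (u : W) (hu0 : u ≠ 0) (hu : u ∈ G 0) (m : ℕ) :
    (m + 1) ^ n ≤ Module.finrank K (G (4 * n * m)) := by
  set i := 2 * n * m with hi
  let E := (Fin n ⊕ Fin n) → Fin (m + 1)
  let mon : E → MvPolynomial (Fin n ⊕ Fin n) K :=
    fun e => MvPolynomial.monomial (Finsupp.equivFunOnFinite.symm (fun j => (e j : ℕ))) 1
  have hmon : LinearIndependent K mon := by
    have h1 := (MvPolynomial.basisMonomials (Fin n ⊕ Fin n) K).linearIndependent
    have h2 := h1.comp (fun e : E => Finsupp.equivFunOnFinite.symm (fun j => (e j : ℕ))) (by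
      intro a b hab
      funext j
      have := DFunLike.congr_fun hab j
      exact Fin.ext (by simpa using this))
    rw [MvPolynomial.coe_basisMonomials] at h2
    exact h2
  let B := MvPolynomial.restrictTotalDegree (Fin n ⊕ Fin n) K i
  have hmonB : ∀ e, mon e ∈ B := by
    intro e
    rw [MvPolynomial.mem_restrictTotalDegree]
    refine (MvPolynomial.totalDegree_monomial_le _ _).trans ?_
    rw [Finsupp.sum_fintype _ _ (by simp)]
    calc _ ≤ ∑ j : Fin n ⊕ Fin n, m := Finset.sum_le_sum fun j _ => by
            simpa using Nat.lt_succ_iff.mp (e j).2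
      _ = i := by rw [Finset.sum_const, Finset.card_univ, hi]; simp; ring_nf; simp
  have hmem : ∀ P : B, ∀ w ∈ G i, weylOp X D P w ∈ G (4 * n * m) := by
    intro P w hw
    have := weylOp_mem X D G hG hX hD P i ((MvPolynomial.mem_restrictTotalDegree _ _ _).mp P.2) i w hw
    convert this using 2
    rw [hi]; ring
  let Φ : B →ₗ[K] (G i →ₗ[K] G (4 * n * m)) :=
    { toFun := fun P => (weylOp X D P).restrict (hmem P)
      map_add' := by intro P Q; ext w; simp
      map_smul' := by intro c P; ext w; simp }
  have hΦ : LinearMap.ker Φ = ⊥ := by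
    rw [LinearMap.ker_eq_bot']
    intro P hP
    have := weyl_faithful h G hG hX hD u hu0 hu i P
      ((MvPolynomial.mem_restrictTotalDegree _ _ _).mp P.2) (by
        intro w hw
        have h1 := LinearMap.congr_fun hP ⟨w, hw⟩
        exact congrArg Subtype.val h1)
    exact Subtype.ext this
  have hB : LinearIndependent K (fun e : E => (⟨mon e, hmonB e⟩ : B)) := by
    apply LinearIndependent.of_comp B.subtype
    exact hmon
  have hI := (hB.map' Φ hΦ).fintype_card_le_finrank
  rw [Module.finrank_linearMap] at hI
  have hcard : Fintype.card E = (m + 1) ^ n * (m + 1) ^ n := by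
    simp [E, pow_add]
  have hle : Module.finrank K (G i) ≤ Module.finrank K (G (4 * n * m)) := by
    apply Submodule.finrank_mono
    apply hG
    rw [hi]; gcongr; norm_num
  rw [hcard] at hI
  have := hI.trans (Nat.mul_le_mul_right _ hle)
  exact Nat.mul_self_le_mul_self_iff.mp this

theorem finite_length_aux [CharZero K] {X D : Fin n → Module.End K W} (h : IsWeyl X D)
    (F : ℕ → Submodule K W) (hF : Monotone F) [∀ i, FiniteDimensional K (F i)]
    (hX : ∀ k l w, w ∈ F k → X l w ∈ F (k + 1)) (hD : ∀ k l w, w ∈ F k → D l w ∈ F (k + 1))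
    (N N' : Submodule K W)
    (hNX : ∀ l w, w ∈ N → X l w ∈ N) (hND : ∀ l w, w ∈ N → D l w ∈ N)
    (hNX' : ∀ l w, w ∈ N' → X l w ∈ N') (hND' : ∀ l w, w ∈ N' → D l w ∈ N')
    (hNN : N' ≤ N) (u : W) (hu : u ∈ N) (hu' : u ∉ N') (t m : ℕ) (hut : u ∈ F t) :
    (m + 1) ^ n + Module.finrank K (N' ⊓ F (t + 4 * n * m) : Submodule K W) ≤
      Module.finrank K (N ⊓ F (t + 4 * n * m) : Submodule K W) := by
  let X' : Fin n → Module.End K (W ⧸ N') := fun l => N'.mapQ N' (X l) (fun w hw => hNX' l w hw)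
  let D' : Fin n → Module.End K (W ⧸ N') := fun l => N'.mapQ N' (D l) (fun w hw => hND' l w hw)
  have hW : IsWeyl X' D' := by
    refine ⟨fun i j => ?_, fun i j => ?_, fun i => ?_, fun i j hij => ?_⟩
    · ext w
      exact congrArg N'.mkQ (LinearMap.congr_fun (h.xx i j) w)
    · ext w
      exact congrArg N'.mkQ (LinearMap.congr_fun (h.dd i j) w)
    · ext w
      exact congrArg N'.mkQ (LinearMap.congr_fun (h.dx i) w)
    · ext w
      exact congrArg N'.mkQ (LinearMap.congr_fun (h.dxne i j hij) w)
  let G : ℕ → Submodule K (W ⧸ N') := fun i => (N ⊓ F (t + i)).map N'.mkQ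
  have hfin : ∀ i, FiniteDimensional K (N ⊓ F i : Submodule K W) := fun i =>
    Submodule.finiteDimensional_of_le inf_le_right
  have hGfin : ∀ i, FiniteDimensional K (G i) := fun i => inferInstance
  have hG : Monotone G := fun a b hab =>
    Submodule.map_mono (inf_le_inf_left _ (hF (by omega)))
  have key := bernstein_ineq hW G hG (by
      rintro k l _ ⟨w, hw, rfl⟩
      exact ⟨X l w, ⟨hNX l w hw.1, hX _ l w hw.2⟩, rfl⟩) (by
      rintro k l _ ⟨w, hw, rfl⟩
      exact ⟨D l w, ⟨hND l w hw.1, hD _ l w hw.2⟩, rfl⟩) (N'.mkQ u) (by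
      simpa using hu') ⟨u, ⟨hu, hut⟩, rfl⟩ m
  set S := N ⊓ F (t + 4 * n * m) with hS
  have h1 := LinearMap.finrank_range_add_finrank_ker (N'.mkQ ∘ₗ S.subtype)
  have h2 : LinearMap.range (N'.mkQ ∘ₗ S.subtype) = G (4 * n * m) := by
    rw [LinearMap.range_comp, Submodule.range_subtype]
  have h3 : LinearMap.ker (N'.mkQ ∘ₗ S.subtype) = N'.comap S.subtype := by
    rw [LinearMap.ker_comp, Submodule.ker_mkQ]
  have h4 : (N'.comap S.subtype).map S.subtype = N' ⊓ F (t + 4 * n * m) := by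
    rw [Submodule.map_comap_subtype, hS, inf_assoc, inf_comm (F _), ← inf_assoc, inf_eq_right.mpr hNN]
  rw [h2, h3, ← Submodule.finrank_map_subtype_eq S, h4] at h1
  omega

theorem finite_length [CharZero K] {X D : Fin n → Module.End K W} (h : IsWeyl X D)
    (F : ℕ → Submodule K W) (hF : Monotone F) [∀ i, FiniteDimensional K (F i)]
    (hX : ∀ k l w, w ∈ F k → X l w ∈ F (k + 1)) (hD : ∀ k l w, w ∈ F k → D l w ∈ F (k + 1))
    (C : ℕ) (hC : ∀ i, Module.finrank K (F i) ≤ (C * (i + 1)) ^ n)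
    (N : ℕ → Submodule K W)
    (hNX : ∀ j l w, w ∈ N j → X l w ∈ N j) (hND : ∀ j l w, w ∈ N j → D l w ∈ N j)
    (hNN : ∀ j, N (j + 1) ≤ N j) (u : ℕ → W) (hu : ∀ j, u j ∈ N j)
    (t : ℕ → ℕ) (hut : ∀ j, u j ∈ F (t j)) : ∃ j, u j ∈ N (j + 1) := by
  by_contra! hcon
  set r := (C * (4 * n + 1)) ^ n + 1 with hr
  set T := ∑ j ∈ Finset.range r, t j with hT
  have ht : ∀ j < r, u j ∈ F T := fun j hj =>
    hF (Finset.single_le_sum (f := t) (fun _ _ => Nat.zero_le _) (Finset.mem_range.mpr hj)) (hut j)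
  have htel : ∀ j ≤ r, j * (T + 1) ^ n +
      Module.finrank K (N j ⊓ F (T + 4 * n * T) : Submodule K W) ≤
      Module.finrank K (F (T + 4 * n * T)) := by
    intro j
    induction j with
    | zero =>
      intro _
      rw [zero_mul, zero_add]
      exact Submodule.finrank_mono inf_le_right
    | succ j ih =>
      intro hj
      have h1 := ih (by omega)
      have h2 := finite_length_aux h F hF hX hD (N j) (N (j + 1)) (hNX j) (hND j) (hNX _) (hND _)
        (hNN j) (u j) (hu j) (hcon j) T T (ht j (by omega))
      rw [add_mul, one_mul]
      omega
  have h1 := htel r le_rfl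
  have h2 := hC (T + 4 * n * T)
  have h3 : (C * (T + 4 * n * T + 1)) ^ n ≤ (C * (4 * n + 1)) ^ n * (T + 1) ^ n := by
    rw [← mul_pow]
    apply Nat.pow_le_pow_left
    rw [mul_assoc C]
    apply Nat.mul_le_mul_left
    nlinarith
  have h4 : r * (T + 1) ^ n ≤ (C * (4 * n + 1)) ^ n * (T + 1) ^ n := by omega
  have h5 := Nat.le_of_mul_le_mul_right h4 (by positivity)
  omega

end WeylAbstract2

section BernsteinConcrete

/-- Sequences of polynomials, on which polynomials in `s` act by evaluation at the index. -/
def BSeq (n : ℕ) : Type := ℕ → MvPolynomial (Fin n) ℝ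

noncomputable instance (n : ℕ) : AddCommGroup (BSeq n) :=
  inferInstanceAs (AddCommGroup (ℕ → MvPolynomial (Fin n) ℝ))

noncomputable instance (n : ℕ) : Module (Polynomial ℝ) (BSeq n) where
  smul c g := fun m => (Polynomial.eval (m : ℝ) c) • g m
  one_smul g := by
    funext m
    change (Polynomial.eval (m : ℝ) 1) • g m = g m
    simp
  mul_smul a b g := by
    funext m
    change (Polynomial.eval (m : ℝ) (a * b)) • g m =
      (Polynomial.eval (m : ℝ) a) • ((Polynomial.eval (m : ℝ) b) • g m)
    rw [Polynomial.eval_mul, mul_smul]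
  smul_zero a := by
    funext m
    exact smul_zero (A := MvPolynomial (Fin n) ℝ) (Polynomial.eval (m : ℝ) a)
  smul_add a g h := by
    funext m
    exact smul_add (A := MvPolynomial (Fin n) ℝ) (Polynomial.eval (m : ℝ) a) (g m) (h m)
  add_smul a b g := by
    funext m
    change (Polynomial.eval (m : ℝ) (a + b)) • g m =
      (Polynomial.eval (m : ℝ) a) • g m + (Polynomial.eval (m : ℝ) b) • g m
    rw [Polynomial.eval_add, add_smul]
  zero_smul g := by
    funext m
    change (Polynomial.eval (m : ℝ) 0) • g m = 0
    simp

theorem BSeq.smul_apply {n : ℕ} (c : Polynomial ℝ) (g : BSeq n) (m : ℕ) :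
    (c • g) m = (Polynomial.eval (m : ℝ) c) • g m := rfl

theorem BSeq.add_apply {n : ℕ} (g h : BSeq n) (m : ℕ) : (g + h) m = g m + h m := rfl

theorem BSeq.sum_apply {n : ℕ} {ι : Type*} (s : Finset ι) (g : ι → BSeq n) (m : ℕ) :
    (∑ i ∈ s, g i) m = ∑ i ∈ s, g i m :=
  Finset.sum_apply (M := fun _ : ℕ => MvPolynomial (Fin n) ℝ) m s g

/-- Coordinatewise action of an operator. -/
noncomputable def BSeq.lift {n : ℕ} (T : Module.End ℝ (MvPolynomial (Fin n) ℝ)) :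
    Module.End (Polynomial ℝ) (BSeq n) where
  toFun g := fun m => T (g m)
  map_add' g h := by funext m; exact map_add T (g m) (h m)
  map_smul' c g := by funext m; exact map_smul T (Polynomial.eval (m : ℝ) c) (g m)

abbrev BK : Type := Localization (nonZeroDivisors (Polynomial ℝ))

abbrev BW (n : ℕ) : Type := LocalizedModule (nonZeroDivisors (Polynomial ℝ)) (BSeq n)

/-- The canonical map. -/
noncomputable def BSeq.toBW {n : ℕ} : BSeq n →ₗ[Polynomial ℝ] BW n :=
  LocalizedModule.mkLinearMap (nonZeroDivisors (Polynomial ℝ)) (BSeq n)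

/-- Operators on the localized module. -/
noncomputable def bop (n : ℕ) :
    Module.End ℝ (MvPolynomial (Fin n) ℝ) →+* Module.End BK (BW n) where
  toFun T := LocalizedModule.map (nonZeroDivisors (Polynomial ℝ)) (BSeq.lift T)
  map_one' := by
    ext x
    induction x using LocalizedModule.induction_on with
    | h m s => rw [LocalizedModule.map_mk]; rfl
  map_mul' T S := by
    ext x
    induction x using LocalizedModule.induction_on with
    | h m s => rw [Module.End.mul_apply, LocalizedModule.map_mk, LocalizedModule.map_mk,
        LocalizedModule.map_mk]; rfl
  map_zero' := by
    have : BSeq.lift (0 : Module.End ℝ (MvPolynomial (Fin n) ℝ)) = 0 := rfl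
    rw [this, map_zero]
  map_add' T S := by
    have : BSeq.lift (T + S) = BSeq.lift T + BSeq.lift S := rfl
    rw [this, map_add]

theorem bop_toBW {n : ℕ} (T : Module.End ℝ (MvPolynomial (Fin n) ℝ)) (g : BSeq n) :
    bop n T (BSeq.toBW g) = BSeq.toBW (fun m => T (g m) : BSeq n) := by
  exact LocalizedModule.map_mk _ _ _ _

theorem toBW_eq_of_eventually {n : ℕ} (g h : BSeq n) (m0 : ℕ) (H : ∀ m, m0 ≤ m → g m = h m) :
    BSeq.toBW g = BSeq.toBW h := by
  have hne : (∏ i ∈ Finset.range m0, (Polynomial.X - Polynomial.C (i : ℝ))) ∈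
      nonZeroDivisors (Polynomial ℝ) := by
    rw [mem_nonZeroDivisors_iff_ne_zero, Finset.prod_ne_zero_iff]
    exact fun i _ => Polynomial.X_sub_C_ne_zero _
  unfold BSeq.toBW
  rw [IsLocalizedModule.eq_iff_exists (nonZeroDivisors (Polynomial ℝ))]
  refine ⟨⟨_, hne⟩, ?_⟩
  funext m
  change (Polynomial.eval (m : ℝ) (∏ i ∈ Finset.range m0, (Polynomial.X - Polynomial.C (i : ℝ)))) •
    (g m : MvPolynomial (Fin n) ℝ) = (Polynomial.eval (m : ℝ)
      (∏ i ∈ Finset.range m0, (Polynomial.X - Polynomial.C (i : ℝ)))) • h m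
  by_cases hm : m0 ≤ m
  · rw [H m hm]
  · have : Polynomial.eval (m : ℝ) (∏ i ∈ Finset.range m0, (Polynomial.X - Polynomial.C (i : ℝ))) = 0 := by
      rw [Polynomial.eval_prod]
      exact Finset.prod_eq_zero (Finset.mem_range.mpr (not_le.mp hm)) (by simp)
    rw [this, zero_smul, zero_smul]

/-- Multiplication by a variable. -/
noncomputable def mulX {n : ℕ} (i : Fin n) : Module.End ℝ (MvPolynomial (Fin n) ℝ) :=
  LinearMap.mulLeft ℝ (MvPolynomial.X i)

/-- Partial derivative as a linear map. -/
noncomputable def dX {n : ℕ} (i : Fin n) : Module.End ℝ (MvPolynomial (Fin n) ℝ) :=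
  (MvPolynomial.pderiv i).toLinearMap

theorem mulX_apply {n : ℕ} (i : Fin n) (q : MvPolynomial (Fin n) ℝ) :
    mulX i q = MvPolynomial.X i * q := rfl

theorem dX_apply {n : ℕ} (i : Fin n) (q : MvPolynomial (Fin n) ℝ) :
    dX i q = MvPolynomial.pderiv i q := rfl

theorem pderiv_comm' {n : ℕ} (i j : Fin n) (q : MvPolynomial (Fin n) ℝ) :
    MvPolynomial.pderiv i (MvPolynomial.pderiv j q) =
      MvPolynomial.pderiv j (MvPolynomial.pderiv i q) := by
  have h : ⁅MvPolynomial.pderiv (R := ℝ) i, MvPolynomial.pderiv (R := ℝ) j⁆ = 0 := by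
    apply MvPolynomial.derivation_ext
    intro k
    rw [Derivation.commutator_apply]
    simp [MvPolynomial.pderiv_X, Pi.single_apply, apply_ite]
  have h2 := DFunLike.congr_fun h q
  rw [Derivation.commutator_apply] at h2
  exact sub_eq_zero.mp h2

theorem isWeyl_bop (n : ℕ) : IsWeyl (fun i : Fin n => bop n (mulX i)) (fun i => bop n (dX i)) := by
  refine ⟨fun i j => ?_, fun i j => ?_, fun i => ?_, fun i j hij => ?_⟩
  · rw [← map_mul, ← map_mul]
    congr 1
    apply LinearMap.ext
    intro q
    simp only [Module.End.mul_apply, mulX_apply]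
    ring
  · rw [← map_mul, ← map_mul]
    congr 1
    apply LinearMap.ext
    intro q
    simp only [Module.End.mul_apply, dX_apply]
    exact pderiv_comm' _ _ _
  · rw [← map_mul, ← map_mul, ← map_one (bop n), ← map_add]
    congr 1
    apply LinearMap.ext
    intro q
    simp only [Module.End.mul_apply, dX_apply, mulX_apply, LinearMap.add_apply, Module.End.one_apply]
    rw [MvPolynomial.pderiv_mul, MvPolynomial.pderiv_X_self]
    ring
  · rw [← map_mul, ← map_mul]
    congr 1
    apply LinearMap.ext
    intro q
    simp only [Module.End.mul_apply, dX_apply, mulX_apply]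
    rw [MvPolynomial.pderiv_mul, MvPolynomial.pderiv_X_of_ne hij.symm]
    ring

theorem ypow_map {R S : Type*} [Semiring R] [Semiring S] (φ : R →+* S) {n : ℕ} (Y : Fin n → R)
    (L : List (Fin n)) (β : Fin n → ℕ) : ypow (fun i => φ (Y i)) L β = φ (ypow Y L β) := by
  unfold ypow
  rw [map_list_prod, List.map_map]
  congr 2
  funext i
  simp

theorem ypow_dX {n : ℕ} (β : Fin n → ℕ) (q : MvPolynomial (Fin n) ℝ) :
    ypow dX (List.finRange n) β q = iterPDeriv β q := by
  unfold iterPDeriv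
  generalize List.finRange n = L
  induction L with
  | nil => rfl
  | cons i L ih =>
    rw [ypow_cons, Module.End.mul_apply, ih, List.foldr_cons, Module.End.pow_apply]
    rfl

theorem ypow_mulX {n : ℕ} (α : Fin n → ℕ) (q : MvPolynomial (Fin n) ℝ) :
    ypow mulX (List.finRange n) α q =
      MvPolynomial.monomial (Finsupp.equivFunOnFinite.symm α) (1 : ℝ) * q := by
  have h1 : ∀ L : List (Fin n), ypow mulX L α q =
      (L.map (fun i => (MvPolynomial.X i : MvPolynomial (Fin n) ℝ) ^ α i)).prod * q := by
    intro L
    induction L with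
    | nil => simp [ypow]
    | cons i L ih =>
      rw [ypow_cons, Module.End.mul_apply, ih, List.map_cons, List.prod_cons, mul_assoc]
      have h2 : ∀ (k : ℕ) (p : MvPolynomial (Fin n) ℝ), (mulX i ^ k) p = MvPolynomial.X i ^ k * p := by
        intro k
        induction k with
        | zero => intro p; simp
        | succ k ihk => intro p; rw [pow_succ', Module.End.mul_apply, ihk, mulX_apply]; ring
      exact h2 _ _
  rw [h1, MvPolynomial.monomial_eq, Finsupp.prod_fintype _ _ (by simp), ← Fin.prod_univ_def]
  simp

theorem weylMon_bop {n : ℕ} (α β : Fin n → ℕ) (g : BSeq n) :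
    weylMon (fun i => bop n (mulX i)) (fun i => bop n (dX i)) α β (BSeq.toBW g) =
      BSeq.toBW (fun m => MvPolynomial.monomial (Finsupp.equivFunOnFinite.symm α) (1 : ℝ) *
        iterPDeriv β (g m) : BSeq n) := by
  unfold weylMon
  rw [ypow_map (bop n), ypow_map (bop n), Module.End.mul_apply]
  refine (congrArg _ (bop_toBW _ _)).trans ((bop_toBW _ _).trans ?_)
  refine congrArg _ ?_
  funext m
  exact (ypow_mulX _ _).trans (congrArg _ (ypow_dX _ _))

end BernsteinConcrete

section BernsteinExistence

variable {n : ℕ}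

/-- The element `q f^(s-k)`. -/
noncomputable def bel (f q : MvPolynomial (Fin n) ℝ) (k : ℕ) : BW n :=
  BSeq.toBW (fun m => q * f ^ (m - k) : BSeq n)

/-- The Bernstein type filtration. -/
noncomputable def bfilt (f : MvPolynomial (Fin n) ℝ) (k : ℕ) : Submodule BK (BW n) :=
  Submodule.span BK (Set.range fun e : Fin n → Fin (k * (f.totalDegree + 1) + 1) =>
    bel f (MvPolynomial.monomial (Finsupp.equivFunOnFinite.symm fun i => (e i : ℕ)) 1) k)

theorem poly_smul_mem (N : Submodule BK (BW n)) (c : Polynomial ℝ) (w : BW n) (hw : w ∈ N) :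
    c • w ∈ N := by
  rw [← algebraMap_smul BK c w]
  exact N.smul_mem _ hw

theorem toBW_add' (g h : ℕ → MvPolynomial (Fin n) ℝ) :
    BSeq.toBW (fun m => g m + h m : BSeq n) = BSeq.toBW (g : BSeq n) + BSeq.toBW (h : BSeq n) :=
  map_add BSeq.toBW (g : BSeq n) (h : BSeq n)

theorem toBW_smul' (c : Polynomial ℝ) (g : ℕ → MvPolynomial (Fin n) ℝ) :
    BSeq.toBW (fun m => Polynomial.eval (m : ℝ) c • g m : BSeq n) = c • BSeq.toBW (g : BSeq n) :=
  LinearMap.map_smul (BSeq.toBW (n := n)) c g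

theorem bel_add (f p q : MvPolynomial (Fin n) ℝ) (k : ℕ) :
    bel f (p + q) k = bel f p k + bel f q k := by
  refine Eq.trans ?_ (toBW_add' _ _)
  refine congrArg BSeq.toBW ?_
  funext m
  exact add_mul _ _ _

theorem bel_smul (f q : MvPolynomial (Fin n) ℝ) (c : ℝ) (k : ℕ) :
    bel f (c • q) k = (Polynomial.C c) • bel f q k := by
  refine Eq.trans ?_ (toBW_smul' _ _)
  refine congrArg BSeq.toBW ?_
  funext m
  rw [Polynomial.eval_C]
  exact smul_mul_assoc _ _ _

theorem bel_zero (f : MvPolynomial (Fin n) ℝ) (k : ℕ) : bel f 0 k = 0 := by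
  have := bel_smul f 0 0 k
  simpa using this

theorem bel_mem (f q : MvPolynomial (Fin n) ℝ) (k : ℕ)
    (h : ∀ i, q.degreeOf i ≤ k * (f.totalDegree + 1)) : bel f q k ∈ bfilt f k := by
  have hsum : ∀ s : Finset (Fin n →₀ ℕ), s ⊆ q.support →
      bel f (∑ v ∈ s, MvPolynomial.monomial v (q.coeff v)) k ∈ bfilt f k := by
    intro s
    induction s using Finset.induction_on with
    | empty => intro _; rw [Finset.sum_empty, bel_zero]; exact Submodule.zero_mem _
    | insert v s hv ih =>
      intro hs
      rw [Finset.sum_insert hv, bel_add]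
      refine Submodule.add_mem _ ?_ (ih (fun x hx => hs (Finset.mem_insert_of_mem hx)))
      have hvq := hs (Finset.mem_insert_self v s)
      have h1 : MvPolynomial.monomial v (q.coeff v) =
          q.coeff v • (MvPolynomial.monomial v (1 : ℝ)) := by
        rw [MvPolynomial.smul_monomial, smul_eq_mul, mul_one]
      rw [h1, bel_smul]
      apply poly_smul_mem
      apply Submodule.subset_span
      refine ⟨fun i => ⟨v i, Nat.lt_succ_of_le
        ((MvPolynomial.degreeOf_le_iff.mp (h i)) v hvq)⟩, ?_⟩
      dsimp only
      congr 3
      ext i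
      rfl
  have := hsum q.support (Finset.Subset.refl _)
  rwa [← MvPolynomial.as_sum q] at this

theorem degreeOf_pderiv_le (q : MvPolynomial (Fin n) ℝ) (i l : Fin n) :
    (MvPolynomial.pderiv l q).degreeOf i ≤ q.degreeOf i := by
  rw [MvPolynomial.degreeOf_le_iff]
  intro v hv
  rw [MvPolynomial.mem_support_iff, MvPolynomial.coeff_pderiv] at hv
  have h1 : q.coeff (v + Finsupp.single l 1) ≠ 0 := left_ne_zero_of_mul hv
  have h2 := (MvPolynomial.degreeOf_le_iff.mp (le_refl (q.degreeOf i)))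
    (v + Finsupp.single l 1) (MvPolynomial.mem_support_iff.mpr h1)
  refine le_trans ?_ h2
  simp

theorem bel_raise (f q : MvPolynomial (Fin n) ℝ) (k : ℕ) : bel f q k = bel f (q * f) (k + 1) := by
  apply toBW_eq_of_eventually _ _ (k + 1)
  intro m hm
  obtain ⟨j, rfl⟩ := Nat.exists_eq_add_of_le hm
  have h1 : k + 1 + j - k = j + 1 := by omega
  have h2 : k + 1 + j - (k + 1) = j := by omega
  change q * f ^ (k + 1 + j - k) = q * f * f ^ (k + 1 + j - (k + 1))
  rw [h1, h2]
  ring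

theorem bop_X_bel (f q : MvPolynomial (Fin n) ℝ) (k : ℕ) (l : Fin n) :
    bop n (mulX l) (bel f q k) = bel f (MvPolynomial.X l * q) k := by
  refine (bop_toBW _ _).trans ?_
  refine congrArg _ ?_
  funext m
  exact (mul_assoc _ _ _).symm

theorem bop_D_bel (f q : MvPolynomial (Fin n) ℝ) (k : ℕ) (l : Fin n) :
    bop n (dX l) (bel f q k) = bel f (MvPolynomial.pderiv l q * f) (k + 1) +
      (Polynomial.X - Polynomial.C (k : ℝ)) • bel f (q * MvPolynomial.pderiv l f) (k + 1) := by
  refine (bop_toBW _ _).trans ?_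
  refine Eq.trans ?_ ((toBW_add' _ _).trans (congrArg _ (toBW_smul' _ _)))
  apply toBW_eq_of_eventually _ _ (k + 1)
  intro m hm
  obtain ⟨j, rfl⟩ := Nat.exists_eq_add_of_le hm
  have h1 : k + 1 + j - k = j + 1 := by omega
  have h2 : k + 1 + j - (k + 1) = j := by omega
  change MvPolynomial.pderiv l (q * f ^ (k + 1 + j - k)) =
    MvPolynomial.pderiv l q * f * f ^ (k + 1 + j - (k + 1)) +
    (Polynomial.eval ((k + 1 + j : ℕ) : ℝ) (Polynomial.X - Polynomial.C (k : ℝ))) •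
      (q * MvPolynomial.pderiv l f * f ^ (k + 1 + j - (k + 1)))
  rw [h1, h2, MvPolynomial.pderiv_mul, MvPolynomial.pderiv_pow]
  simp only [Polynomial.eval_sub, Polynomial.eval_X, Polynomial.eval_C]
  have h3 : (((k + 1 + j : ℕ) : ℝ) - (k : ℝ)) = ((j + 1 : ℕ) : ℝ) := by push_cast; ring
  rw [h3, MvPolynomial.smul_eq_C_mul, map_natCast]
  simp only [Nat.add_sub_cancel]
  ring

theorem monomial_degreeOf_le (k : ℕ) (e : Fin n → Fin (k + 1)) (i : Fin n) :
    (MvPolynomial.monomial (Finsupp.equivFunOnFinite.symm fun i => (e i : ℕ))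
      (1 : ℝ)).degreeOf i ≤ k := by
  rw [MvPolynomial.degreeOf_monomial_eq _ _ one_ne_zero]
  exact Nat.le_of_lt_succ (e i).2

theorem bfilt_map_le (f : MvPolynomial (Fin n) ℝ) (k : ℕ) (T : Module.End BK (BW n))
    (N : Submodule BK (BW n))
    (h : ∀ q : MvPolynomial (Fin n) ℝ, (∀ i, q.degreeOf i ≤ k * (f.totalDegree + 1)) →
      T (bel f q k) ∈ N) (w : BW n) (hw : w ∈ bfilt f k) : T w ∈ N := by
  have : bfilt f k ≤ N.comap T := by
    unfold bfilt
    rw [Submodule.span_le]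
    rintro _ ⟨e, rfl⟩
    exact h _ (monomial_degreeOf_le _ e)
  exact this hw

theorem bfilt_mono (f : MvPolynomial (Fin n) ℝ) : Monotone (bfilt f) := by
  apply monotone_nat_of_le_succ
  intro k w hw
  refine bfilt_map_le f k 1 _ (fun q hq => ?_) w hw
  rw [Module.End.one_apply, bel_raise]
  apply bel_mem
  intro i
  have h1 := MvPolynomial.degreeOf_mul_le i q f
  have h2 := MvPolynomial.degreeOf_le_totalDegree f i
  have h3 := hq i
  rw [add_mul]
  omega

theorem bfilt_X (f : MvPolynomial (Fin n) ℝ) (k : ℕ) (l : Fin n) (w : BW n)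
    (hw : w ∈ bfilt f k) : bop n (mulX l) w ∈ bfilt f (k + 1) := by
  refine bfilt_map_le f k _ _ (fun q hq => ?_) w hw
  rw [bop_X_bel, bel_raise]
  apply bel_mem
  intro i
  have h1 := MvPolynomial.degreeOf_mul_le i (MvPolynomial.X l * q) f
  have h2 := MvPolynomial.degreeOf_le_totalDegree f i
  have h3 := hq i
  have h4 := MvPolynomial.degreeOf_mul_le i (MvPolynomial.X l) q
  have h5 : (MvPolynomial.X l : MvPolynomial (Fin n) ℝ).degreeOf i ≤ 1 := by
    rw [MvPolynomial.degreeOf_X]; split_ifs <;> simp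
  rw [add_mul]
  omega

theorem bfilt_D (f : MvPolynomial (Fin n) ℝ) (k : ℕ) (l : Fin n) (w : BW n)
    (hw : w ∈ bfilt f k) : bop n (dX l) w ∈ bfilt f (k + 1) := by
  refine bfilt_map_le f k _ _ (fun q hq => ?_) w hw
  rw [bop_D_bel]
  refine Submodule.add_mem _ (bel_mem _ _ _ fun i => ?_) (poly_smul_mem _ _ _ (bel_mem _ _ _ fun i => ?_))
  · have h1 := MvPolynomial.degreeOf_mul_le i (MvPolynomial.pderiv l q) f
    have h2 := MvPolynomial.degreeOf_le_totalDegree f i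
    have h3 := hq i
    have h4 := degreeOf_pderiv_le q i l
    rw [add_mul]
    omega
  · have h1 := MvPolynomial.degreeOf_mul_le i q (MvPolynomial.pderiv l f)
    have h2 := MvPolynomial.degreeOf_le_totalDegree f i
    have h3 := hq i
    have h4 := degreeOf_pderiv_le f i l
    rw [add_mul]
    omega

instance bfilt_fd (f : MvPolynomial (Fin n) ℝ) (k : ℕ) : FiniteDimensional BK (bfilt f k) :=
  FiniteDimensional.span_of_finite BK (Set.finite_range _)

theorem bfilt_finrank (f : MvPolynomial (Fin n) ℝ) (k : ℕ) :
    Module.finrank BK (bfilt f k) ≤ ((f.totalDegree + 1) * (k + 1)) ^ n := by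
  unfold bfilt
  refine (finrank_range_le_card (R := BK) _).trans ?_
  rw [Fintype.card_fun, Fintype.card_fin, Fintype.card_fin]
  apply Nat.pow_le_pow_left
  nlinarith

/-- The element `f^(s+j)`. -/
noncomputable def bu (f : MvPolynomial (Fin n) ℝ) (j : ℕ) : BW n :=
  BSeq.toBW (fun m => f ^ (m + j) : BSeq n)

theorem bu_mem (f : MvPolynomial (Fin n) ℝ) (j : ℕ) :
    bu f j ∈ bfilt f (j * f.totalDegree) := by
  have h : bu f j = bel f (f ^ (j + j * f.totalDegree)) (j * f.totalDegree) := by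
    apply toBW_eq_of_eventually _ _ (j * f.totalDegree)
    intro m hm
    rw [← pow_add]
    congr 1
    omega
  rw [h]
  apply bel_mem
  intro i
  refine (MvPolynomial.degreeOf_pow_le _ _ _).trans ?_
  have h2 := MvPolynomial.degreeOf_le_totalDegree f i
  calc _ ≤ (j + j * f.totalDegree) * f.totalDegree := Nat.mul_le_mul_left _ h2
    _ = _ := by ring

/-- The submodule generated by `f^(s+j)`. -/
noncomputable def bN (f : MvPolynomial (Fin n) ℝ) (j : ℕ) : Submodule BK (BW n) :=
  Submodule.span BK (Set.range fun ab : (Fin n → ℕ) × (Fin n → ℕ) =>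
    weylMon (fun i => bop n (mulX i)) (fun i => bop n (dX i)) ab.1 ab.2 (bu f j))

theorem bN_X (f : MvPolynomial (Fin n) ℝ) (j : ℕ) (l : Fin n) (w : BW n) (hw : w ∈ bN f j) :
    bop n (mulX l) w ∈ bN f j := by
  have : bN f j ≤ (bN f j).comap (bop n (mulX l)) := by
    conv_lhs => unfold bN
    rw [Submodule.span_le]
    rintro _ ⟨⟨α, β⟩, rfl⟩
    have h := X_mul_weylMon (isWeyl_bop n) α β l
    have h2 := LinearMap.congr_fun h (bu f j)
    rw [Module.End.mul_apply] at h2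
    change bop n (mulX l) _ ∈ bN f j
    rw [h2]
    exact Submodule.subset_span ⟨(_, _), rfl⟩
  exact this hw

theorem bN_D (f : MvPolynomial (Fin n) ℝ) (j : ℕ) (l : Fin n) (w : BW n) (hw : w ∈ bN f j) :
    bop n (dX l) w ∈ bN f j := by
  have : bN f j ≤ (bN f j).comap (bop n (dX l)) := by
    conv_lhs => unfold bN
    rw [Submodule.span_le]
    rintro _ ⟨⟨α, β⟩, rfl⟩
    have h := weylMon_comm_D (isWeyl_bop n) α β l
    rw [weylMon_mul_D (isWeyl_bop n), sub_eq_iff_eq_add] at h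
    have h2 := LinearMap.congr_fun h (bu f j)
    rw [Module.End.mul_apply] at h2
    change bop n (dX l) _ ∈ bN f j
    rw [h2]
    exact Submodule.add_mem _ (Submodule.smul_mem _ _ (Submodule.subset_span ⟨(_, _), rfl⟩))
      (Submodule.subset_span ⟨(_, _), rfl⟩)
  exact this hw

theorem bu_mem_bN (f : MvPolynomial (Fin n) ℝ) (j : ℕ) : bu f j ∈ bN f j := by
  apply Submodule.subset_span
  refine ⟨(0, 0), ?_⟩
  simp [weylMon, ypow]

theorem weylMon_mem_sub {K W : Type*} [Field K] [AddCommGroup W] [Module K W]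
    (X D : Fin n → Module.End K W) (N : Submodule K W)
    (hX : ∀ l w, w ∈ N → X l w ∈ N) (hD : ∀ l w, w ∈ N → D l w ∈ N) (α β : Fin n → ℕ)
    (w : W) (hw : w ∈ N) : weylMon X D α β w ∈ N := by
  have key : ∀ (Y : Fin n → Module.End K W), (∀ l w, w ∈ N → Y l w ∈ N) →
      ∀ (L : List (Fin n)) (γ : Fin n → ℕ) (w : W), w ∈ N → ypow Y L γ w ∈ N := by
    intro Y hY L γ
    induction L with
    | nil => intro w hw; simpa [ypow] using hw
    | cons i L ih =>
      intro w hw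
      rw [ypow_cons, Module.End.mul_apply]
      have : ∀ (k : ℕ) (w : W), w ∈ N → (Y i ^ k) w ∈ N := by
        intro k
        induction k with
        | zero => intro w hw; simpa using hw
        | succ k ihk => intro w hw; rw [pow_succ', Module.End.mul_apply]; exact hY _ _ (ihk w hw)
      exact this _ _ (ih w hw)
  rw [weylMon, Module.End.mul_apply]
  exact key X hX _ _ _ (key D hD _ _ _ hw)

theorem bN_mul (f p : MvPolynomial (Fin n) ℝ) (j : ℕ) (g : BSeq n) (hg : BSeq.toBW g ∈ bN f j) :
    BSeq.toBW (fun m => p * g m : BSeq n) ∈ bN f j := by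
  induction p using MvPolynomial.induction_on with
  | C a =>
    have : BSeq.toBW (fun m => MvPolynomial.C a * g m : BSeq n) =
        (Polynomial.C a) • BSeq.toBW g := by
      rw [← map_smul]
      refine congrArg _ ?_
      funext m
      refine Eq.trans ?_ (BSeq.smul_apply _ _ _).symm
      rw [Polynomial.eval_C]
      exact (MvPolynomial.smul_eq_C_mul _ _).symm
    rw [this]
    exact poly_smul_mem _ _ _ hg
  | add p q hp hq =>
    have : BSeq.toBW (fun m => (p + q) * g m : BSeq n) =
        BSeq.toBW (fun m => p * g m : BSeq n) + BSeq.toBW (fun m => q * g m : BSeq n) := by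
      refine Eq.trans ?_ (toBW_add' _ _)
      refine congrArg _ ?_
      funext m
      exact add_mul _ _ _
    rw [this]
    exact Submodule.add_mem _ hp hq
  | mul_X p i hp =>
    have := bN_X f j i _ hp
    have h2 : BSeq.toBW (fun m => p * MvPolynomial.X i * g m : BSeq n) =
        bop n (mulX i) (BSeq.toBW (fun m => p * g m : BSeq n)) := by
      refine Eq.trans ?_ (bop_toBW _ _).symm
      refine congrArg _ ?_
      funext m
      exact (mul_assoc _ _ _).trans (mul_left_comm _ _ _)
    exact h2 ▸ this

theorem bN_anti (f : MvPolynomial (Fin n) ℝ) (j : ℕ) : bN f (j + 1) ≤ bN f j := by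
  have h : bu f (j + 1) ∈ bN f j := by
    have := bN_mul f f j _ (bu_mem_bN f j)
    convert this using 2
    unfold bu
    refine congrArg _ ?_
    funext m
    exact pow_succ' _ _
  conv_lhs => unfold bN
  rw [Submodule.span_le]
  rintro _ ⟨⟨α, β⟩, rfl⟩
  exact weylMon_mem_sub _ _ _ (fun l w hw => bN_X f j l w hw) (fun l w hw => bN_D f j l w hw) _ _ _ h

theorem exists_bu_mem (f : MvPolynomial (Fin n) ℝ) : ∃ j, bu f j ∈ bN f (j + 1) :=
  finite_length (isWeyl_bop n) (bfilt f) (bfilt_mono f) (bfilt_X f) (bfilt_D f)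
    (f.totalDegree + 1) (bfilt_finrank f) (bN f) (bN_X f) (bN_D f) (bN_anti f)
    (bu f) (bu_mem_bN f) (fun j => j * f.totalDegree) (bu_mem f)

end BernsteinExistence

section BernsteinIdeal

variable {n : ℕ}

theorem exists_shifted (f : MvPolynomial (Fin n) ℝ) : ∃ (j : ℕ) (b : Polynomial ℝ), b ≠ 0 ∧
    ∃ (A : Finset ((Fin n → ℕ) × (Fin n → ℕ)))
    (c : ((Fin n → ℕ) × (Fin n → ℕ)) → Polynomial ℝ),
    ∀ m : ℕ,
      ∑ ab ∈ A,
        MvPolynomial.C (Polynomial.eval (m : ℝ) (c ab)) *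
          MvPolynomial.monomial (Finsupp.equivFunOnFinite.symm ab.1) (1 : ℝ) *
            iterPDeriv ab.2 (f ^ (m + (j + 1))) =
      MvPolynomial.C (Polynomial.eval (m : ℝ) b) * f ^ (m + j) := by
  obtain ⟨j, hj⟩ := exists_bu_mem f
  unfold bN at hj
  rw [Finsupp.mem_span_range_iff_exists_finsupp] at hj
  obtain ⟨c, hc⟩ := hj
  obtain ⟨b, hb⟩ := IsLocalization.exist_integer_multiples (nonZeroDivisors (Polynomial ℝ))
    c.support (fun i => c i)
  choose! a ha using hb
  let g : BSeq n := fun m => f ^ (m + j)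
  let h : ((Fin n → ℕ) × (Fin n → ℕ)) → BSeq n := fun ab => fun m =>
    MvPolynomial.monomial (Finsupp.equivFunOnFinite.symm ab.1) (1 : ℝ) *
            iterPDeriv ab.2 (f ^ (m + (j + 1)))
  have hh : ∀ ab, weylMon (fun i => bop n (mulX i)) (fun i => bop n (dX i)) ab.1 ab.2
      (bu f (j + 1)) = BSeq.toBW (h ab) := fun ab => weylMon_bop _ _ _
  have e1 : BSeq.toBW ((b : Polynomial ℝ) • g) = BSeq.toBW (∑ i ∈ c.support, a i • h i) := by
    rw [map_smul, map_sum]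
    change (b : Polynomial ℝ) • bu f j = _
    rw [← hc, Finsupp.sum, Finset.smul_sum]
    apply Finset.sum_congr rfl
    intro i hi
    rw [map_smul, hh, ← smul_assoc, ← algebraMap_smul BK (a i), ha i hi]
  unfold BSeq.toBW at e1
  rw [IsLocalizedModule.eq_iff_exists (nonZeroDivisors (Polynomial ℝ))] at e1
  obtain ⟨t, ht⟩ := e1
  refine ⟨j, t * b, ?_, c.support, fun i => t * a i, ?_⟩
  · exact mul_ne_zero (nonZeroDivisors.ne_zero t.2) (nonZeroDivisors.ne_zero b.2)
  · intro m
    have h2 := congrFun ht m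
    have h3 : (((t : Polynomial ℝ) • (b : Polynomial ℝ) • g) m : MvPolynomial (Fin n) ℝ) =
      Polynomial.eval (m : ℝ) (t : Polynomial ℝ) • (Polynomial.eval (m : ℝ) (b : Polynomial ℝ) • g m) := rfl
    have h4 : (((t : Polynomial ℝ) • ∑ i ∈ c.support, a i • h i) m : MvPolynomial (Fin n) ℝ) =
      Polynomial.eval (m : ℝ) (t : Polynomial ℝ) • ∑ i ∈ c.support, Polynomial.eval (m : ℝ) (a i) • h i m := by
      refine (BSeq.smul_apply _ _ _).trans (congrArg _ ?_)
      exact BSeq.sum_apply _ _ _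
    have h5 := (h3.symm.trans h2).trans h4
    rw [Finset.smul_sum] at h5
    rw [Polynomial.eval_mul, map_mul]
    refine Eq.trans ?_ (h5.symm.trans ?_)
    · apply Finset.sum_congr rfl
      intro i _
      rw [Polynomial.eval_mul, map_mul, MvPolynomial.smul_eq_C_mul, MvPolynomial.smul_eq_C_mul]
      simp only [mul_assoc]
      rfl
    · rw [MvPolynomial.smul_eq_C_mul, MvPolynomial.smul_eq_C_mul, mul_assoc]

theorem exists_bernstein (f : MvPolynomial (Fin n) ℝ) :
    ∃ b : Polynomial ℝ, b ≠ 0 ∧ SatisfiesBernstein f b := by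
  obtain ⟨j, b, hb, A, c, h⟩ := exists_shifted f
  let P : Polynomial ℝ := ∏ i ∈ Finset.range j, (Polynomial.X - Polynomial.C (i : ℝ))
  have hP : P ≠ 0 := by
    rw [Finset.prod_ne_zero_iff]
    exact fun i _ => Polynomial.X_sub_C_ne_zero _
  refine ⟨P * b.comp (Polynomial.X - Polynomial.C (j : ℝ)), mul_ne_zero hP ?_, A,
    fun i => P * (c i).comp (Polynomial.X - Polynomial.C (j : ℝ)), ?_⟩
  · intro h0
    rw [Polynomial.comp_eq_zero_iff] at h0
    rcases h0 with h0 | ⟨_, h1⟩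
    · exact hb h0
    · have := congrArg Polynomial.natDegree h1
      rw [Polynomial.natDegree_X_sub_C, Polynomial.natDegree_C] at this
      exact one_ne_zero this
  · intro m
    by_cases hm : j ≤ m
    · obtain ⟨m, rfl⟩ := Nat.exists_eq_add_of_le' hm
      have h1 := h m
      have hs : ((m + j : ℕ) : ℝ) - (j : ℝ) = m := by push_cast; ring
      simp only [Polynomial.eval_mul, Polynomial.eval_comp, Polynomial.eval_sub, Polynomial.eval_X,
        Polynomial.eval_C, hs, map_mul, mul_assoc, add_assoc]
      rw [← Finset.mul_sum, ← h1]
      simp only [mul_assoc]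
    · have : Polynomial.eval (m : ℝ) P = 0 := by
        rw [Polynomial.eval_prod]
        exact Finset.prod_eq_zero (Finset.mem_range.mpr (not_le.mp hm)) (by simp)
      simp [this]

/-- The ideal of all Bernstein polynomials. -/
def bernsteinIdeal (f : MvPolynomial (Fin n) ℝ) : Ideal (Polynomial ℝ) where
  carrier := {b | SatisfiesBernstein f b}
  zero_mem' := ⟨∅, fun _ => 0, by simp⟩
  smul_mem' := by
    rintro p b ⟨A, c, h⟩
    refine ⟨A, fun i => p * c i, fun m => ?_⟩
    simp only [smul_eq_mul, Polynomial.eval_mul, map_mul, mul_assoc]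
    rw [← Finset.mul_sum, ← h m]
    simp only [mul_assoc]
  add_mem' := by
    classical
    rintro b b' ⟨A, c, h⟩ ⟨A', c', h'⟩
    refine ⟨A ∪ A', fun i => (if i ∈ A then c i else 0) + (if i ∈ A' then c' i else 0), fun m => ?_⟩
    simp only [Polynomial.eval_add, map_add, add_mul, Finset.sum_add_distrib]
    rw [← h m, ← h' m]
    congr 1
    · rw [← Finset.sum_subset (Finset.subset_union_left (s₁ := A) (s₂ := A'))]
      · apply Finset.sum_congr rfl
        intro i hi
        rw [if_pos hi]
      · intro i _ hi
        rw [if_neg hi]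
        simp
    · rw [← Finset.sum_subset (Finset.subset_union_right (s₁ := A) (s₂ := A'))]
      · apply Finset.sum_congr rfl
        intro i hi
        rw [if_pos hi]
      · intro i _ hi
        rw [if_neg hi]
        simp

theorem exists_bernstein_gen (f : MvPolynomial (Fin n) ℝ) :
    ∃ b : Polynomial ℝ, b ≠ 0 ∧ SatisfiesBernstein f b ∧
      ∀ b', SatisfiesBernstein f b' → b ∣ b' := by
  obtain ⟨b0, hb0, hb⟩ := exists_bernstein f
  refine ⟨Submodule.IsPrincipal.generator (bernsteinIdeal f), ?_,
    Submodule.IsPrincipal.generator_mem (bernsteinIdeal f), ?_⟩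
  · intro h
    rw [← Submodule.IsPrincipal.eq_bot_iff_generator_eq_zero] at h
    have : b0 ∈ bernsteinIdeal f := hb
    rw [h] at this
    exact hb0 this
  · intro b' hb'
    exact (Submodule.IsPrincipal.mem_iff_generator_dvd (bernsteinIdeal f)).mp hb'

end BernsteinIdeal

section PsiPart

/-- Complex power of the positive part. -/
noncomputable def pp (s : ℂ) (y : ℝ) : ℂ := ((max y 0 : ℝ) : ℂ) ^ s

theorem pp_of_nonpos {s : ℂ} (hs : s ≠ 0) {y : ℝ} (hy : y ≤ 0) : pp s y = 0 := by
  rw [pp, max_eq_right hy, Complex.ofReal_zero, Complex.zero_cpow hs]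

theorem pp_of_pos (s : ℂ) {y : ℝ} (hy : 0 < y) : pp s y = (y : ℂ) ^ s := by
  rw [pp, max_eq_left hy.le]

theorem ne_zero_of_re_pos {s : ℂ} (hs : 0 < s.re) : s ≠ 0 := by
  rintro rfl; simp at hs

theorem pp_continuous {s : ℂ} (hs : 0 < s.re) : Continuous (pp s) :=
  (Complex.continuous_ofReal_cpow_const hs).comp (continuous_id.max continuous_const)

theorem pp_shift {s : ℂ} (hs : 0 < s.re) (y : ℝ) : (y : ℂ) * pp s y = pp (s + 1) y := by
  have h1 : 0 < (s + 1).re := by simp; linarith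
  rcases le_or_gt y 0 with hy | hy
  · rw [pp_of_nonpos (ne_zero_of_re_pos hs) hy, pp_of_nonpos (ne_zero_of_re_pos h1) hy, mul_zero]
  · rw [pp_of_pos _ hy, pp_of_pos _ hy, Complex.cpow_add _ _ (by exact_mod_cast hy.ne'),
      Complex.cpow_one, mul_comm]

theorem pp_hasDerivAt {s : ℂ} (hs : 1 < s.re) (y : ℝ) :
    HasDerivAt (pp s) (s * pp (s - 1) y) y := by
  have hs0 : 0 < s.re := by linarith
  have hs1 : 0 < (s - 1).re := by simp; linarith
  apply hasDerivAt_of_hasDerivAt_of_ne' (x := 0) (g := fun y => s * pp (s - 1) y)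
  · intro z hz
    rcases lt_or_gt_of_ne hz with hz | hz
    · rw [pp_of_nonpos (ne_zero_of_re_pos hs1) hz.le, mul_zero]
      refine (hasDerivAt_const z (0 : ℂ)).congr_of_eventuallyEq ?_
      filter_upwards [eventually_lt_nhds hz] with w hw
      exact pp_of_nonpos (ne_zero_of_re_pos hs0) hw.le
    · rw [pp_of_pos _ hz]
      refine (hasDerivAt_ofReal_cpow_const hz.ne' (ne_zero_of_re_pos hs0)).congr_of_eventuallyEq ?_
      filter_upwards [eventually_gt_nhds hz] with w hw
      exact pp_of_pos _ hw
  · exact (pp_continuous hs0).continuousAt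
  · exact (continuous_const.mul (pp_continuous hs1)).continuousAt

theorem pp_hasDerivAt_param {s : ℂ} (hs : 0 < s.re) (y : ℝ) :
    HasDerivAt (fun s => pp s y) (pp s y * Complex.log ((max y 0 : ℝ) : ℂ)) s := by
  have := (hasDerivAt_id s).const_cpow (c := ((max y 0 : ℝ) : ℂ)) (Or.inr (ne_zero_of_re_pos hs))
  simpa [pp] using this

theorem pp_norm_le {s : ℂ} (hs : 0 < s.re) {R : ℝ} (hR : s.re ≤ R) (y : ℝ) :
    ‖pp s y‖ ≤ (1 + |y|) ^ R := by
  rcases le_or_gt y 0 with hy | hy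
  · rw [pp_of_nonpos (ne_zero_of_re_pos hs) hy, norm_zero]
    positivity
  · rw [pp_of_pos _ hy, Complex.norm_cpow_eq_rpow_re_of_pos hy, abs_of_pos hy]
    calc y ^ s.re ≤ (1 + y) ^ s.re := Real.rpow_le_rpow hy.le (by linarith) hs.le
      _ ≤ (1 + y) ^ R := Real.rpow_le_rpow_of_exponent_le (by linarith) hR

/-- The general homogeneous distribution kernel on the line. -/
noncomputable def psi (a b s : ℂ) (y : ℝ) : ℂ := a * pp s y + b * pp s (-y)

theorem psi_zero {a b s : ℂ} (hs : 0 < s.re) : psi a b s 0 = 0 := by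
  simp [psi, pp_of_nonpos (ne_zero_of_re_pos hs) (le_refl (0 : ℝ))]

theorem psi_continuous {a b s : ℂ} (hs : 0 < s.re) : Continuous (psi a b s) :=
  (continuous_const.mul (pp_continuous hs)).add
    (continuous_const.mul ((pp_continuous hs).comp continuous_neg))

theorem psi_shift {a b s : ℂ} (hs : 0 < s.re) (y : ℝ) :
    (y : ℂ) * psi a b s y = psi a (-b) (s + 1) y := by
  have h1 := pp_shift hs y
  have h2 := pp_shift hs (-y)
  push_cast at h2
  rw [psi, psi, ← h1, ← h2]
  ring

theorem psi_shift_pow {a b s : ℂ} (hs : 0 < s.re) (y : ℝ) (k : ℕ) :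
    (y : ℂ) ^ k * psi a b s y = psi a ((-1) ^ k * b) (s + k) y := by
  induction k with
  | zero => simp
  | succ k ih =>
    rw [pow_succ', mul_assoc, ih, psi_shift (by simp; positivity)]
    congr 1
    · ring
    · push_cast; ring

theorem psi_hasDerivAt {a b s : ℂ} (hs : 1 < s.re) (y : ℝ) :
    HasDerivAt (psi a b s) (s * psi a (-b) (s - 1) y) y := by
  have h1 := (pp_hasDerivAt hs y).const_mul a
  have h2 := ((pp_hasDerivAt hs (-y)).scomp y (hasDerivAt_neg y)).const_mul b
  have h3 := h1.add h2
  refine h3.congr_deriv ?_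
  rw [psi]
  simp only [neg_smul, one_smul]
  ring

theorem psi_norm_le {a b s : ℂ} (hs : 0 < s.re) {R : ℝ} (hR : s.re ≤ R) (y : ℝ) :
    ‖psi a b s y‖ ≤ (‖a‖ + ‖b‖) * (1 + |y|) ^ R := by
  have h1 := pp_norm_le hs hR y
  have h2 := pp_norm_le hs hR (-y)
  rw [abs_neg] at h2
  calc ‖psi a b s y‖ ≤ ‖a * pp s y‖ + ‖b * pp s (-y)‖ := norm_add_le _ _
    _ = ‖a‖ * ‖pp s y‖ + ‖b‖ * ‖pp s (-y)‖ := by rw [norm_mul, norm_mul]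
    _ ≤ ‖a‖ * (1 + |y|) ^ R + ‖b‖ * (1 + |y|) ^ R := by gcongr
    _ = _ := by ring

/-- Derivative of `psi` in the exponent. -/
noncomputable def psiLog (a b s : ℂ) (y : ℝ) : ℂ :=
  a * (pp s y * Complex.log ((max y 0 : ℝ) : ℂ)) +
    b * (pp s (-y) * Complex.log ((max (-y) 0 : ℝ) : ℂ))

theorem psi_hasDerivAt_param {a b s : ℂ} (hs : 0 < s.re) (y : ℝ) :
    HasDerivAt (fun s => psi a b s y) (psiLog a b s y) s :=
  ((pp_hasDerivAt_param hs y).const_mul a).add ((pp_hasDerivAt_param hs (-y)).const_mul b)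

theorem psiLog_measurable {a b s : ℂ} (hs : 0 < s.re) : Measurable (psiLog a b s) := by
  unfold psiLog
  have h1 := (pp_continuous hs).measurable
  have h2 : Measurable fun y : ℝ => Complex.log ((max y 0 : ℝ) : ℂ) :=
    Complex.measurable_log.comp (Complex.measurable_ofReal.comp (measurable_id.max measurable_const))
  have h3 := h1.comp measurable_neg
  have h4 := h2.comp measurable_neg
  exact ((h1.mul h2).const_mul a).add ((h3.mul h4).const_mul b)

theorem psi_integral_differentiable {n : ℕ} (g : (Fin n → ℝ) → ℝ) (hg : Continuous g)
    (φ : (Fin n → ℝ) → ℂ) (hφ : Continuous φ) (hφc : HasCompactSupport φ) (a b : ℂ) :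
    DifferentiableOn ℂ (fun s => ∫ x, psi a b s (g x) * φ x) {s | 0 < s.re} := by
  intro s0 hs0
  have hs0' : 0 < s0.re := hs0
  apply DifferentiableAt.differentiableWithinAt
  set r : ℝ := s0.re / 4 with hr
  have hrpos : 0 < r := by positivity
  have hball : ∀ s ∈ Metric.ball s0 r, ∀ z ∈ Metric.closedBall s r, 0 < z.re ∧ z.re ≤ 2 * s0.re := by
    intro s hs z hz
    have h1 : |(s - s0).re| ≤ ‖s - s0‖ := Complex.abs_re_le_norm _
    have h2 : |(z - s).re| ≤ ‖z - s‖ := Complex.abs_re_le_norm _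
    rw [Metric.mem_ball, Complex.dist_eq] at hs
    rw [Metric.mem_closedBall, Complex.dist_eq] at hz
    rw [Complex.sub_re] at h1 h2
    have h3 := abs_le.mp h1
    have h4 := abs_le.mp h2
    constructor <;> linarith
  have hsub : ∀ s ∈ Metric.ball s0 r, 0 < s.re := fun s hs =>
    (hball s hs s (Metric.mem_closedBall_self hrpos.le)).1
  have hcont : ∀ s : ℂ, 0 < s.re → Continuous fun x => psi a b s (g x) * φ x := fun s hs =>
    ((psi_continuous hs).comp hg).mul hφ
  refine (hasDerivAt_integral_of_dominated_loc_of_deriv_le (μ := volume)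
    (F := fun s x => psi a b s (g x) * φ x) (F' := fun s x => psiLog a b s (g x) * φ x)
    (bound := fun x => ((‖a‖ + ‖b‖) * (1 + |g x|) ^ (2 * s0.re)) / r * ‖φ x‖)
    (Metric.ball_mem_nhds s0 hrpos) ?_ ?_ ?_ ?_ ?_ ?_).2.differentiableAt
  · filter_upwards [Metric.ball_mem_nhds s0 hrpos] with s hs
    exact (hcont s (hsub s hs)).aestronglyMeasurable
  · exact (hcont s0 hs0').integrable_of_hasCompactSupport hφc.mul_left
  · exact ((psiLog_measurable hs0').comp hg.measurable).aestronglyMeasurable.mul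
      hφ.aestronglyMeasurable
  · refine Eventually.of_forall fun x s hs => ?_
    rw [norm_mul]
    gcongr
    rw [← (psi_hasDerivAt_param (a := a) (b := b) (hsub s hs) (g x)).deriv]
    apply Complex.norm_deriv_le_of_forall_mem_sphere_norm_le hrpos
    · apply DifferentiableOn.diffContOnCl
      rw [closure_ball _ hrpos.ne']
      intro z hz
      exact (psi_hasDerivAt_param (hball s hs z hz).1 _).differentiableAt.differentiableWithinAt
    · intro z hz
      have := hball s hs z (Metric.sphere_subset_closedBall hz)
      exact psi_norm_le this.1 this.2 _
  · refine Continuous.integrable_of_hasCompactSupport ?_ ?_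
    · refine Continuous.mul (Continuous.div_const (continuous_const.mul ?_) _) hφ.norm
      refine (continuous_const.add hg.abs).rpow_const fun x => Or.inl ?_
      have := abs_nonneg (g x)
      change 1 + |g x| ≠ 0
      linarith
    · exact hφc.norm.mul_left
  · refine Eventually.of_forall fun x s hs => ?_
    exact (psi_hasDerivAt_param (hsub s hs) (g x)).mul_const _

end PsiPart

section PolyPart

variable {n : ℕ}

/-- Evaluate the space variables. -/
noncomputable def evx (x : Fin n → ℝ) : MvPolynomial (Fin n) (Polynomial ℝ) →+* Polynomial ℝ :=
  MvPolynomial.eval (fun i => Polynomial.C (x i))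

/-- Evaluate everything. -/
noncomputable def evs (s : ℂ) (x : Fin n → ℝ) : MvPolynomial (Fin n) (Polynomial ℝ) →+* ℂ :=
  ((Polynomial.aeval s : Polynomial ℝ →ₐ[ℝ] ℂ) : Polynomial ℝ →+* ℂ).comp (evx x)

/-- Embedding of constant-in-`s` polynomials. -/
noncomputable def ftil (f : MvPolynomial (Fin n) ℝ) : MvPolynomial (Fin n) (Polynomial ℝ) :=
  MvPolynomial.map Polynomial.C f

theorem evx_C (x : Fin n → ℝ) (c : Polynomial ℝ) : evx x (MvPolynomial.C c) = c := by simp [evx]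
theorem evx_X (x : Fin n → ℝ) (i : Fin n) : evx x (MvPolynomial.X i) = Polynomial.C (x i) := by
  simp [evx]
theorem evs_C (s : ℂ) (x : Fin n → ℝ) (c : Polynomial ℝ) :
    evs s x (MvPolynomial.C c) = Polynomial.aeval s c := by simp [evs, evx]
theorem evs_X (s : ℂ) (x : Fin n → ℝ) (i : Fin n) : evs s x (MvPolynomial.X i) = (x i : ℂ) := by
  simp [evs, evx]
theorem evs_eq (s : ℂ) (x : Fin n → ℝ) (p : MvPolynomial (Fin n) (Polynomial ℝ)) :
    evs s x p = Polynomial.aeval s (evx x p) := rfl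

theorem evx_ftil (x : Fin n → ℝ) (f : MvPolynomial (Fin n) ℝ) :
    evx x (ftil f) = Polynomial.C (MvPolynomial.eval x f) := by
  unfold evx ftil
  induction f using MvPolynomial.induction_on with
  | C a => simp
  | add p q hp hq => simp only [map_add, hp, hq]
  | mul_X p i hp => simp only [map_mul, hp]; simp

theorem evs_ftil (s : ℂ) (x : Fin n → ℝ) (f : MvPolynomial (Fin n) ℝ) :
    evs s x (ftil f) = (MvPolynomial.eval x f : ℂ) := by
  rw [evs_eq, evx_ftil, Polynomial.aeval_C]
  rfl

theorem evx_eval (x : Fin n → ℝ) (t : ℝ) (p : MvPolynomial (Fin n) (Polynomial ℝ)) :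
    Polynomial.eval t (evx x p) =
      MvPolynomial.eval x (MvPolynomial.map (Polynomial.evalRingHom t) p) := by
  induction p using MvPolynomial.induction_on with
  | C a => simp [evx_C]
  | add p q hp hq => simp only [map_add, Polynomial.eval_add, hp, hq]
  | mul_X p i hp => simp only [map_mul, Polynomial.eval_mul, hp, evx_X]; simp

theorem evs_deriv (s : ℂ) (p : MvPolynomial (Fin n) (Polynomial ℝ)) :
    Differentiable ℝ (fun x => evs s x p) ∧ ∀ x i,
      fderiv ℝ (fun x => evs s x p) x (Pi.single i 1) = evs s x (MvPolynomial.pderiv i p) := by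
  induction p using MvPolynomial.induction_on with
  | C a =>
    simp only [evs_C]
    exact ⟨differentiable_const _, fun x i => by simp⟩
  | add p q hp hq =>
    simp only [map_add]
    refine ⟨hp.1.add hq.1, fun x i => ?_⟩
    rw [fderiv_fun_add (hp.1 x) (hq.1 x), add_apply, hp.2, hq.2]
  | mul_X p j hp =>
    have hX : ∀ x : Fin n → ℝ, HasFDerivAt (fun x : Fin n → ℝ => ((x j : ℝ) : ℂ))
        (Complex.ofRealCLM.comp (ContinuousLinearMap.proj j)) x := fun x =>
      (Complex.ofRealCLM.comp (ContinuousLinearMap.proj (R := ℝ) (φ := fun _ : Fin n => ℝ) j)).hasFDerivAt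
    simp only [map_mul, evs_X]
    refine ⟨hp.1.mul (fun x => (hX x).differentiableAt), fun x i => ?_⟩
    rw [fderiv_fun_mul (hp.1 x) (hX x).differentiableAt, (hX x).fderiv]
    rw [MvPolynomial.pderiv_mul, map_add, map_mul, map_mul, evs_X, MvPolynomial.pderiv_X]
    simp only [add_apply, smul_apply, hp.2]
    by_cases hij : j = i
    · subst hij; simp; ring
    · simp [hij]
      ring

/-- The polynomials `f^(|L|-s) ∂_L f^s`. -/
noncomputable def pL (f : MvPolynomial (Fin n) ℝ) :
    List (Fin n) → MvPolynomial (Fin n) (Polynomial ℝ)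
  | [] => 1
  | i :: L => ftil f * MvPolynomial.pderiv i (pL f L) +
      MvPolynomial.C (Polynomial.X - Polynomial.C (L.length : ℝ)) *
        MvPolynomial.pderiv i (ftil f) * pL f L

theorem map_ftil (f : MvPolynomial (Fin n) ℝ) (t : ℝ) :
    MvPolynomial.map (Polynomial.evalRingHom t) (ftil f) = f := by
  rw [ftil, MvPolynomial.map_map]
  have : (Polynomial.evalRingHom t).comp Polynomial.C = RingHom.id ℝ := by
    ext; simp
  rw [this, MvPolynomial.map_id]

theorem ftil_pderiv (f : MvPolynomial (Fin n) ℝ) (i : Fin n) :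
    MvPolynomial.pderiv i (ftil f) = ftil (MvPolynomial.pderiv i f) :=
  MvPolynomial.pderiv_map

theorem foldr_pderiv_pow (f : MvPolynomial (Fin n) ℝ) (L : List (Fin n)) (j : ℕ) :
    L.foldr (fun i r => MvPolynomial.pderiv i r) (f ^ (j + L.length)) =
      f ^ j * MvPolynomial.map (Polynomial.evalRingHom ((j + L.length : ℕ) : ℝ)) (pL f L) := by
  induction L generalizing j with
  | nil => simp [pL]
  | cons i L ih =>
    have h1 : j + (i :: L).length = j + 1 + L.length := by simp; ring
    rw [List.foldr_cons, h1, ih (j + 1), pL, MvPolynomial.pderiv_mul, MvPolynomial.pderiv_pow,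
      MvPolynomial.pderiv_map, map_add, map_mul, map_mul, map_mul, ftil_pderiv, map_ftil, map_ftil,
      MvPolynomial.map_C]
    have h2 : Polynomial.evalRingHom ((j + 1 + L.length : ℕ) : ℝ)
        (Polynomial.X - Polynomial.C (L.length : ℝ)) = ((j + 1 : ℕ) : ℝ) := by
      simp
    rw [h2, map_natCast]
    simp only [Nat.add_sub_cancel]
    ring

theorem exists_list_iterPDeriv (β : Fin n → ℕ) : ∃ L : List (Fin n),
    ∀ q : MvPolynomial (Fin n) ℝ,
      iterPDeriv β q = L.foldr (fun i r => MvPolynomial.pderiv i r) q := by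
  unfold iterPDeriv
  generalize List.finRange n = M
  induction M with
  | nil => exact ⟨[], fun q => rfl⟩
  | cons i M ih =>
    obtain ⟨L, hL⟩ := ih
    refine ⟨List.replicate (β i) i ++ L, fun q => ?_⟩
    rw [List.foldr_cons, hL, List.foldr_append]
    generalize L.foldr (fun i r => MvPolynomial.pderiv i r) q = r
    induction β i with
    | zero => rfl
    | succ k ihk => rw [Function.iterate_succ_apply', ihk, List.replicate_succ, List.foldr_cons]

/-- The polynomial identity in `s` at a fixed point. -/
theorem bernstein_pointwise (f : MvPolynomial (Fin n) ℝ) (b : Polynomial ℝ)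
    (A : Finset ((Fin n → ℕ) × (Fin n → ℕ)))
    (c : ((Fin n → ℕ) × (Fin n → ℕ)) → Polynomial ℝ)
    (h : ∀ m : ℕ,
      ∑ ab ∈ A,
        MvPolynomial.C (Polynomial.eval (m : ℝ) (c ab)) *
          MvPolynomial.monomial (Finsupp.equivFunOnFinite.symm ab.1) (1 : ℝ) *
            iterPDeriv ab.2 (f ^ (m + 1)) =
      MvPolynomial.C (Polynomial.eval (m : ℝ) b) * f ^ m)
    (Λ : (Fin n → ℕ) → List (Fin n))
    (hΛ : ∀ β, ∀ q : MvPolynomial (Fin n) ℝ,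
      iterPDeriv β q = (Λ β).foldr (fun i r => MvPolynomial.pderiv i r) q)
    (N : ℕ) (hN : ∀ ab ∈ A, (Λ ab.2).length ≤ N + 1) (x : Fin n → ℝ)
    (hx : MvPolynomial.eval x f ≠ 0) (s : ℂ) :
    ∑ ab ∈ A, Polynomial.aeval s (c ab) *
      ((MvPolynomial.eval x (MvPolynomial.monomial (Finsupp.equivFunOnFinite.symm ab.1) (1 : ℝ)) : ℝ) : ℂ) *
      ((MvPolynomial.eval x f : ℝ) : ℂ) ^ (N + 1 - (Λ ab.2).length) * evs (s + 1) x (pL f (Λ ab.2)) =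
      Polynomial.aeval s b * ((MvPolynomial.eval x f : ℝ) : ℂ) ^ N := by
  set y := MvPolynomial.eval x f with hy
  have key : ∑ ab ∈ A, c ab *
      Polynomial.C (MvPolynomial.eval x (MvPolynomial.monomial (Finsupp.equivFunOnFinite.symm ab.1) (1 : ℝ))) *
      Polynomial.C y ^ (N + 1 - (Λ ab.2).length) *
        (evx x (pL f (Λ ab.2))).comp (Polynomial.X + 1) = b * Polynomial.C y ^ N := by
    apply Polynomial.eq_of_infinite_eval_eq
    have hinf : (Set.range fun j : ℕ => ((j + N : ℕ) : ℝ)).Infinite := by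
      apply Set.infinite_range_of_injective
      intro i j hij
      have : i + N = j + N := Nat.cast_injective (R := ℝ) hij
      omega
    refine hinf.mono ?_
    rintro _ ⟨j, rfl⟩
    have h1 := congrArg (MvPolynomial.eval x) (h (j + N))
    rw [map_sum, map_mul, map_pow, MvPolynomial.eval_C, ← hy] at h1
    have hyj : y ^ j ≠ 0 := pow_ne_zero _ hx
    apply mul_left_cancel₀ hyj
    simp only [Polynomial.eval_finsetSum, Polynomial.eval_mul, Polynomial.eval_pow,
      Polynomial.eval_C, Polynomial.eval_comp, Polynomial.eval_add, Polynomial.eval_X,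
      Polynomial.eval_one]
    rw [mul_left_comm, ← pow_add, ← h1, Finset.mul_sum]
    apply Finset.sum_congr rfl
    intro ab hab
    have hl := hN ab hab
    have h2 : j + N + 1 = (j + (N + 1 - (Λ ab.2).length)) + (Λ ab.2).length := by omega
    rw [hΛ, map_mul, map_mul, MvPolynomial.eval_C, h2, foldr_pderiv_pow, map_mul, ← evx_eval, ← h2,
      map_pow, ← hy, pow_add]
    push_cast
    ring
  have := congrArg (Polynomial.aeval s) key
  simp only [map_sum, map_mul, map_pow, Polynomial.aeval_C, Polynomial.aeval_comp, map_add,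
    Polynomial.aeval_X, map_one] at this
  exact this

end PolyPart

section IBP

variable {n : ℕ}

/-- Test functions. -/
def IsTest (φ : (Fin n → ℝ) → ℂ) : Prop := ContDiff ℝ (⊤ : ℕ∞) φ ∧ HasCompactSupport φ

/-- `∂_L` applied to `psi(f)`. -/
noncomputable def uL (f : MvPolynomial (Fin n) ℝ) (L : List (Fin n)) (a b s : ℂ)
    (x : Fin n → ℝ) : ℂ :=
  psi a ((-1) ^ L.length * b) (s - L.length) (MvPolynomial.eval x f) * evs s x (pL f L)

theorem eval_continuous (f : MvPolynomial (Fin n) ℝ) :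
    Continuous fun x : Fin n → ℝ => MvPolynomial.eval x f :=
  MvPolynomial.continuous_eval f

theorem eval_differentiable (f : MvPolynomial (Fin n) ℝ) :
    Differentiable ℝ fun x : Fin n → ℝ => MvPolynomial.eval x f := by
  have := (AnalyticOnNhd.eval_mvPolynomial f).differentiableOn
  rwa [differentiableOn_univ] at this

theorem eval_fderiv (f : MvPolynomial (Fin n) ℝ) (x : Fin n → ℝ) (i : Fin n) :
    fderiv ℝ (fun x : Fin n → ℝ => MvPolynomial.eval x f) x (Pi.single i 1) =
      MvPolynomial.eval x (MvPolynomial.pderiv i f) := by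
  have h1 := (evs_deriv 0 (ftil f)).2 x i
  simp only [ftil_pderiv, evs_ftil] at h1
  have h2 := Complex.ofRealCLM.hasFDerivAt.comp x (eval_differentiable f x).hasFDerivAt
  have h3 := h2.fderiv
  have h4 : (Complex.ofRealCLM ∘ fun x : Fin n → ℝ => MvPolynomial.eval x f) =
    fun x => ((MvPolynomial.eval x f : ℝ) : ℂ) := rfl
  rw [h4] at h3
  rw [h3] at h1
  simpa using h1

theorem uL_continuous (f : MvPolynomial (Fin n) ℝ) (L : List (Fin n)) (a b s : ℂ)
    (hs : (L.length : ℝ) < s.re) : Continuous (uL f L a b s) := by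
  refine Continuous.mul ((psi_continuous ?_).comp (eval_continuous f)) (evs_deriv s _).1.continuous
  simpa using hs

theorem uL_deriv (f : MvPolynomial (Fin n) ℝ) (L : List (Fin n)) (a b s : ℂ)
    (hs : (L.length : ℝ) + 1 < s.re) (x : Fin n → ℝ) :
    DifferentiableAt ℝ (uL f L a b s) x ∧ ∀ i,
      fderiv ℝ (uL f L a b s) x (Pi.single i 1) = uL f (i :: L) a b s x := by
  have hs1 : 1 < (s - L.length).re := by simp; linarith
  have hs2 : 0 < (s - L.length - 1).re := by simp; linarith
  have hp := psi_hasDerivAt (a := a) (b := (-1) ^ L.length * b) hs1 (MvPolynomial.eval x f)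
  have hf := (eval_differentiable f x).hasFDerivAt
  have h1 := HasFDerivAt.comp x (f := fun x : Fin n → ℝ => MvPolynomial.eval x f) hp.hasFDerivAt hf
  have h2 := ((evs_deriv s (pL f L)).1 x).hasFDerivAt
  have h3 : HasFDerivAt (uL f L a b s) _ x := h1.mul h2
  refine ⟨h3.differentiableAt, fun i => ?_⟩
  rw [h3.fderiv]
  have h5 := psi_shift (a := a) (b := -((-1) ^ L.length * b)) hs2 (MvPolynomial.eval x f)
  rw [sub_add_cancel, neg_neg] at h5
  have h6 : (-1) ^ (i :: L).length * b = -((-1) ^ L.length * b) := by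
    rw [List.length_cons, pow_succ]; ring
  have h7 : s - ((i :: L).length : ℂ) = s - L.length - 1 := by
    rw [List.length_cons]; push_cast; ring
  rw [uL, h6, h7, pL, map_add, map_mul, map_mul, map_mul, evs_C, evs_ftil, ftil_pderiv, evs_ftil]
  simp only [add_apply, smul_apply, (evs_deriv s (pL f L)).2, ContinuousLinearMap.comp_apply,
    ContinuousLinearMap.toSpanSingleton_apply, eval_fderiv, Function.comp_apply, smul_eq_mul,
    Complex.real_smul, map_sub, Polynomial.aeval_X, map_natCast]
  rw [← h5]
  ring

theorem IsTest.pderiv {φ : (Fin n → ℝ) → ℂ} (h : IsTest φ) (i : Fin n) :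
    IsTest (fun x => -fderiv ℝ φ x (Pi.single i 1)) := by
  constructor
  · have h1 : ContDiff ℝ (⊤ : ℕ∞) (fderiv ℝ φ) := h.1.fderiv_right (by simp)
    exact (h1.clm_apply contDiff_const).neg
  · exact (h.2.fderiv_apply ℝ _).neg

theorem uL_ibp (f : MvPolynomial (Fin n) ℝ) (i : Fin n) (L : List (Fin n)) (a b s : ℂ)
    (hs : (L.length : ℝ) + 1 < s.re) (φ : (Fin n → ℝ) → ℂ) (hφ : IsTest φ) :
    ∫ x, uL f (i :: L) a b s x * φ x = ∫ x, uL f L a b s x * (-fderiv ℝ φ x (Pi.single i 1)) := by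
  have hc1 := uL_continuous f L a b s (by linarith)
  have hc2 := uL_continuous f (i :: L) a b s (by simpa using hs)
  have hd : ∀ x, fderiv ℝ (uL f L a b s) x (Pi.single i 1) = uL f (i :: L) a b s x := fun x =>
    (uL_deriv f L a b s hs x).2 i
  have hpd : Continuous fun x => fderiv ℝ φ x (Pi.single i 1) := by
    have h1 : ContDiff ℝ (⊤ : ℕ∞) (fderiv ℝ φ) := hφ.1.fderiv_right (by simp)
    exact (h1.clm_apply contDiff_const).continuous
  have := integral_mul_fderiv_eq_neg_fderiv_mul_of_integrable (μ := (volume : Measure (Fin n → ℝ)))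
    (f := uL f L a b s) (g := φ) (v := Pi.single i 1) ?_ ?_ ?_ ?_ ?_
  · simp only [mul_neg, integral_neg]
    rw [this, neg_neg]
    simp only [hd]
  · simp only [hd]
    exact (hc2.mul hφ.1.continuous).integrable_of_hasCompactSupport hφ.2.mul_left
  · exact (hc1.mul hpd).integrable_of_hasCompactSupport (hφ.2.fderiv_apply ℝ _).mul_left
  · exact (hc1.mul hφ.1.continuous).integrable_of_hasCompactSupport hφ.2.mul_left
  · exact fun x _ => (uL_deriv f L a b s hs x).1
  · exact fun x _ => (hφ.1.differentiable (by simp)) x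

/-- Generalized zeta function. -/
noncomputable def Zab (f : MvPolynomial (Fin n) ℝ) (a b : ℂ) (φ : (Fin n → ℝ) → ℂ) (s : ℂ) : ℂ :=
  ∫ x, psi a b s (MvPolynomial.eval x f) * φ x

theorem uL_transfer (f : MvPolynomial (Fin n) ℝ) (L : List (Fin n)) :
    ∀ φ : (Fin n → ℝ) → ℂ, IsTest φ → ∃ θ : (Fin n → ℝ) → ℂ, IsTest θ ∧
      ∀ a b s : ℂ, (L.length : ℝ) < s.re → ∫ x, uL f L a b s x * φ x = Zab f a b θ s := by
  induction L with
  | nil =>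
    intro φ hφ
    refine ⟨φ, hφ, fun a b s hs => ?_⟩
    simp [uL, Zab, pL]
  | cons i L ih =>
    intro φ hφ
    obtain ⟨θ, hθ, h⟩ := ih _ (hφ.pderiv i)
    refine ⟨θ, hθ, fun a b s hs => ?_⟩
    have hs' : (L.length : ℝ) + 1 < s.re := by simpa using hs
    rw [uL_ibp f i L a b s hs' φ hφ, h a b s (by linarith)]

theorem Zab_differentiable (f : MvPolynomial (Fin n) ℝ) (a b : ℂ) (φ : (Fin n → ℝ) → ℂ)
    (hφ : IsTest φ) : DifferentiableOn ℂ (Zab f a b φ) {s | 0 < s.re} :=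
  psi_integral_differentiable _ (eval_continuous f) φ hφ.1.continuous hφ.2 a b

theorem isOpen_half (t : ℝ) : IsOpen {s : ℂ | t < s.re} := isOpen_lt continuous_const Complex.continuous_re

theorem preconnected_half (t : ℝ) : IsPreconnected {s : ℂ | t < s.re} :=
  (convex_halfSpace_re_gt t).isPreconnected

theorem half_eqOn {F G : ℂ → ℂ} {t u : ℝ} (hF : DifferentiableOn ℂ F {s | t < s.re})
    (hG : DifferentiableOn ℂ G {s | t < s.re}) (h : ∀ s : ℂ, u < s.re → F s = G s) :
    ∀ s : ℂ, t < s.re → F s = G s := by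
  have h0 : (((max t u) + 1 : ℝ) : ℂ) ∈ {s : ℂ | t < s.re} := by
    have := le_max_left t u
    simp; linarith [le_max_left t u]
  have h1 := (hF.analyticOnNhd (isOpen_half t)).eqOn_of_preconnected_of_eventuallyEq
    (hG.analyticOnNhd (isOpen_half t)) (preconnected_half t) h0 (by
      filter_upwards [(isOpen_half u).mem_nhds (show (((max t u) + 1 : ℝ) : ℂ) ∈ {s : ℂ | u < s.re} by
        have := le_max_right t u
        simp; linarith [le_max_right t u])] with s hs
      exact h s hs)
  exact fun s hs => h1 hs

theorem poly_aeval_differentiable (p : Polynomial ℝ) : Differentiable ℂ fun s : ℂ => Polynomial.aeval s p := by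
  exact Polynomial.differentiable_aeval p

theorem functional_eq (f : MvPolynomial (Fin n) ℝ) (bf : Polynomial ℝ)
    (hb : SatisfiesBernstein f bf) :
    ∃ (A : Finset ((Fin n → ℕ) × (Fin n → ℕ)))
    (c : ((Fin n → ℕ) × (Fin n → ℕ)) → Polynomial ℝ), ∀ φ : (Fin n → ℝ) → ℂ, IsTest φ →
    ∃ θ : ((Fin n → ℕ) × (Fin n → ℕ)) → (Fin n → ℝ) → ℂ, (∀ ab, IsTest (θ ab)) ∧
      ∀ a b s : ℂ, 0 < s.re → Polynomial.aeval s bf * Zab f a b φ s =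
        ∑ ab ∈ A, Polynomial.aeval s (c ab) * Zab f a (-b) (θ ab) (s + 1) := by
  obtain ⟨A, c, h⟩ := hb
  choose Λ hΛ using exists_list_iterPDeriv (n := n)
  refine ⟨A, c, fun φ hφ => ?_⟩
  set mon : ((Fin n → ℕ) × (Fin n → ℕ)) → MvPolynomial (Fin n) ℝ := fun ab =>
    MvPolynomial.monomial (Finsupp.equivFunOnFinite.symm ab.1) (1 : ℝ) with hmon
  have hmt : ∀ ab, IsTest fun x => ((MvPolynomial.eval x (mon ab) : ℝ) : ℂ) * φ x := by
    intro ab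
    refine ⟨ContDiff.mul ?_ hφ.1, hφ.2.mul_left⟩
    have h1 : ContDiff ℝ (⊤ : ℕ∞) fun x : Fin n → ℝ => MvPolynomial.eval x (mon ab) := by
      have := (AnalyticOnNhd.eval_mvPolynomial (mon ab)).contDiffOn (n := (⊤ : ℕ∞)) uniqueDiffOn_univ
      rwa [contDiffOn_univ] at this
    exact Complex.ofRealCLM.contDiff.comp h1
  choose θ hθ hθe using fun ab => uL_transfer f (Λ ab.2) _ (hmt ab)
  refine ⟨θ, hθ, fun a b => ?_⟩
  set N : ℕ := ∑ ab ∈ A, (Λ ab.2).length with hNdef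
  have hN : ∀ ab ∈ A, (Λ ab.2).length ≤ N := fun ab hab =>
    Finset.single_le_sum (f := fun ab => (Λ ab.2).length) (fun _ _ => Nat.zero_le _) hab
  apply half_eqOn (u := (N : ℝ) + 1)
  · exact (poly_aeval_differentiable bf).differentiableOn.mul (Zab_differentiable f a b φ hφ)
  · apply DifferentiableOn.fun_sum
    intro ab _
    refine (poly_aeval_differentiable _).differentiableOn.mul ?_
    refine (Zab_differentiable f a (-b) (θ ab) (hθ ab)).comp
      (differentiable_id.add_const (1 : ℂ)).differentiableOn ?_
    intro s hs
    have : 0 < s.re := hs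
    simp
    linarith
  · intro s hs
    have hpt : ∀ x, Polynomial.aeval s bf * (psi a b s (MvPolynomial.eval x f) * φ x) =
        ∑ ab ∈ A, Polynomial.aeval s (c ab) * (uL f (Λ ab.2) a (-b) (s + 1) x *
          (((MvPolynomial.eval x (mon ab) : ℝ) : ℂ) * φ x)) := by
      intro x
      have hre : ∀ ab ∈ A, 0 < (s + 1 - (Λ ab.2).length).re := by
        intro ab hab
        have : ((Λ ab.2).length : ℝ) ≤ N := by exact_mod_cast hN ab hab
        simp; linarith
      have hs0 : 0 < s.re := by
        have : (0 : ℝ) ≤ N := Nat.cast_nonneg _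
        linarith
      have hsN : 0 < (s - N).re := by simp; linarith
      by_cases hx : MvPolynomial.eval x f = 0
      · rw [hx, psi_zero hs0, zero_mul, mul_zero]
        symm
        apply Finset.sum_eq_zero
        intro ab hab
        rw [uL, hx, psi_zero (hre ab hab)]
        simp
      · have key := bernstein_pointwise f bf A c h Λ hΛ N (fun ab hab => (hN ab hab).trans (Nat.le_succ _))
          x hx s
        set y := MvPolynomial.eval x f
        have e1 : psi a b s y = (y : ℂ) ^ N * psi a ((-1) ^ N * b) (s - N) y := by
          rw [psi_shift_pow hsN, sub_add_cancel, ← mul_assoc, ← mul_pow]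
          simp
        rw [e1, ← mul_assoc, ← mul_assoc, ← key, Finset.sum_mul, Finset.sum_mul]
        apply Finset.sum_congr rfl
        intro ab hab
        have hle := hN ab hab
        have e2 : psi a ((-1) ^ (Λ ab.2).length * (-b)) (s + 1 - (Λ ab.2).length) y =
            (y : ℂ) ^ (N + 1 - (Λ ab.2).length) * psi a ((-1) ^ N * b) (s - N) y := by
          rw [psi_shift_pow hsN]
          congr 1
          · obtain ⟨k, hk⟩ := Nat.exists_eq_add_of_le hle
            have h1 : N + 1 - (Λ ab.2).length = k + 1 := by omega
            rw [h1, hk, pow_succ, pow_add]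
            have h2 : ((-1 : ℂ) ^ k) * (-1) ^ k = 1 := by rw [← mul_pow]; simp
            linear_combination ((-1 : ℂ) ^ (Λ ab.2).length * b) * h2
          · have h1 : (N + 1 - (Λ ab.2).length : ℕ) = ((N : ℂ) + 1 - (Λ ab.2).length) := by
              rw [Nat.cast_sub (by omega)]; push_cast; rfl
            rw [h1]; ring
        rw [uL, e2]
        ring
    have hInt1 : ∀ ab ∈ A, Integrable fun x => Polynomial.aeval s (c ab) * (uL f (Λ ab.2) a (-b) (s + 1) x *
          (((MvPolynomial.eval x (mon ab) : ℝ) : ℂ) * φ x)) := by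
      intro ab hab
      have : ((Λ ab.2).length : ℝ) ≤ N := by exact_mod_cast hN ab hab
      apply Integrable.const_mul
      exact ((uL_continuous f (Λ ab.2) a (-b) (s + 1) (by simp; linarith)).mul
        (hmt ab).1.continuous).integrable_of_hasCompactSupport (hmt ab).2.mul_left
    rw [Zab, ← integral_const_mul]
    simp only [hpt]
    rw [integral_finsetSum A hInt1]
    apply Finset.sum_congr rfl
    intro ab hab
    have : ((Λ ab.2).length : ℝ) ≤ N := by exact_mod_cast hN ab hab
    rw [integral_const_mul, hθe ab a (-b) (s + 1) (by simp; linarith)]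

end IBP

section Continuation

variable {n : ℕ}

/-- Product of shifted Bernstein polynomials. -/
noncomputable def Bk (bf : Polynomial ℝ) (k : ℕ) (s : ℂ) : ℂ :=
  ∏ i ∈ Finset.range k, Polynomial.aeval (s + (i : ℂ)) bf

theorem Bk_succ (bf : Polynomial ℝ) (k : ℕ) (s : ℂ) :
    Bk bf (k + 1) s = Polynomial.aeval s bf * Bk bf k (s + 1) := by
  unfold Bk
  rw [Finset.prod_range_succ', mul_comm]
  congr 1
  · simp
  · apply Finset.prod_congr rfl
    intro i _
    congr 1
    push_cast
    ring

theorem Bk_differentiable (bf : Polynomial ℝ) (k : ℕ) : Differentiable ℂ (Bk bf k) := by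
  unfold Bk
  apply Differentiable.fun_finsetProd
  intro i _
  exact (poly_aeval_differentiable bf).comp (differentiable_id.add_const _)

theorem exists_H (f : MvPolynomial (Fin n) ℝ) (bf : Polynomial ℝ)
    (hb : SatisfiesBernstein f bf) (k : ℕ) : ∀ (a b : ℂ) (φ : (Fin n → ℝ) → ℂ), IsTest φ →
    ∃ H : ℂ → ℂ, DifferentiableOn ℂ H {s | -(k : ℝ) < s.re} ∧
      ∀ s : ℂ, 0 < s.re → H s = Bk bf k s * Zab f a b φ s := by
  obtain ⟨A, c, h⟩ := functional_eq f bf hb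
  induction k with
  | zero =>
    intro a b φ hφ
    refine ⟨Zab f a b φ, ?_, fun s hs => by simp [Bk]⟩
    simpa using Zab_differentiable f a b φ hφ
  | succ k ih =>
    intro a b φ hφ
    obtain ⟨θ, hθ, hfe⟩ := h φ hφ
    choose H hH1 hH2 using fun ab => ih a (-b) (θ ab) (hθ ab)
    refine ⟨fun s => ∑ ab ∈ A, Polynomial.aeval s (c ab) * H ab (s + 1), ?_, ?_⟩
    · apply DifferentiableOn.fun_sum
      intro ab _
      refine (poly_aeval_differentiable _).differentiableOn.mul ?_
      refine (hH1 ab).comp (differentiable_id.add_const (1 : ℂ)).differentiableOn ?_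
      intro s hs
      have : -((k + 1 : ℕ) : ℝ) < s.re := hs
      push_cast at this
      simp
      linarith
    · intro s hs
      have hs1 : 0 < (s + 1).re := by simp; linarith
      have := hfe a b s hs
      rw [Bk_succ, mul_right_comm, this, Finset.sum_mul]
      apply Finset.sum_congr rfl
      intro ab _
      rw [hH2 ab _ hs1]
      ring

theorem realZeta_eq (f : MvPolynomial (Fin n) ℝ) (φ : (Fin n → ℝ) → ℂ) (s : ℂ) (hs : 0 < s.re) :
    realZeta f φ s = Zab f 1 1 φ s := by
  unfold realZeta Zab
  congr 1
  funext x
  unfold realZetaIntegrand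
  congr 1
  set y := MvPolynomial.eval x f
  have hs0 := ne_zero_of_re_pos hs
  have key : ∀ t : ℝ, 0 < t → Complex.exp (s * (Real.log t : ℂ)) = (t : ℂ) ^ s := by
    intro t ht
    rw [Complex.cpow_def_of_ne_zero (by exact_mod_cast ht.ne'), Complex.ofReal_log ht.le, mul_comm]
  split_ifs with hy
  · rw [hy, psi_zero hs]
  · rcases lt_or_gt_of_ne hy with hy | hy
    · rw [psi, pp_of_nonpos hs0 hy.le, pp_of_pos _ (by linarith : 0 < -y), abs_of_neg hy,
        key _ (by linarith)]
      simp
    · rw [psi, pp_of_nonpos hs0 (by linarith : -y ≤ 0), pp_of_pos _ hy, abs_of_pos hy, key _ hy]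
      simp

theorem Bk_eventually_ne (bf : Polynomial ℝ) (hbf : bf ≠ 0) (k : ℕ) (s₀ : ℂ) :
    ∀ᶠ s in nhdsWithin s₀ {s₀}ᶜ, Bk bf k s ≠ 0 := by
  have h1 : ∀ i ∈ Finset.range k, ∀ᶠ s in nhdsWithin s₀ {s₀}ᶜ,
      Polynomial.aeval (s + (i : ℂ)) bf ≠ 0 := by
    intro i _
    have hm : bf.map (algebraMap ℝ ℂ) ≠ 0 :=
      (Polynomial.map_ne_zero_iff (algebraMap ℝ ℂ).injective).mpr hbf
    have hfin := Polynomial.finite_setOfPred_isRoot hm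
    have hfin2 : {s : ℂ | Polynomial.aeval (s + (i : ℂ)) bf = 0}.Finite := by
      have h2 := hfin.preimage (f := fun s : ℂ => s + (i : ℂ)) (add_left_injective (i : ℂ)).injOn
      refine h2.subset ?_
      intro s hs
      change Polynomial.IsRoot _ _
      rw [Polynomial.IsRoot.def, Polynomial.eval_map_algebraMap]
      exact hs
    have hcl := (hfin2.diff (t := {s₀})).isClosed.isOpen_compl.mem_nhds
      (show s₀ ∈ _ from fun h => h.2 rfl)
    filter_upwards [mem_nhdsWithin_of_mem_nhds hcl, self_mem_nhdsWithin] with s hs1 hs2 h0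
    exact hs1 ⟨h0, hs2⟩
  filter_upwards [(Finset.eventually_all _).mpr h1] with s hs
  unfold Bk
  rw [Finset.prod_ne_zero_iff]
  exact hs

theorem Bk_ne_of_le (bf : Polynomial ℝ) {j k : ℕ} (h : j ≤ k) {s : ℂ} (hs : Bk bf k s ≠ 0) :
    Bk bf j s ≠ 0 := by
  unfold Bk at *
  rw [Finset.prod_ne_zero_iff] at *
  exact fun i hi => hs i (Finset.range_mono h hi)

end Continuation

theorem stmt4 {n : ℕ} (f : MvPolynomial (Fin n) ℝ) (hf : 0 < f.totalDegree)
    (φ : (Fin n → ℝ) → ℂ) (hφ : ContDiff ℝ (⊤ : ℕ∞) φ) (hφc : HasCompactSupport φ) :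
    ∃ G : ℂ → ℂ, MeromorphicOn G Set.univ ∧
      (∀ s : ℂ, 0 < s.re → G s = realZeta f φ s) ∧
      (∀ s₀ : ℂ, IsPole G s₀ → ∃ k : ℕ,
        ∀ b : Polynomial ℝ, SatisfiesBernstein f b →
          Polynomial.aeval (s₀ + (k : ℂ)) b = 0) := by
  obtain ⟨bf, hbf0, hbf, hgen⟩ := exists_bernstein_gen f
  choose H hH1 hH2 using fun k => exists_H f bf hbf k 1 1 φ ⟨hφ, hφc⟩
  have hcons : ∀ j k : ℕ, ∀ s : ℂ, -((min j k : ℕ) : ℝ) < s.re →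
      H j s * Bk bf k s = H k s * Bk bf j s := by
    intro j k
    apply half_eqOn (u := 0)
    · refine ((hH1 j).mono ?_).mul (Bk_differentiable bf k).differentiableOn
      intro s hs
      have h1 : -((min j k : ℕ) : ℝ) < s.re := hs
      have h2 : ((min j k : ℕ) : ℝ) ≤ j := by exact_mod_cast min_le_left j k
      change -(j : ℝ) < s.re
      linarith
    · refine ((hH1 k).mono ?_).mul (Bk_differentiable bf j).differentiableOn
      intro s hs
      have h1 : -((min j k : ℕ) : ℝ) < s.re := hs
      have h2 : ((min j k : ℕ) : ℝ) ≤ k := by exact_mod_cast min_le_right j k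
      change -(k : ℝ) < s.re
      linarith
    · intro s hs
      rw [hH2 j s hs, hH2 k s hs]
      ring
  let G : ℂ → ℂ := fun s => if 0 < s.re then realZeta f φ s else
    H ⌈1 - s.re⌉₊ s / Bk bf ⌈1 - s.re⌉₊ s
  have hloc : ∀ s₀ : ℂ, ∃ K : ℕ, -(K : ℝ) < s₀.re ∧
      ∀ᶠ s in nhdsWithin s₀ {s₀}ᶜ, H K s / Bk bf K s = G s := by
    intro s₀
    have hK := Nat.le_ceil (2 - s₀.re)
    refine ⟨⌈2 - s₀.re⌉₊, by linarith, ?_⟩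
    filter_upwards [Bk_eventually_ne bf hbf0 ⌈2 - s₀.re⌉₊ s₀, mem_nhdsWithin_of_mem_nhds
      ((isOpen_half (s₀.re - 1)).mem_nhds (show s₀ ∈ _ by simp))] with s hs1 hs2
    have hs2' : s₀.re - 1 < s.re := hs2
    by_cases hs : 0 < s.re
    · simp only [G, if_pos hs]
      rw [hH2 _ s hs, realZeta_eq f φ s hs, mul_div_cancel_left₀ _ hs1]
    · simp only [G, if_neg hs]
      have hle : ⌈1 - s.re⌉₊ ≤ ⌈2 - s₀.re⌉₊ := Nat.ceil_mono (by linarith)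
      rw [div_eq_div_iff hs1 (Bk_ne_of_le bf hle hs1)]
      apply hcons
      rw [min_eq_right hle]
      have := Nat.le_ceil (1 - s.re)
      linarith
  have hdiff : ∀ (K : ℕ) (s₀ : ℂ), -(K : ℝ) < s₀.re → AnalyticAt ℂ (H K) s₀ := fun K s₀ h =>
    (hH1 K).analyticAt ((isOpen_half _).mem_nhds h)
  have hdiffB : ∀ (K : ℕ) (s₀ : ℂ), AnalyticAt ℂ (Bk bf K) s₀ := fun K s₀ =>
    (Bk_differentiable bf K).analyticAt s₀
  refine ⟨G, ?_, ?_, ?_⟩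
  · intro s₀ _
    obtain ⟨K, hK, he⟩ := hloc s₀
    exact ((hdiff K s₀ hK).meromorphicAt.div (hdiffB K s₀).meromorphicAt).congr he
  · intro s hs
    simp only [G, if_pos hs]
  · intro s₀ hpole
    obtain ⟨K, hK, he⟩ := hloc s₀
    by_contra hcon
    push Not at hcon
    have hB : Bk bf K s₀ ≠ 0 := by
      unfold Bk
      rw [Finset.prod_ne_zero_iff]
      intro i _ h0
      obtain ⟨b, hb, hb2⟩ := hcon i
      obtain ⟨q, rfl⟩ := hgen b hb
      apply hb2
      rw [map_mul, h0, zero_mul]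
    have hc : ContinuousAt (fun s => H K s / Bk bf K s) s₀ :=
      (hdiff K s₀ hK).continuousAt.div (hdiffB K s₀).continuousAt hB
    have ht : Tendsto (fun s => ‖G s‖) (nhdsWithin s₀ {s₀}ᶜ) (nhds ‖H K s₀ / Bk bf K s₀‖) := by
      refine Tendsto.congr' ?_ ((hc.norm.tendsto).mono_left nhdsWithin_le_nhds)
      filter_upwards [he] with s hs
      rw [hs]
    exact not_tendsto_nhds_of_tendsto_atTop hpole _ ht
end

section
/- Let p be a prime and f ∈ ℤ[x₁,…,xₙ] a nonconstant polynomial. For each i ∈ ℤ_{≥1} let Nᵢ denote the number of a ∈ (ℤ/pⁱℤ)ⁿ with f(a) = 0 in ℤ/pⁱℤ. Then for every s ∈ ℂ with Re(s) > 0 the series P := 1 + ∑_{i≥1} Nᵢ p^{-ni} (p^{-s})ⁱ converges absolutely and, viewing f as a polynomial over ℚ_p, Z(f;s) = ((p^{-s} - 1)·P + 1) / p^{-s}. -/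
open MeasureTheory MvPolynomial

open scoped Classical in
/-- `|q|_p^s := p^{-s · ord_p q}`, interpreted as `0` when `q = 0`. -/
noncomputable def padicPow (p : ℕ) [Fact p.Prime] (s : ℂ) (q : ℚ_[p]) : ℂ :=
  if q = 0 then 0 else (p : ℂ) ^ (-s * (q.valuation : ℂ))

/-- The unit polydisc `ℤ_pⁿ ⊆ ℚ_pⁿ`. -/
def unitPolydisc (p : ℕ) [Fact p.Prime] (n : ℕ) : Set (Fin n → ℚ_[p]) :=
  {x | ∀ i, ‖x i‖ ≤ 1}

/-- The p-adic Igusa zeta function `Z(f;s) = ∫_{ℤ_pⁿ} |f(x)|_p^s dx`. -/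
noncomputable def padicZeta (p : ℕ) [Fact p.Prime] {n : ℕ} [MeasurableSpace ℚ_[p]]
    (μ : Measure (Fin n → ℚ_[p])) (f : MvPolynomial (Fin n) ℚ_[p]) (s : ℂ) : ℂ :=
  ∫ x in unitPolydisc p n, padicPow p s (eval x f) ∂μ

/-- The number `Nᵢ` of solutions of `f = 0` over `ℤ/pⁱℤ`. -/
noncomputable def zeroCount (p : ℕ) {n : ℕ} (f : MvPolynomial (Fin n) ℤ) (i : ℕ) : ℕ :=
  Nat.card {a : Fin n → ZMod (p ^ i) //
    eval a (MvPolynomial.map (Int.castRingHom (ZMod (p ^ i))) f) = 0}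

/-- The residue ball of radius `p^{-i}` around a class `a`. -/
def resBall (p : ℕ) [Fact p.Prime] {n : ℕ} (i : ℕ) (a : Fin n → ZMod (p ^ i)) :
    Set (Fin n → ℚ_[p]) :=
  {x | ∀ j, ‖x j - ((a j).val : ℚ_[p])‖ ≤ (p : ℝ) ^ (-(i : ℤ))}

theorem norm_le_iff_toZModPow (p : ℕ) [Fact p.Prime] (i : ℕ) (y : ℤ_[p]) :
    ‖y‖ ≤ (p : ℝ) ^ (-(i : ℤ)) ↔ PadicInt.toZModPow i y = 0 := by
  rw [PadicInt.norm_le_pow_iff_mem_span_pow, ← PadicInt.ker_toZModPow, RingHom.mem_ker]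

theorem mem_resBall_iff (p : ℕ) [Fact p.Prime] {n : ℕ} (i : ℕ) (a : Fin n → ZMod (p ^ i))
    (y : Fin n → ℤ_[p]) :
    (fun j => (y j : ℚ_[p])) ∈ resBall p i a ↔ (fun j => PadicInt.toZModPow i (y j)) = a := by
  have : NeZero (p ^ i) := ⟨pow_ne_zero _ (Fact.out : p.Prime).ne_zero⟩
  rw [funext_iff]
  refine forall_congr' fun j => ?_
  have h := norm_le_iff_toZModPow p i (y j - ((a j).val : ℤ_[p]))
  rw [map_sub, map_natCast, ZMod.natCast_zmod_val, sub_eq_zero] at h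
  rw [← h, PadicInt.norm_def, PadicInt.coe_sub, PadicInt.coe_natCast]

theorem resBall_subset (p : ℕ) [Fact p.Prime] {n : ℕ} (i : ℕ) (a : Fin n → ZMod (p ^ i)) :
    resBall p i a ⊆ unitPolydisc p n := by
  intro x hx j
  have h1 : ‖x j - ((a j).val : ℚ_[p])‖ ≤ 1 := by
    refine (hx j).trans (zpow_le_one_of_nonpos₀ ?_ (by simp))
    exact_mod_cast (Fact.out : p.Prime).one_le
  have h2 : ‖((a j).val : ℚ_[p])‖ ≤ 1 := by
    have := Padic.norm_int_le_one (p := p) ((a j).val : ℤ)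
    exact_mod_cast this
  have h3 := Padic.nonarchimedean (x j - ((a j).val : ℚ_[p])) ((a j).val : ℚ_[p])
  rw [sub_add_cancel] at h3
  exact h3.trans (max_le h1 h2)

theorem exists_lift (p : ℕ) [Fact p.Prime] {n : ℕ} {x : Fin n → ℚ_[p]}
    (hx : x ∈ unitPolydisc p n) : ∃ y : Fin n → ℤ_[p], x = fun j => (y j : ℚ_[p]) :=
  ⟨fun j => ⟨x j, hx j⟩, rfl⟩

theorem measurableSet_resBall (p : ℕ) [Fact p.Prime] {n : ℕ} [MeasurableSpace ℚ_[p]]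
    [BorelSpace ℚ_[p]] (i : ℕ) (a : Fin n → ZMod (p ^ i)) : MeasurableSet (resBall p i a) := by
  have : IsClosed (resBall p i a) := by
    unfold resBall
    simp only [Set.ofPred_forall]
    exact isClosed_iInter fun j => isClosed_le (by fun_prop) (by fun_prop)
  exact this.measurableSet

theorem resBall_disjoint (p : ℕ) [Fact p.Prime] {n : ℕ} (i : ℕ) :
    Pairwise (Function.onFun Disjoint (resBall p (n := n) i)) := by
  intro a b hab
  rw [Function.onFun, Set.disjoint_left]
  intro x ha hb
  obtain ⟨y, rfl⟩ := exists_lift p (resBall_subset p i a ha)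
  rw [mem_resBall_iff] at ha hb
  exact hab (ha.symm.trans hb)

theorem unitPolydisc_eq (p : ℕ) [Fact p.Prime] (n : ℕ) (i : ℕ) :
    unitPolydisc p n = ⋃ a, resBall p (n := n) i a := by
  apply Set.Subset.antisymm
  · intro x hx
    obtain ⟨y, rfl⟩ := exists_lift p hx
    exact Set.mem_iUnion.2 ⟨_, (mem_resBall_iff p i _ y).2 rfl⟩
  · exact Set.iUnion_subset fun a => resBall_subset p i a

theorem measure_resBall_eq (p : ℕ) [Fact p.Prime] {n : ℕ} [MeasurableSpace ℚ_[p]]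
    [BorelSpace ℚ_[p]] (μ : Measure (Fin n → ℚ_[p])) [μ.IsAddHaarMeasure]
    (i : ℕ) (a : Fin n → ZMod (p ^ i)) : μ (resBall p i a) = μ (resBall p i 0) := by
  rw [← measure_preimage_add_right μ (-fun j => ((a j).val : ℚ_[p])) (resBall p i 0)]
  congr 1
  ext x
  simp [resBall, sub_eq_add_neg]

theorem measureReal_resBall (p : ℕ) [Fact p.Prime] {n : ℕ} [MeasurableSpace ℚ_[p]]
    [BorelSpace ℚ_[p]] (μ : Measure (Fin n → ℚ_[p])) [μ.IsAddHaarMeasure]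
    (hμ : μ (unitPolydisc p n) = 1) (i : ℕ) (a : Fin n → ZMod (p ^ i)) :
    μ.real (resBall p i a) = (((p : ℝ) ^ i) ^ n)⁻¹ := by
  have : NeZero (p ^ i) := ⟨pow_ne_zero _ (Fact.out : p.Prime).ne_zero⟩
  have h := hμ
  rw [unitPolydisc_eq p n i, measure_iUnion (resBall_disjoint p i)
    (fun a => measurableSet_resBall p i a), tsum_fintype] at h
  simp only [measure_resBall_eq p μ i, Finset.sum_const, Finset.card_univ] at h
  rw [Fintype.card_fun, ZMod.card, Fintype.card_fin, nsmul_eq_mul] at h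
  have h' := congrArg ENNReal.toReal h
  rw [ENNReal.toReal_mul] at h'
  rw [Measure.real, measure_resBall_eq p μ i a]
  apply eq_inv_of_mul_eq_one_right
  simpa using h'

/-- The points of the polydisc where `|f| ≤ p^{-i}`. -/
def smallSet (p : ℕ) [Fact p.Prime] {n : ℕ} (f : MvPolynomial (Fin n) ℤ) (i : ℕ) :
    Set (Fin n → ℚ_[p]) :=
  ⋃ a : {a : Fin n → ZMod (p ^ i) //
    eval a (MvPolynomial.map (Int.castRingHom (ZMod (p ^ i))) f) = 0}, resBall p i a.1

theorem mem_smallSet_iff (p : ℕ) [Fact p.Prime] {n : ℕ} (f : MvPolynomial (Fin n) ℤ) (i : ℕ)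
    (y : Fin n → ℤ_[p]) :
    (fun j => (y j : ℚ_[p])) ∈ smallSet p f i ↔
      ‖eval₂ (Int.castRingHom ℤ_[p]) y f‖ ≤ (p : ℝ) ^ (-(i : ℤ)) := by
  rw [norm_le_iff_toZModPow, eval₂_comp_left]
  simp only [smallSet, Set.mem_iUnion, mem_resBall_iff, Subtype.exists, eval_map]
  rw [RingHom.ext_int ((PadicInt.toZModPow i).comp (Int.castRingHom ℤ_[p]))
    (Int.castRingHom (ZMod (p ^ i)))]
  constructor
  · rintro ⟨a, ha, rfl⟩
    exact ha
  · intro h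
    exact ⟨_, h, rfl⟩

theorem measurableSet_smallSet (p : ℕ) [Fact p.Prime] {n : ℕ} [MeasurableSpace ℚ_[p]]
    [BorelSpace ℚ_[p]] (f : MvPolynomial (Fin n) ℤ) (i : ℕ) : MeasurableSet (smallSet p f i) := by
  have : NeZero (p ^ i) := ⟨pow_ne_zero _ (Fact.out : p.Prime).ne_zero⟩
  exact MeasurableSet.iUnion fun a => measurableSet_resBall p i a.1

theorem smallSet_subset (p : ℕ) [Fact p.Prime] {n : ℕ}
    (f : MvPolynomial (Fin n) ℤ) (i : ℕ) : smallSet p f i ⊆ unitPolydisc p n :=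
  Set.iUnion_subset fun a => resBall_subset p i a.1

theorem measureReal_smallSet (p : ℕ) [Fact p.Prime] {n : ℕ} [MeasurableSpace ℚ_[p]]
    [BorelSpace ℚ_[p]] (μ : Measure (Fin n → ℚ_[p])) [μ.IsAddHaarMeasure]
    (hμ : μ (unitPolydisc p n) = 1) (f : MvPolynomial (Fin n) ℤ) (i : ℕ) :
    μ.real (smallSet p f i) = zeroCount p f i * (((p : ℝ) ^ i) ^ n)⁻¹ := by
  classical
  have : NeZero (p ^ i) := ⟨pow_ne_zero _ (Fact.out : p.Prime).ne_zero⟩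
  have hfin : ∀ a : Fin n → ZMod (p ^ i), μ (resBall p i a) ≠ ⊤ := fun a =>
    ne_top_of_le_ne_top (by simp [hμ]) (measure_mono (resBall_subset p i a))
  have hd : Pairwise (Function.onFun Disjoint (fun a : {a : Fin n → ZMod (p ^ i) //
      eval a (MvPolynomial.map (Int.castRingHom (ZMod (p ^ i))) f) = 0} => resBall p i a.1)) :=
    fun a b hab => resBall_disjoint p i (fun h => hab (Subtype.ext h))
  have hm := measure_iUnion (μ := μ) hd (fun a => measurableSet_resBall p i a.1)
  unfold smallSet
  rw [Measure.real, hm, tsum_fintype,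
    ENNReal.toReal_sum (fun a _ => hfin a.1)]
  have := measureReal_resBall p μ hμ i
  simp only [Measure.real] at this
  simp only [this, Finset.sum_const, Finset.card_univ, nsmul_eq_mul, zeroCount,
    Nat.card_eq_fintype_card]

theorem smallSet_zero (p : ℕ) [Fact p.Prime] {n : ℕ} (f : MvPolynomial (Fin n) ℤ) :
    smallSet p f 0 = unitPolydisc p n := by
  refine (smallSet_subset p f 0).antisymm fun x hx => ?_
  obtain ⟨y, rfl⟩ := exists_lift p hx
  rw [mem_smallSet_iff]
  simpa using PadicInt.norm_le_one _

theorem norm_t_lt (p : ℕ) [hp : Fact p.Prime] {s : ℂ} (hs : 0 < s.re) :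
    ‖(p : ℂ) ^ (-s)‖ < 1 := by
  rw [Complex.norm_natCast_cpow_of_pos hp.out.pos]
  apply Real.rpow_lt_one_of_one_lt_of_neg
  · exact_mod_cast hp.out.one_lt
  · simpa using hs

theorem pointwise (p : ℕ) [hp : Fact p.Prime] {n : ℕ} (f : MvPolynomial (Fin n) ℤ)
    {s : ℂ} (hs : 0 < s.re) {x : Fin n → ℚ_[p]} (hx : x ∈ unitPolydisc p n) :
    padicPow p s (eval x (MvPolynomial.map (Int.castRingHom ℚ_[p]) f)) * (p : ℂ) ^ (-s) =
      ((p : ℂ) ^ (-s) - 1) *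
        (∑' i : ℕ, (smallSet p f i).indicator (fun _ => ((p : ℂ) ^ (-s)) ^ i) x) + 1 := by
  classical
  have ht := norm_t_lt p hs
  have hpow : ∀ k : ℕ, (p : ℂ) ^ (-s * (k : ℂ)) = ((p : ℂ) ^ (-s)) ^ k := fun k =>
    Complex.cpow_mul_nat _ _ _
  unfold padicPow
  generalize (p : ℂ) ^ (-s) = t at *
  have ht1 : 1 - t ≠ 0 := by
    intro h
    rw [← sub_eq_zero.1 h] at ht
    simp at ht
  obtain ⟨y, rfl⟩ := exists_lift p hx
  have he : eval (fun j => (y j : ℚ_[p])) (MvPolynomial.map (Int.castRingHom ℚ_[p]) f) =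
      ((eval₂ (Int.castRingHom ℤ_[p]) y f : ℤ_[p]) : ℚ_[p]) := by
    have := eval₂_comp_left (PadicInt.Coe.ringHom (p := p)) (Int.castRingHom ℤ_[p]) y f
    rw [RingHom.ext_int ((PadicInt.Coe.ringHom (p := p)).comp (Int.castRingHom ℤ_[p]))
      (Int.castRingHom ℚ_[p])] at this
    rw [eval_map]
    exact this.symm
  rw [he]
  simp only [Set.indicator_apply, mem_smallSet_iff]
  generalize eval₂ (Int.castRingHom ℤ_[p]) y f = z
  by_cases hz : z = 0
  · subst hz
    have : ∀ i : ℕ, (0 : ℝ) ≤ (p : ℝ) ^ (-(i : ℤ)) := fun i => by positivity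
    simp only [norm_zero, this, if_true, tsum_geometric_of_norm_lt_one ht]
    simp
    field_simp
    ring
  · have hz' : (z : ℚ_[p]) ≠ 0 := by simpa using hz
    simp only [PadicInt.norm_le_pow_iff_le_valuation z hz, hz', if_false, PadicInt.valuation_coe]
    rw [Int.cast_natCast, hpow, tsum_eq_sum (s := Finset.range (z.valuation + 1))]
    · rw [Finset.sum_congr rfl (g := fun i => t ^ i), mul_geom_sum]
      · ring
      · intro i hi
        rw [if_pos (Nat.lt_succ_iff.1 (Finset.mem_range.1 hi))]
    · intro i hi
      rw [if_neg]
      intro h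
      exact hi (Finset.mem_range.2 (Nat.lt_succ_of_le h))

theorem stmt11 (p : ℕ) [Fact p.Prime] {n : ℕ}
    [MeasurableSpace ℚ_[p]] [BorelSpace ℚ_[p]]
    (μ : Measure (Fin n → ℚ_[p])) [μ.IsAddHaarMeasure]
    (hμ : μ (unitPolydisc p n) = 1)
    (f : MvPolynomial (Fin n) ℤ) (hf : 0 < f.totalDegree) :
    ∀ s : ℂ, 0 < s.re →
      Summable (fun i : ℕ =>
        ‖(zeroCount p f (i + 1) : ℂ) * (p : ℂ) ^ (-((n : ℂ) * ((i : ℂ) + 1))) *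
          ((p : ℂ) ^ (-s)) ^ (i + 1)‖) ∧
      padicZeta p μ (MvPolynomial.map (Int.castRingHom ℚ_[p]) f) s =
        (((p : ℂ) ^ (-s) - 1) *
            (1 + ∑' i : ℕ, (zeroCount p f (i + 1) : ℂ) *
              (p : ℂ) ^ (-((n : ℂ) * ((i : ℂ) + 1))) * ((p : ℂ) ^ (-s)) ^ (i + 1)) + 1) /
          (p : ℂ) ^ (-s) := by
  intro s hs
  have hp : p.Prime := Fact.out
  have hp0 : (p : ℂ) ≠ 0 := by exact_mod_cast hp.ne_zero
  have ht := norm_t_lt p hs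
  have ht0 : (p : ℂ) ^ (-s) ≠ 0 := by simp [Complex.cpow_eq_zero_iff, hp0]
  have hterm : ∀ i : ℕ, (zeroCount p f (i + 1) : ℂ) * (p : ℂ) ^ (-((n : ℂ) * ((i : ℂ) + 1))) *
      ((p : ℂ) ^ (-s)) ^ (i + 1) =
      (μ.real (smallSet p f (i + 1)) : ℂ) * ((p : ℂ) ^ (-s)) ^ (i + 1) := by
    intro i
    rw [measureReal_smallSet p μ hμ]
    push_cast
    congr 2
    rw [Complex.cpow_neg, ← pow_mul, ← Complex.cpow_natCast]
    push_cast
    ring_nf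
  simp only [hterm]
  unfold padicZeta
  have hpt := fun x hx => pointwise p f hs (x := x) hx
  generalize (p : ℂ) ^ (-s) = t at *
  have hUm : MeasurableSet (unitPolydisc p n) := by
    rw [← smallSet_zero p f]
    exact measurableSet_smallSet p f 0
  have hle : ∀ i, μ.real (smallSet p f i) ≤ 1 := by
    intro i
    have h := measureReal_mono (μ := μ) (smallSet_subset p f i) (by simp [hμ])
    simpa [Measure.real, hμ] using h
  have hfull : Summable fun i : ℕ => μ.real (smallSet p f i) * ‖t‖ ^ i := by
    refine Summable.of_nonneg_of_le (fun i => by positivity) (fun i => ?_)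
      (summable_geometric_of_lt_one (norm_nonneg t) ht)
    exact mul_le_of_le_one_left (by positivity) (hle i)
  have hnorm : ∀ i : ℕ, ‖(μ.real (smallSet p f i) : ℂ) * t ^ i‖ =
      μ.real (smallSet p f i) * ‖t‖ ^ i := by
    intro i
    rw [norm_mul, norm_pow, Complex.norm_real, Real.norm_of_nonneg measureReal_nonneg]
  have hfullC : Summable fun i : ℕ => (μ.real (smallSet p f i) : ℂ) * t ^ i := by
    apply Summable.of_norm
    simpa only [hnorm] using hfull
  refine ⟨?_, ?_⟩
  · simp only [hnorm]
    exact (summable_nat_add_iff 1).2 hfull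
  have hfinU : IsFiniteMeasure (μ.restrict (unitPolydisc p n)) := ⟨by simp [hμ]⟩
  have hrestr : ∀ i, (μ.restrict (unitPolydisc p n)).real (smallSet p f i) =
      μ.real (smallSet p f i) := by
    intro i
    rw [measureReal_restrict_apply (measurableSet_smallSet p f i),
      Set.inter_eq_left.2 (smallSet_subset p f i)]
  have hint : ∀ i : ℕ, Integrable ((smallSet p f i).indicator (fun _ => t ^ i))
      (μ.restrict (unitPolydisc p n)) := fun i =>
    (integrable_const _).indicator (measurableSet_smallSet p f i)
  have hI : ∀ i : ℕ, ∫ x in unitPolydisc p n, (smallSet p f i).indicator (fun _ => t ^ i) x ∂μ =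
      (μ.real (smallSet p f i) : ℂ) * t ^ i := by
    intro i
    rw [integral_indicator_const _ (measurableSet_smallSet p f i), hrestr, Complex.real_smul]
  have hIn : ∀ i : ℕ,
      ∫ x in unitPolydisc p n, ‖(smallSet p f i).indicator (fun _ => t ^ i) x‖ ∂μ =
      μ.real (smallSet p f i) * ‖t‖ ^ i := by
    intro i
    simp only [norm_indicator_eq_indicator_norm]
    rw [integral_indicator_const _ (measurableSet_smallSet p f i), hrestr, smul_eq_mul, norm_pow]
  have hsumnorm : Summable fun i : ℕ =>
      ∫ x in unitPolydisc p n, ‖(smallSet p f i).indicator (fun _ => t ^ i) x‖ ∂μ := by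
    simpa only [hIn] using hfull
  have hS := (hasSum_integral_of_summable_integral_norm hint hsumnorm).tsum_eq
  have hP : 1 + ∑' i : ℕ, (μ.real (smallSet p f (i + 1)) : ℂ) * t ^ (i + 1) =
      ∫ x in unitPolydisc p n,
        (∑' i : ℕ, (smallSet p f i).indicator (fun _ => t ^ i) x) ∂μ := by
    rw [← hS]
    simp only [hI]
    rw [hfullC.tsum_eq_zero_add, smallSet_zero]
    simp [Measure.real, hμ]
  rw [eq_div_iff ht0, hP, ← integral_mul_const, setIntegral_congr_fun hUm hpt,
    integral_add, integral_const_mul]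
  · simp [Measure.real, hμ]
  · apply Integrable.const_mul
    have hb : ∀ x (i : ℕ), ‖(smallSet p f i).indicator (fun _ => t ^ i) x‖ ≤ ‖t‖ ^ i := by
      intro x i
      rw [← norm_pow]
      exact norm_indicator_le_norm_self _ _
    have hg := hasSum_geometric_of_lt_one (norm_nonneg t) ht
    refine Integrable.of_bound (C := (1 - ‖t‖)⁻¹) (Measurable.aestronglyMeasurable ?_)
      (Filter.Eventually.of_forall fun x => tsum_of_norm_bounded hg (hb x))
    refine measurable_of_tendsto_metrizable
      (f := fun N x => ∑ i ∈ Finset.range N, (smallSet p f i).indicator (fun _ => t ^ i) x) ?_ ?_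
    · intro N
      exact Finset.measurable_sum _ fun i _ =>
        measurable_const.indicator (measurableSet_smallSet p f i)
    · rw [tendsto_pi_nhds]
      intro x
      exact (hg.summable.of_norm_bounded (hb x)).hasSum.tendsto_sum_nat
  · exact integrable_const _
end
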